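/- arXiv:0806.4009 — 3 statements merged into one kernel-verified Lean document; each statement's English description precedes it below -/
import Mathlib

section
/- For every closed surface S there exists a natural number n such that the complete bipartite graph K_{3,n} admits no topological embedding into S; that is, there do not exist distinct points a₁, a₂, a₃ ∈ S, distinct points b₁, …, bₙ ∈ S with {a₁,a₂,a₃} ∩ {b₁,…,bₙ} = ∅, together with arcs A_{ij} ⊆ S for 1 ≤ i ≤ 3 and 1 ≤ j ≤ n such that A_{ij} has endpoints aᵢ and bⱼ and the interiors Int(A_{ij}) are pairwise disjoint and disjoint from the set {a₁,a₂,a₃,b₁,…,bₙ}. -/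
open Set Metric Filter Topology

/-- A space is locally homeomorphic to ℝ²: every point has an open
neighborhood homeomorphic to the Euclidean plane. -/
def LocallyEuclidean2 (S : Type*) [TopologicalSpace S] : Prop :=
  ∀ x : S, ∃ U : Set S, IsOpen U ∧ x ∈ U ∧
    Nonempty (U ≃ₜ EuclideanSpace ℝ (Fin 2))

section Defs

variable {S : Type*} [TopologicalSpace S]

/-- A continuum: a nonempty compact connected subset. -/
def IsContinuum (X : Set S) : Prop := IsCompact X ∧ IsConnected X

/-- A complementary domain of `X`: a connected component of the complement of `X`. -/
def IsComplementaryDomain (X U : Set S) : Prop :=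
  ∃ x, x ∉ X ∧ U = connectedComponentIn Xᶜ x

/-- A proper subcontinuum of `X`. -/
def IsProperSubcontinuum (X A : Set S) : Prop :=
  A.Nonempty ∧ IsClosed A ∧ IsConnected A ∧ A ⊆ X ∧ A ≠ X

/-- `X` is decomposable: the union of two proper subcontinua. -/
def IsDecomposable (X : Set S) : Prop :=
  ∃ A B, IsProperSubcontinuum X A ∧ IsProperSubcontinuum X B ∧ A ∪ B = X

/-- `X` is the essential union of three proper subcontinua. -/
def IsEssentialUnionOfThree (X : Set S) : Prop :=
  ∃ X₁ X₂ X₃, IsProperSubcontinuum X X₁ ∧ IsProperSubcontinuum X X₂ ∧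
    IsProperSubcontinuum X X₃ ∧ X₁ ∪ X₂ ∪ X₃ = X ∧
    ¬ X₁ ⊆ X₂ ∪ X₃ ∧ ¬ X₂ ⊆ X₁ ∪ X₃ ∧ ¬ X₃ ⊆ X₁ ∪ X₂

/-- `X` is 2-indecomposable: decomposable but not the essential union of
three proper subcontinua. -/
def Is2Indecomposable (X : Set S) : Prop :=
  IsDecomposable X ∧ ¬ IsEssentialUnionOfThree X

/-- `X` is shielded: no complementary domain has frontier equal to `X`. -/
def IsShielded (X : Set S) : Prop :=
  ∀ U, IsComplementaryDomain X U → frontier U ≠ X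

/-- A generalized crosscut of `U`. -/
def IsGenCrosscut (U A : Set S) : Prop :=
  A ⊆ U ∧ Nonempty (A ≃ₜ Set.Ioo (0:ℝ) 1) ∧ closure A \ A ⊆ frontier U

/-- `T` is a shadow of the (generalized) crosscut `A` of `U`. -/
def IsShadowOf (U A T : Set S) : Prop :=
  ∃ x ∈ U \ A, T = closure (connectedComponentIn (U \ A) x) ∩ frontier U

/-- An arc with endpoints `a` and `b`. -/
def IsArcFrom (A : Set S) (a b : S) : Prop :=
  ∃ f : Set.Icc (0:ℝ) 1 → S, Continuous f ∧ Function.Injective f ∧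
    Set.range f = A ∧ f ⟨0, by norm_num⟩ = a ∧ f ⟨1, by norm_num⟩ = b

/-- A crosscut of `U`: a copy of `(0,1)` in `U` whose closure is an arc
meeting the frontier of `U` exactly at the endpoints of the arc. -/
def IsCrosscut (U K : Set S) : Prop :=
  K ⊆ U ∧ Nonempty (K ≃ₜ Set.Ioo (0:ℝ) 1) ∧
    ∃ a b, IsArcFrom (closure K) a b ∧ closure K ∩ frontier U = {a, b}

/-- A closed disk: a set homeomorphic to the closed unit disk in ℝ². -/
def IsClosedDisk (D : Set S) : Prop :=
  Nonempty (D ≃ₜ Metric.closedBall (0 : EuclideanSpace ℝ (Fin 2)) 1)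

/-- A cat's cradle between `d₁` and `d₃`: a family of arcs from `d₁` to `d₃`
whose interiors are pairwise disjoint. -/
def IsCatsCradle {ι : Type*} (d₁ d₃ : S) (A : ι → Set S) : Prop :=
  (∀ i, IsArcFrom (A i) d₁ d₃) ∧
    Pairwise fun i j => (A i \ {d₁, d₃}) ∩ (A j \ {d₁, d₃}) = ∅

/-- A cat's cradle between `d₁` and `d₃` through `D₂`. -/
def IsCatsCradleThrough {ι : Type*} (d₁ d₃ : S) (D₂ : Set S) (A : ι → Set S) : Prop :=
  IsCatsCradle d₁ d₃ A ∧ D₂ ∩ {d₁, d₃} = ∅ ∧ ∀ i, (A i ∩ D₂).Nonempty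

/-- A chord of the closed disk `D`: an arc in `D` meeting the frontier of `D`
exactly at its two endpoints. -/
def IsChord (D A : Set S) : Prop :=
  ∃ a b, IsArcFrom A a b ∧ A ⊆ D ∧ A ∩ frontier D = {a, b}

/-- A sequence of pairwise disjoint chords of `D` is linearly ordered if each
middle chord separates the earlier ones from the later ones in `D`. -/
def LinearlyOrderedChords (D : Set S) (A : ℕ → Set S) : Prop :=
  (Pairwise fun i j => Disjoint (A i) (A j)) ∧
    ∀ i j k, i < j → j < k → ∀ x ∈ A i, ∀ y ∈ A k,
      connectedComponentIn (D \ A j) x ≠ connectedComponentIn (D \ A j) y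

end Defs

section MetricDefs

variable {S : Type*} [MetricSpace S]

/-- Convergence of a sequence of sets to `X` in the Hausdorff metric. -/
def HausdorffConvergesTo (A : ℕ → Set S) (X : Set S) : Prop :=
  Tendsto (fun n => hausdorffDist (A n) X) atTop (𝓝 0)

/-- The double-pass condition for a sequence of domains. -/
def DoublePassCondition (X : Set S) (U : ℕ → Set S) : Prop :=
  ∀ K : ℕ → Set S, (∀ n, IsGenCrosscut (U n) (K n)) →
    ∃ Sh : ℕ → Set S, (∀ n, IsShadowOf (U n) (K n) (Sh n)) ∧ HausdorffConvergesTo Sh X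

/-- The double-pass condition with (genuine) crosscuts. -/
def DoublePassConditionCrosscuts (X : Set S) (U : ℕ → Set S) : Prop :=
  ∀ K : ℕ → Set S, (∀ n, IsCrosscut (U n) (K n)) →
    ∃ Sh : ℕ → Set S, (∀ n, IsShadowOf (U n) (K n) (Sh n)) ∧ HausdorffConvergesTo Sh X

end MetricDefs


namespace K3n
open Complex

/-- Tietze extension for functions which are continuous on a closed set. -/
theorem tietze {X : Type*} [TopologicalSpace X] [NormalSpace X] {s : Set X} (hs : IsClosed s)
    {f : X → ℂ} (hf : ContinuousOn f s) : ∃ g : X → ℂ, Continuous g ∧ ∀ x ∈ s, g x = f x := by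
  obtain ⟨g, hg⟩ := ContinuousMap.exists_restrict_eq hs
    (⟨fun x : s => f x, continuousOn_iff_continuous_domRestrict.1 hf⟩ : C(s, ℂ))
  refine ⟨g, g.continuous, fun x hx => ?_⟩
  have := congrArg (fun h : C(s, ℂ) => h ⟨x, hx⟩) hg
  exact this

/-- Nonvanishing functions on a simply connected space have continuous logarithms. -/
theorem exists_log {A : Type*} [TopologicalSpace A] [SimplyConnectedSpace A]
    [LocallyPathConnectedSpace A] (f : A → ℂ) (hf : Continuous f) (h0 : ∀ z, f z ≠ 0) :
    ∃ φ : A → ℂ, Continuous φ ∧ ∀ z, f z = exp (φ z) := by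
  obtain ⟨a⟩ : Nonempty A := inferInstance
  obtain ⟨F, ⟨-, hF⟩, -⟩ := isCoveringMapOn_exp.existsUnique_continuousMap_lifts
    (⟨f, hf⟩ : C(A, ℂ)) (a₀ := a) (exp_log (h0 a)) (fun z => h0 z)
  exact ⟨F, F.continuous, fun z => (congrFun hF z).symm⟩

theorem exists_log_real (f : ℝ → ℂ) (hf : Continuous f) (h0 : ∀ z, f z ≠ 0) :
    ∃ φ : ℝ → ℂ, Continuous φ ∧ ∀ z, f z = exp (φ z) := exists_log f hf h0

theorem exists_log_complex (f : ℂ → ℂ) (hf : Continuous f) (h0 : ∀ z, f z ≠ 0) :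
    ∃ φ : ℂ → ℂ, Continuous φ ∧ ∀ z, f z = exp (φ z) := exists_log f hf h0

/-- Two logarithms on a preconnected set differ by a constant. -/
theorem log_unique {X : Type*} [TopologicalSpace X] {B : Set X} (hB : IsPreconnected B)
    {φ ψ : X → ℂ} (hφ : ContinuousOn φ B) (hψ : ContinuousOn ψ B)
    (h : ∀ x ∈ B, exp (φ x) = exp (ψ x)) :
    ∃ n : ℤ, ∀ x ∈ B, φ x = ψ x + n * (2 * Real.pi * I) := by
  rcases B.eq_empty_or_nonempty with rfl | ⟨b, hb⟩
  · exact ⟨0, by simp⟩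
  have h2 : ∀ x ∈ B, ∃ n : ℤ, φ x = ψ x + n * (2 * Real.pi * I) :=
    fun x hx => exp_eq_exp_iff_exists_int.1 (h x hx)
  have hpi : (2 * Real.pi : ℝ) ≠ 0 := by positivity
  -- the real-valued function
  let u : X → ℝ := fun x => ((φ x - ψ x) / (2 * Real.pi * I)).re
  have hu : ContinuousOn u B := by
    apply continuous_re.comp_continuousOn
    exact (hφ.sub hψ).div_const _
  have hne : (2 * Real.pi * I : ℂ) ≠ 0 := by simp [Real.pi_ne_zero]
  have huv : ∀ x ∈ B, ∀ n : ℤ, φ x = ψ x + n * (2 * Real.pi * I) → u x = n := by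
    intro x hx n hn
    have : (φ x - ψ x) / (2 * Real.pi * I) = (n : ℂ) := by
      rw [hn]; field_simp; ring
    simp only [u, this]; simp
  obtain ⟨n, hn⟩ := h2 b hb
  refine ⟨n, fun x hx => ?_⟩
  obtain ⟨m, hm⟩ := h2 x hx
  suffices m = n by rw [hm, this]
  by_contra hmn
  have hpre : IsPreconnected (u '' B) := hB.image u hu
  have hsub : u '' B ⊆ range ((↑) : ℤ → ℝ) := by
    rintro _ ⟨y, hy, rfl⟩
    obtain ⟨k, hk⟩ := h2 y hy
    exact ⟨k, (huv y hy k hk).symm⟩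
  have hcount : (range ((↑) : ℤ → ℝ)).Countable := countable_range _
  have hss : (u '' B).Subsingleton := (hcount.mono hsub).isTotallyDisconnected _ Subset.rfl hpre
  have := hss (mem_image_of_mem u hx) (mem_image_of_mem u hb)
  rw [huv x hx m hm, huv b hb n hn] at this
  exact hmn (by exact_mod_cast this)

theorem circle_ne {r : ℝ} (hr : 0 < r) (θ : ℝ) : (r : ℂ) * exp (θ * I) ∈ sphere (0 : ℂ) r := by
  simp [Complex.norm_exp_ofReal_mul_I, abs_of_pos hr]

/-- Every nonvanishing function on a circle is `z ^ d * exp ψ`. -/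
theorem circle_degree {r : ℝ} (hr : 0 < r) {f : ℂ → ℂ} (hf : ContinuousOn f (sphere 0 r))
    (h0 : ∀ z ∈ sphere (0 : ℂ) r, f z ≠ 0) :
    ∃ (d : ℤ) (ψ : ℂ → ℂ), ContinuousOn ψ (sphere 0 r) ∧
      ∀ z ∈ sphere (0 : ℂ) r, f z = z ^ d * exp (ψ z) := by
  obtain ⟨Ψ, hΨ, hf'⟩ := exists_log_real (fun θ : ℝ => f (r * exp (θ * I)))
    (hf.comp_continuous (by fun_prop) (circle_ne hr)) (fun θ => h0 _ (circle_ne hr θ))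
  have hper : ∀ θ : ℝ, exp (((θ + 2 * Real.pi : ℝ) : ℂ) * I) = exp (θ * I) := by
    intro θ
    rw [show (((θ + 2 * Real.pi : ℝ) : ℂ) * I) = θ * I + 2 * Real.pi * I by push_cast; ring]
    rw [Complex.exp_periodic]
  obtain ⟨d, hd⟩ := log_unique (isPreconnected_univ (α := ℝ))
    (φ := fun θ => Ψ (θ + 2 * Real.pi)) (ψ := Ψ) (by fun_prop) (by fun_prop) (by
      intro θ _
      rw [← hf', ← hf', hper])
  let N : ℝ → ℂ := fun θ => Ψ θ - d * (Real.log r + θ * I)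
  have hN : Function.Periodic N (2 * Real.pi) := by
    intro θ
    simp only [N]
    rw [hd θ (mem_univ _)]
    push_cast
    ring
  have hNc : Continuous N := by fun_prop
  let M : Real.Angle → ℂ := hN.lift
  have hM : Continuous M := by
    exact hNc.quotient_lift _
  refine ⟨d, fun z => M (arg z), ?_, ?_⟩
  · intro z hz
    have hz0 : z ≠ 0 := by
      rintro rfl; simp at hz; exact hr.ne hz
    exact (hM.continuousAt.comp (continuousAt_arg_coe_angle hz0)).continuousWithinAt
  · intro z hz
    have hz' : ‖z‖ = r := by simpa using hz
    have hz0 : z ≠ 0 := by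
      rintro rfl; simp at hz; exact hr.ne hz
    have e1 : M (arg z) = N (arg z) := hN.lift_coe _
    have e2 : (r : ℂ) * exp (arg z * I) = z := by rw [← hz']; exact norm_mul_exp_arg_mul_I z
    have e3 := hf' (arg z)
    simp only [e2] at e3
    simp only [e1, e3, N]
    have e4 : z = exp (Real.log r + arg z * I) := by
      rw [Complex.exp_add, ← Complex.ofReal_exp, Real.exp_log hr, e2]
    have e5 : z ^ d = exp (d * (Real.log r + arg z * I)) := by
      conv_lhs => rw [e4]
      rw [← Complex.exp_int_mul]
    rw [e5, ← Complex.exp_add]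
    congr 1; ring

/-- `z ^ k` has no logarithm on a circle, unless `k = 0`. -/
theorem circle_no_log {r : ℝ} (hr : 0 < r) {k : ℤ} {φ : ℂ → ℂ} (hφ : ContinuousOn φ (sphere 0 r))
    (h : ∀ z ∈ sphere (0 : ℂ) r, z ^ k = exp (φ z)) : k = 0 := by
  obtain ⟨n, hn⟩ := log_unique (isPreconnected_univ (α := ℝ))
    (φ := fun θ : ℝ => φ (r * exp (θ * I))) (ψ := fun θ : ℝ => k * (Real.log r + θ * I))
    ((hφ.comp_continuous (by fun_prop) (circle_ne hr)).continuousOn) (by fun_prop) (by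
      intro θ _
      rw [← h _ (circle_ne hr θ), Complex.exp_int_mul, Complex.exp_add, ← Complex.ofReal_exp,
        Real.exp_log hr])
  have h1 := hn 0 (mem_univ _)
  have h2 := hn (2 * Real.pi) (mem_univ _)
  have e : exp (((2 * Real.pi : ℝ) : ℂ) * I) = exp (((0 : ℝ) : ℂ) * I) := by
    push_cast; simp
  simp only [e] at h2
  rw [h1] at h2
  have h3 : (k : ℂ) * (2 * Real.pi * I) = 0 := by
    push_cast at h2
    linear_combination -h2
  have hne : (2 * Real.pi * I : ℂ) ≠ 0 := by simp [Real.pi_ne_zero]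
  exact_mod_cast (mul_eq_zero.1 h3).resolve_right hne

/-- `(z - p) / (z - x)` has a logarithm when `p` is closer to `x` than `z`. -/
theorem ratio_log {x p : ℂ} {r : ℝ} (hp : ‖p - x‖ < r) :
    ∃ μ : ℂ → ℂ, ContinuousOn μ {z | r ≤ ‖z - x‖} ∧
      ∀ z, r ≤ ‖z - x‖ → z - p = (z - x) * exp (μ z) := by
  have hr : 0 < r := (norm_nonneg _).trans_lt hp
  have hs : ∀ z, r ≤ ‖z - x‖ → z - x ≠ 0 := fun z hz h => by
    rw [h] at hz; simp at hz; linarith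
  have hslit : ∀ z, r ≤ ‖z - x‖ → (z - p) / (z - x) ∈ slitPlane := by
    intro z hz
    have h1 := hs z hz
    have h2 : (z - p) / (z - x) = 1 + (-((p - x) / (z - x))) := by field_simp; ring
    rw [h2]
    apply Complex.mem_slitPlane_of_norm_lt_one
    rw [norm_neg, norm_div, div_lt_one (norm_pos_iff.2 h1)]
    linarith
  refine ⟨fun z => log ((z - p) / (z - x)), ?_, ?_⟩
  · apply ContinuousOn.clog
    · exact ContinuousOn.div (by fun_prop) (by fun_prop) (fun z hz => hs z hz)
    · exact fun z hz => hslit z hz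
  · intro z hz
    have h1 := hs z hz
    rw [exp_log (slitPlane_ne_zero (hslit z hz))]
    field_simp

end K3n


namespace K3n
open Complex

/-- The frontier of a component of an open set lies outside the set. -/
theorem frontier_component {X : Type*} [TopologicalSpace X] [LocallyConnectedSpace X] {O : Set X}
    (hO : IsOpen O) (p : X) : frontier (connectedComponentIn O p) ⊆ Oᶜ := by
  intro y hy hyO
  have hop : IsOpen (connectedComponentIn O p) := hO.connectedComponentIn
  have h1 : y ∈ closure (connectedComponentIn O p) := frontier_subset_closure hy
  have h2 : (connectedComponentIn O y ∩ connectedComponentIn O p).Nonempty :=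
    mem_closure_iff.1 h1 _ hO.connectedComponentIn (mem_connectedComponentIn hyO)
  obtain ⟨z, hz1, hz2⟩ := h2
  have e : connectedComponentIn O y = connectedComponentIn O p := by
    rw [connectedComponentIn_eq hz1, connectedComponentIn_eq hz2]
  have : y ∈ connectedComponentIn O p := e ▸ mem_connectedComponentIn hyO
  rw [hop.frontier_eq] at hy
  exact hy.2 this

theorem borsuk {W : Set ℂ} (hW : IsOpen W) (hbd : Bornology.IsBounded W) {p : ℂ} (hp : p ∈ W)
    {k : ℤ} {u φ : ℂ → ℂ} (hu : ContinuousOn u (closure W)) (hu0 : ∀ z ∈ closure W, u z ≠ 0)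
    (hφ : ContinuousOn φ (frontier W))
    (h : ∀ z ∈ frontier W, (z - p) ^ k * u z = exp (φ z)) : k = 0 := by
  classical
  obtain ⟨Φ, hΦ, hΦe⟩ := tietze isClosed_frontier hφ
  have hne : ∀ z ∉ W, z - p ≠ 0 := fun z hz h => hz (by rw [sub_eq_zero.1 h]; exact hp)
  let H : ℂ → ℂ := W.piecewise (fun z => u z * exp (-Φ z)) (fun z => (z - p) ^ (-k))
  have hH : Continuous H := by
    apply continuous_piecewise
    · intro z hz
      have hz' : z ∉ W := by rw [hW.frontier_eq] at hz; exact hz.2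
      have h1 := h z hz
      rw [← hΦe z hz] at h1
      have h2 : (z - p) ^ k ≠ 0 := zpow_ne_zero _ (hne z hz')
      rw [zpow_neg, Complex.exp_neg, ← h1]
      have h3 := hu0 z (frontier_subset_closure hz)
      field_simp
    · exact hu.mul (by fun_prop)
    · rw [hW.isClosed_compl.closure_eq]
      apply ContinuousOn.zpow₀ (by fun_prop)
      exact fun z hz => Or.inl (hne z hz)
  have hH0 : ∀ z, H z ≠ 0 := by
    intro z
    by_cases hz : z ∈ W
    · simp only [H, piecewise_eq_of_mem _ _ _ hz]
      exact mul_ne_zero (hu0 z (subset_closure hz)) (Complex.exp_ne_zero _)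
    · simp only [H, piecewise_eq_of_notMem _ _ _ hz]
      exact zpow_ne_zero _ (hne z hz)
  obtain ⟨L, hL, hHL⟩ := exists_log_complex H hH hH0
  obtain ⟨ρ, hρ0, hρ⟩ : ∃ ρ : ℝ, 0 < ρ ∧ W ⊆ ball p ρ := by
    obtain ⟨ρ, hρ⟩ := hbd.subset_ball p
    exact ⟨max ρ 1, by positivity, hρ.trans (ball_subset_ball (le_max_left _ _))⟩
  have := circle_no_log hρ0 (k := -k) (φ := fun z => L (z + p)) (by fun_prop) (by
    intro z hz
    have hzW : z + p ∉ W := fun hh => by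
      have := hρ hh
      simp at hz this
      rw [hz] at this
      exact lt_irrefl _ this
    rw [← hHL]
    simp only [H, piecewise_eq_of_notMem _ _ _ hzW, add_sub_cancel_right])
  omega

/-- Core computation: a logarithm of `(z - p) ^ k * u` on `A` matching a logarithm outside
the ball `ball x R`. -/
theorem sep_core {A : Set ℂ} (hA : IsClosed A) {x p : ℂ} {R : ℝ} (hp : p ∈ ball x R \ A) {k : ℤ}
    {u lam mu : ℂ → ℂ}
    (hu : ContinuousOn u (closure (connectedComponentIn (ball x R \ A) p)))
    (hu0 : ∀ z ∈ closure (connectedComponentIn (ball x R \ A) p), u z ≠ 0)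
    (hlam : ContinuousOn lam A) (hmu : ContinuousOn mu (ball x R)ᶜ)
    (h1 : ∀ z ∈ A, (z - p) ^ k * u z = exp (lam z))
    (h2 : ∀ z ∈ (ball x R)ᶜ, (z - p) ^ k * u z = exp (mu z))
    (h12 : ∀ z ∈ A, z ∈ (ball x R)ᶜ → lam z = mu z) : k = 0 := by
  classical
  have hO : IsOpen (ball x R \ A) := isOpen_ball.sdiff hA
  have hfr : frontier (connectedComponentIn (ball x R \ A) p) ⊆ A ∪ (ball x R)ᶜ := by
    intro z hz
    have := frontier_component hO p hz
    simp only [mem_compl_iff, Set.mem_sdiff, not_and, not_not] at this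
    by_cases hzb : z ∈ ball x R
    · exact Or.inl (this hzb)
    · exact Or.inr hzb
  let φ : ℂ → ℂ := fun z => if z ∈ A then lam z else mu z
  have eA : ∀ z ∈ A, φ z = lam z := fun z hz => by simp [φ, hz]
  have eB : ∀ z ∈ (ball x R)ᶜ, φ z = mu z := fun z hz => by
    by_cases hzA : z ∈ A
    · simp only [φ, hzA, if_true]; exact h12 z hzA hz
    · simp [φ, hzA]
  have hφ : ContinuousOn φ (A ∪ (ball x R)ᶜ) :=
    ContinuousOn.union_of_isClosed (hlam.congr eA) (hmu.congr eB) hA isOpen_ball.isClosed_compl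
  refine borsuk (φ := φ) hO.connectedComponentIn
    (isBounded_ball.subset ((connectedComponentIn_subset _ _).trans sdiff_subset))
    (mem_connectedComponentIn hp) hu hu0 (hφ.mono hfr) ?_
  intro z hz
  rcases hfr hz with h | h
  · rw [eA z h, h1 z h]
  · rw [eB z h, h2 z h]

/-- Every nonvanishing continuous function on `A` has a logarithm. -/
def HasLogs (A : Set ℂ) : Prop :=
  ∀ f : ℂ → ℂ, ContinuousOn f A → (∀ z ∈ A, f z ≠ 0) →
    ∃ l : ℂ → ℂ, ContinuousOn l A ∧ ∀ z ∈ A, f z = exp (l z)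

theorem not_mem_closure_comp {A : Set ℂ} (hA : IsClosed A) {x p q : ℂ} {R : ℝ}
    (hq : q ∈ ball x R \ A) (h : q ∉ connectedComponentIn (ball x R \ A) p) :
    q ∉ closure (connectedComponentIn (ball x R \ A) p) := by
  intro hc
  have hO : IsOpen (ball x R \ A) := isOpen_ball.sdiff hA
  have : q ∈ frontier (connectedComponentIn (ball x R \ A) p) := by
    rw [hO.connectedComponentIn.frontier_eq]; exact ⟨hc, h⟩
  exact frontier_component hO p this hq

theorem planar_two {A A₁ B : Set ℂ} (hA : IsClosed A) (hlog : HasLogs A) {x : ℂ} {r R : ℝ}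
    (hrR : r ≤ R) (hcov : A ⊆ A₁ ∪ B) (hA₁ : A₁ ⊆ ball x R) (hBA : B ⊆ A)
    (hB : IsPreconnected B)
    (hBr : ∀ z ∈ B, r ≤ ‖z - x‖) {p q : ℂ} (hp : p ∈ ball x r \ A) (hq : q ∈ ball x r \ A) :
    q ∈ connectedComponentIn (ball x R \ A) p := by
  by_contra hcon
  have hpx : ‖p - x‖ < r := by simpa [dist_eq_norm] using hp.1
  have hqx : ‖q - x‖ < r := by simpa [dist_eq_norm] using hq.1
  have hpR : p ∈ ball x R \ A := ⟨ball_subset_ball hrR hp.1, hp.2⟩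
  have hqR : q ∈ ball x R \ A := ⟨ball_subset_ball hrR hq.1, hq.2⟩
  have hout : ∀ z ∈ (ball x R)ᶜ, r ≤ ‖z - x‖ := by
    intro z hz
    simp [dist_eq_norm] at hz
    linarith
  obtain ⟨m1, hm1, hm1e⟩ := ratio_log hpx
  obtain ⟨m2, hm2, hm2e⟩ := ratio_log hqx
  have hpA : ∀ z ∈ A, z - p ≠ 0 := fun z hz h => hp.2 (by rw [← sub_eq_zero.1 h]; exact hz)
  have hqA : ∀ z ∈ A, z - q ≠ 0 := fun z hz h => hq.2 (by rw [← sub_eq_zero.1 h]; exact hz)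
  have hr : 0 < r := (norm_nonneg _).trans_lt hpx
  have hxne : ∀ z, r ≤ ‖z - x‖ → z - x ≠ 0 := fun z hz h => by
    rw [h] at hz; simp at hz; linarith
  have hrat : ∀ z, r ≤ ‖z - x‖ → (z - p) ^ (1 : ℤ) * (z - q)⁻¹ = exp (m1 z - m2 z) := by
    intro z hz
    rw [hm1e z hz, hm2e z hz, Complex.exp_sub]
    have := hxne z hz
    have := Complex.exp_ne_zero (m2 z)
    field_simp
  obtain ⟨l, hl, hle⟩ := hlog (fun z => (z - p) ^ (1 : ℤ) * (z - q)⁻¹)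
    (ContinuousOn.mul (by simp; fun_prop) (ContinuousOn.inv₀ (by fun_prop) hqA))
    (fun z hz => mul_ne_zero (zpow_ne_zero _ (hpA z hz)) (inv_ne_zero (hqA z hz)))
  obtain ⟨n, hn⟩ := log_unique hB (hl.mono hBA)
    ((hm1.sub hm2).mono hBr) (by
      intro z hz
      rw [← hle z (hBA hz), hrat z (hBr z hz)]
      rfl)
  have hqcl := not_mem_closure_comp hA hqR hcon
  have := sep_core hA hpR (k := 1) (u := fun z => (z - q)⁻¹)
    (lam := fun z => l z - n * (2 * Real.pi * I)) (mu := fun z => m1 z - m2 z)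
    (ContinuousOn.inv₀ (by fun_prop) (fun z hz h => hqcl (by rw [← sub_eq_zero.1 h]; exact hz)))
    (fun z hz => inv_ne_zero (fun h => hqcl (by rw [← sub_eq_zero.1 h]; exact hz)))
    (hl.sub continuousOn_const) ((hm1.sub hm2).mono hout)
    (fun z hz => by
      rw [hle z hz, Complex.exp_sub, Complex.exp_int_mul_two_pi_mul_I, div_one])
    (fun z hz => hrat z (hout z hz))
    (fun z hz hz' => by
      have hzB : z ∈ B := (hcov hz).resolve_left (fun h => hz' (hA₁ h))
      have := hn z hzB
      simp only [Pi.sub_apply] at this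
      rw [this]; ring)
  omega

theorem planar_three {A A₁ B₁ B₂ : Set ℂ} (hA : IsClosed A) (hlog : HasLogs A) {x : ℂ} {r R : ℝ}
    (hrR : r ≤ R) (hcov : A ⊆ A₁ ∪ (B₁ ∪ B₂)) (hA₁ : A₁ ⊆ ball x R)
    (hB₁A : B₁ ⊆ A) (hB₂A : B₂ ⊆ A) (hB₁ : IsPreconnected B₁) (hB₂ : IsPreconnected B₂)
    (hB₁r : ∀ z ∈ B₁, r ≤ ‖z - x‖) (hB₂r : ∀ z ∈ B₂, r ≤ ‖z - x‖)
    {p : Fin 3 → ℂ} (hp : ∀ i, p i ∈ ball x r \ A) :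
    ∃ i j, i ≠ j ∧ p j ∈ connectedComponentIn (ball x R \ A) (p i) := by
  by_contra! hcon
  have hpx : ∀ i, ‖p i - x‖ < r := fun i => by simpa [dist_eq_norm] using (hp i).1
  have hpR : ∀ i, p i ∈ ball x R \ A := fun i => ⟨ball_subset_ball hrR (hp i).1, (hp i).2⟩
  have hout : ∀ z ∈ (ball x R)ᶜ, r ≤ ‖z - x‖ := by
    intro z hz
    simp [dist_eq_norm] at hz
    linarith
  choose m hm hme using fun i => ratio_log (hpx i)
  have hpA : ∀ i, ∀ z ∈ A, z - p i ≠ 0 :=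
    fun i z hz h => (hp i).2 (by rw [← sub_eq_zero.1 h]; exact hz)
  have hr : 0 < r := (norm_nonneg _).trans_lt (hpx 0)
  have hxne : ∀ z, r ≤ ‖z - x‖ → z - x ≠ 0 := fun z hz h => by
    rw [h] at hz; simp at hz; linarith
  -- logs on `A` of `(z - p 0) / (z - p i)`
  have hrat : ∀ i z, r ≤ ‖z - x‖ → (z - p 0) * (z - p i)⁻¹ = exp (m 0 z - m i z) := by
    intro i z hz
    rw [hme 0 z hz, hme i z hz, Complex.exp_sub]
    have := hxne z hz
    have := Complex.exp_ne_zero (m i z)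
    field_simp
  have hl' := fun i => hlog (fun z => (z - p 0) * (z - p i)⁻¹)
    (ContinuousOn.mul (by fun_prop) (ContinuousOn.inv₀ (by fun_prop) (hpA i)))
    (fun z hz => mul_ne_zero (hpA 0 z hz) (inv_ne_zero (hpA i z hz)))
  choose l hl hle using hl'
  have hn' := fun i => log_unique hB₁ ((hl i).mono hB₁A)
    (((hm 0).sub (hm i)).mono hB₁r) (by
      intro z hz
      rw [← hle i z (hB₁A hz), hrat i z (hB₁r z hz)]
      rfl)
  choose c hc using hn'
  have hn' := fun i => log_unique hB₂ ((hl i).mono hB₂A)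
    (((hm 0).sub (hm i)).mono hB₂r) (by
      intro z hz
      rw [← hle i z (hB₂A hz), hrat i z (hB₂r z hz)]
      rfl)
  choose e he using hn'
  have hcl : ∀ i j, i ≠ j → p j ∉ closure (connectedComponentIn (ball x R \ A) (p i)) :=
    fun i j hij => not_mem_closure_comp hA (hpR j) (hcon i j hij)
  -- the key statement
  have key : ∀ a b : ℤ, a * (e 1 - c 1) + b * (e 2 - c 2) = 0 → a = 0 ∧ b = 0 := by
    intro a b hab
    have habC : (a : ℂ) * (e 1 - c 1) + b * (e 2 - c 2) = 0 := by exact_mod_cast hab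
    let F : ℂ → ℂ := fun z => ((z - p 0) * (z - p 1)⁻¹) ^ a * ((z - p 0) * (z - p 2)⁻¹) ^ b
    let lam : ℂ → ℂ := fun z => a * l 1 z + b * l 2 z - (a * c 1 + b * c 2 : ℤ) * (2 * Real.pi * I)
    let mu : ℂ → ℂ := fun z => a * (m 0 z - m 1 z) + b * (m 0 z - m 2 z)
    have hlam : ContinuousOn lam A :=
      ((continuousOn_const.mul (hl 1)).add (continuousOn_const.mul (hl 2))).sub continuousOn_const
    have hmu : ContinuousOn mu (ball x R)ᶜ := by
      have h0 := (hm 0).mono hout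
      have h1 := (hm 1).mono hout
      have h2 := (hm 2).mono hout
      exact (continuousOn_const.mul (h0.sub h1)).add (continuousOn_const.mul (h0.sub h2))
    have hF1 : ∀ z ∈ A, F z = exp (lam z) := by
      intro z hz
      simp only [F, lam]
      rw [Complex.exp_sub, Complex.exp_int_mul_two_pi_mul_I, div_one, Complex.exp_add,
        Complex.exp_int_mul, Complex.exp_int_mul, ← hle 1 z hz, ← hle 2 z hz]
    have hF2 : ∀ z ∈ (ball x R)ᶜ, F z = exp (mu z) := by
      intro z hz
      simp only [F, mu]
      rw [Complex.exp_add, Complex.exp_int_mul, Complex.exp_int_mul, ← hrat 1 z (hout z hz),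
        ← hrat 2 z (hout z hz)]
    have h12 : ∀ z ∈ A, z ∈ (ball x R)ᶜ → lam z = mu z := by
      intro z hz hz'
      rcases (hcov hz).resolve_left (fun h => hz' (hA₁ h)) with hzB | hzB
      · have h1 := hc 1 z hzB
        have h2 := hc 2 z hzB
        simp only [Pi.sub_apply] at h1 h2
        simp only [lam, mu, h1, h2]
        push_cast; ring
      · have h1 := he 1 z hzB
        have h2 := he 2 z hzB
        simp only [Pi.sub_apply] at h1 h2
        simp only [lam, mu, h1, h2]
        push_cast
        linear_combination (2 * Real.pi * I) * habC
    have hcont : ∀ i j, i ≠ j → ∀ k : ℤ, ContinuousOn (fun z => (z - p j) ^ k)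
        (closure (connectedComponentIn (ball x R \ A) (p i))) := by
      intro i j hij k
      apply ContinuousOn.zpow₀ (by fun_prop)
      exact fun z hz => Or.inl (fun h => hcl i j hij (by rw [← sub_eq_zero.1 h]; exact hz))
    have hne : ∀ i j, i ≠ j → ∀ k : ℤ, ∀ z ∈
        (closure (connectedComponentIn (ball x R \ A) (p i))), (z - p j) ^ k ≠ 0 := by
      intro i j hij k z hz
      exact zpow_ne_zero _ (fun h => hcl i j hij (by rw [← sub_eq_zero.1 h]; exact hz))
    have hout0 : ∀ i, ∀ z ∈ (ball x R)ᶜ, z - p i ≠ 0 := by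
      intro i z hz h
      rw [sub_eq_zero.1 h] at hz
      exact hz (hpR i).1
    have expand1 : ∀ z, z - p 0 ≠ 0 →
        (z - p 1) ^ (-a) * ((z - p 0) ^ (a + b) * (z - p 2) ^ (-b)) = F z := by
      intro z h0
      simp only [F]
      rw [zpow_add₀ h0, mul_zpow, mul_zpow, inv_zpow', inv_zpow']
      ring
    have expand2 : ∀ z, z - p 0 ≠ 0 →
        (z - p 2) ^ (-b) * ((z - p 0) ^ (a + b) * (z - p 1) ^ (-a)) = F z := by
      intro z h0
      rw [← expand1 z h0]; ring
    constructor
    · have := sep_core hA (hpR 1) (k := -a)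
        (u := fun z => (z - p 0) ^ (a + b) * (z - p 2) ^ (-b)) (lam := lam) (mu := mu)
        ((hcont 1 0 (by decide) _).mul (hcont 1 2 (by decide) _))
        (fun z hz => mul_ne_zero (hne 1 0 (by decide) _ z hz) (hne 1 2 (by decide) _ z hz))
        hlam hmu (fun z hz => by rw [expand1 z (hpA 0 z hz), hF1 z hz])
        (fun z hz => by rw [expand1 z (hout0 0 z hz), hF2 z hz]) h12
      omega
    · have := sep_core hA (hpR 2) (k := -b)
        (u := fun z => (z - p 0) ^ (a + b) * (z - p 1) ^ (-a)) (lam := lam) (mu := mu)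
        ((hcont 2 0 (by decide) _).mul (hcont 2 1 (by decide) _))
        (fun z hz => mul_ne_zero (hne 2 0 (by decide) _ z hz) (hne 2 1 (by decide) _ z hz))
        hlam hmu (fun z hz => by rw [expand2 z (hpA 0 z hz), hF1 z hz])
        (fun z hz => by rw [expand2 z (hout0 0 z hz), hF2 z hz]) h12
      omega
  have k1 := key (e 2 - c 2) (-(e 1 - c 1)) (by ring)
  have k2 := key 1 0 (by rw [neg_eq_zero.1 k1.2]; ring)
  exact one_ne_zero k2.1

end K3n


namespace K3n
open Complex

/-- A nonvanishing function on a planar compact set extends to a continuous function with finitely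
many zeros on a given compact set. -/
theorem planar_ext {K D : Set ℂ} (hK : IsCompact K) (hD : IsCompact D) {f : ℂ → ℂ}
    (hf : ContinuousOn f K) (hf0 : ∀ z ∈ K, f z ≠ 0) :
    ∃ g : ℂ → ℂ, Continuous g ∧ {z ∈ D | g z = 0}.Finite ∧ ∀ z ∈ K, g z = f z := by
  obtain ⟨ε, hε, hεf⟩ : ∃ ε : ℝ, 0 < ε ∧ ∀ z ∈ K, ε ≤ ‖f z‖ := by
    rcases K.eq_empty_or_nonempty with rfl | hne
    · exact ⟨1, one_pos, by simp⟩
    · obtain ⟨z, hz, hmin⟩ := hK.exists_isMinOn hne hf.norm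
      exact ⟨‖f z‖, norm_pos_iff.2 (hf0 z hz), fun w hw => hmin hw⟩
  obtain ⟨F, hF, hFe⟩ := tietze hK.isClosed hf
  obtain ⟨G, hG, hGF, -⟩ := hF.exists_contDiff_approx 1 (ε := fun _ => ε / 4)
    continuous_const (fun _ => by positivity)
  have hGd : Differentiable ℝ G := hG.differentiable (by norm_num)
  -- a regular value
  obtain ⟨c, hc, hcreg⟩ : ∃ c ∈ ball (0 : ℂ) (ε / 4), c ∉ G '' {z | (fderiv ℝ G z).det = 0} := by
    by_contra! hcon
    have h1 : MeasureTheory.volume (G '' {z | (fderiv ℝ G z).det = 0}) = 0 :=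
      MeasureTheory.addHaar_image_eq_zero_of_det_fderivWithin_eq_zero _
        (fun z _ => (hGd z).hasFDerivAt.hasFDerivWithinAt) (fun z hz => hz)
    have h2 : MeasureTheory.volume (ball (0 : ℂ) (ε / 4)) = 0 :=
      MeasureTheory.measure_mono_null hcon h1
    exact (measure_ball_pos MeasureTheory.volume (0 : ℂ) (by positivity : 0 < ε / 4)).ne' h2
  have hc' : ‖c‖ < ε / 4 := by simpa using hc
  let g0 : ℂ → ℂ := fun z => G z - c
  have hg0 : Continuous g0 := by
    have := hG.continuous
    fun_prop
  have hfin : {z ∈ D | g0 z = 0}.Finite := by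
    by_contra hinf
    obtain ⟨x, hx, hacc⟩ := Set.Infinite.exists_accPt_of_subset_isCompact (hs := hinf) hD
      (fun z hz => hz.1)
    have hx0 : g0 x = 0 := by
      have hcl : IsClosed {z | g0 z = 0} := isClosed_eq hg0 continuous_const
      have : x ∈ closure {z ∈ D | g0 z = 0} :=
        mem_closure_iff_clusterPt.2 hacc.clusterPt
      exact closure_minimal (fun z hz => hz.2) hcl this
    have hdet : (fderiv ℝ G x).det ≠ 0 := by
      intro h
      exact hcreg ⟨x, h, sub_eq_zero.1 hx0⟩
    have hanti : ∃ C, AntilipschitzWith C (fderiv ℝ G x) := by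
      let e := (fderiv ℝ G x).toContinuousLinearEquivOfDetNeZero hdet
      exact ⟨_, e.antilipschitz⟩
    have hev := (hGd x).hasFDerivAt.eventually_ne (c := c) hanti
    have hfr := accPt_iff_frequently_nhdsNE.1 hacc
    obtain ⟨y, hy1, hy2⟩ := (hfr.and_eventually hev).exists
    exact hy2 (sub_eq_zero.1 hy1.2)
  have hclose : ∀ z ∈ K, ‖g0 z - f z‖ < ε := by
    intro z hz
    have h1 : ‖G z - F z‖ < ε / 4 := by simpa [dist_eq_norm] using hGF z
    rw [hFe z hz] at h1
    calc ‖g0 z - f z‖ = ‖(G z - f z) - c‖ := by simp only [g0]; ring_nf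
      _ ≤ ‖G z - f z‖ + ‖c‖ := norm_sub_le _ _
      _ < ε := by linarith
  have hslit : ∀ z ∈ K, g0 z / f z ∈ slitPlane := by
    intro z hz
    have h0 := hf0 z hz
    have : g0 z / f z = 1 + (g0 z - f z) / f z := by field_simp; ring
    rw [this]
    apply mem_slitPlane_of_norm_lt_one
    rw [norm_div, div_lt_one (norm_pos_iff.2 h0)]
    exact (hclose z hz).trans_le (hεf z hz)
  obtain ⟨Φ, hΦ, hΦe⟩ := tietze hK.isClosed (f := fun z => -log (g0 z / f z))
    (ContinuousOn.neg (ContinuousOn.clog (hg0.continuousOn.div hf hf0) hslit))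
  refine ⟨fun z => g0 z * exp (Φ z), by fun_prop, ?_, ?_⟩
  · convert hfin using 4
    simp [Complex.exp_ne_zero]
  · intro z hz
    have h0 := hf0 z hz
    have h1 : g0 z ≠ 0 := by
      intro h
      have := slitPlane_ne_zero (hslit z hz)
      simp [h] at this
    simp only [hΦe z hz]
    rw [Complex.exp_neg, exp_log (slitPlane_ne_zero (hslit z hz))]
    field_simp

/-- Replace a function on a disc by one with a single pole at a prescribed point. -/
theorem planar_push {ρ : ℝ} (hρ : 0 < ρ) {p : ℂ} (hp : ‖p‖ < ρ) {f : ℂ → ℂ}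
    (hf : ContinuousOn f (sphere 0 ρ)) (hf0 : ∀ z ∈ sphere (0 : ℂ) ρ, f z ≠ 0) :
    ∃ g : ℂ → ℂ, ContinuousOn g {p}ᶜ ∧ (∀ z, z ≠ p → g z ≠ 0) ∧
      ∀ z ∈ sphere (0 : ℂ) ρ, g z = f z := by
  obtain ⟨d, ψ, hψ, hfd⟩ := circle_degree hρ hf hf0
  obtain ⟨μ, hμ, hμe⟩ := ratio_log (x := 0) (p := p) (r := ρ) (by simpa using hp)
  have hsub : sphere (0 : ℂ) ρ ⊆ {z | ρ ≤ ‖z - 0‖} := fun z hz => by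
    have : ‖z‖ = ρ := by simpa using hz
    simp [this]
  obtain ⟨Φ, hΦ, hΦe⟩ := tietze isClosed_sphere (f := fun z => ψ z - d * μ z)
    (hψ.sub (continuousOn_const.mul (hμ.mono hsub)))
  refine ⟨fun z => (z - p) ^ d * exp (Φ z), ?_, ?_, ?_⟩
  · apply ContinuousOn.mul _ (by fun_prop)
    apply ContinuousOn.zpow₀ (by fun_prop)
    exact fun z hz => Or.inl (sub_ne_zero.2 hz)
  · exact fun z hz => mul_ne_zero (zpow_ne_zero _ (sub_ne_zero.2 hz)) (Complex.exp_ne_zero _)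
  · intro z hz
    have h1 := hμe z (hsub hz)
    simp only [hΦe z hz]
    rw [hfd z hz, h1, sub_zero, mul_zpow, Complex.exp_sub, ← Complex.exp_int_mul]
    have := Complex.exp_ne_zero (d * μ z)
    field_simp

end K3n

namespace K3n
open Complex

/-- Charts at a point inside a given neighbourhood. -/
theorem chart_at {S : Type*} [TopologicalSpace S] (hS : LocallyEuclidean2 S) (x : S)
    {W : Set S} (hW : W ∈ 𝓝 x) :
    ∃ ι : ℂ → S, IsOpenEmbedding ι ∧ ι 0 = x ∧ range ι ⊆ W := by
  obtain ⟨U, hU, hxU, ⟨e⟩⟩ := hS x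
  let e' : ℂ ≃ₜ U :=
    (Complex.orthonormalBasisOneI.repr.toHomeomorph).trans e.symm
  let κ : ℂ → S := fun z => (e' z : S)
  have hκ : IsOpenEmbedding κ := hU.isOpenEmbedding_subtypeVal.comp e'.isOpenEmbedding
  let c : ℂ := e'.symm ⟨x, hxU⟩
  have hc : κ c = x := by simp [κ, c]
  have : κ ⁻¹' W ∈ 𝓝 c := hκ.continuous.continuousAt (by rw [hc]; exact hW)
  obtain ⟨r, hr, hrW⟩ := Metric.mem_nhds_iff.1 this
  let u := OpenPartialHomeomorph.univBall c r
  have hu : IsOpenEmbedding u := by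
    apply OpenPartialHomeomorph.isOpenEmbedding
    exact OpenPartialHomeomorph.univBall_source c r
  refine ⟨κ ∘ u, hκ.comp hu, ?_, ?_⟩
  · simp [u, OpenPartialHomeomorph.univBall_apply_zero, hc]
  · rintro _ ⟨z, rfl⟩
    apply hrW
    rw [← OpenPartialHomeomorph.univBall_target c hr]
    apply u.map_source
    simp [u]

theorem locConn {S : Type*} [TopologicalSpace S] (hS : LocallyEuclidean2 S) :
    LocallyConnectedSpace S := by
  rw [locallyConnectedSpace_iff_connected_subsets]
  intro x W hW
  obtain ⟨ι, hι, h0, hr⟩ := chart_at hS x hW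
  refine ⟨range ι, ?_, (isPreconnected_range hι.continuous), hr⟩
  exact hι.isOpen_range.mem_nhds ⟨0, h0⟩

open Classical in
/-- Gluing a function on a disc with a function outside of it. -/
noncomputable def glue {S : Type*} (ι : ℂ → S) (ρ : ℝ) (g' : ℂ → ℂ) (g : S → ℂ) (x : S) : ℂ :=
  if x ∈ ι '' closedBall 0 ρ then g' (Function.invFun ι x) else g x

theorem glue_in {S : Type*} {ι : ℂ → S} (hι : Function.Injective ι) {ρ : ℝ} {g' : ℂ → ℂ} {g : S → ℂ}
    {z : ℂ} (hz : z ∈ closedBall (0:ℂ) ρ) : glue ι ρ g' g (ι z) = g' z := by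
  rw [glue, if_pos ⟨z, hz, rfl⟩, Function.leftInverse_invFun hι]

theorem glue_out {S : Type*} {ι : ℂ → S} {ρ : ℝ} {g' : ℂ → ℂ} {g : S → ℂ}
    {x : S} (hx : x ∉ ι '' closedBall 0 ρ) : glue ι ρ g' g x = g x := if_neg hx

theorem glue_cont {S : Type*} [TopologicalSpace S] [T2Space S] {ι : ℂ → S} (hι : IsOpenEmbedding ι)
    {ρ : ℝ} {g' : ℂ → ℂ} {g : S → ℂ} {T Y : Set S} (hY : IsClosed Y)
    (hT : T ⊆ ι '' closedBall 0 ρ ∪ Y)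
    (hg' : ContinuousOn g' (closedBall 0 ρ ∩ ι ⁻¹' T))
    (hg : ContinuousOn g ((T ∩ Y) \ ι '' ball 0 ρ))
    (hag : ∀ z ∈ sphere (0:ℂ) ρ, ι z ∈ T → ι z ∈ Y → g' z = g (ι z)) :
    ContinuousOn (glue ι ρ g' g) T := by
  have hB : IsClosed (ι '' closedBall 0 ρ) :=
    ((isCompact_closedBall _ _).image hι.continuous).isClosed
  have hO : IsOpen (ι '' ball 0 ρ) := hι.isOpenMap _ isOpen_ball
  have h1 : ContinuousOn (glue ι ρ g' g) (T ∩ ι '' closedBall 0 ρ) := by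
    have : T ∩ ι '' closedBall 0 ρ = ι '' (closedBall 0 ρ ∩ ι ⁻¹' T) := by
      rw [Set.image_inter_preimage, inter_comm]
    rw [this, hι.isInducing.continuousOn_image_iff]
    refine hg'.congr ?_
    intro z hz
    exact glue_in hι.injective hz.1
  have h2 : ContinuousOn (glue ι ρ g' g) ((T ∩ Y) \ ι '' ball 0 ρ) := by
    refine hg.congr ?_
    rintro x ⟨⟨hxT, hxY⟩, hx⟩
    by_cases hxB : x ∈ ι '' closedBall 0 ρ
    · obtain ⟨z, hz, rfl⟩ := hxB
      rw [glue_in hι.injective hz]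
      apply hag z _ hxT hxY
      have : z ∉ ball (0:ℂ) ρ := fun h => hx ⟨z, h, rfl⟩
      simp only [mem_closedBall, mem_ball, mem_sphere, not_lt] at *
      exact le_antisymm hz this
    · exact glue_out hxB
  have hun : T = (T ∩ ι '' closedBall 0 ρ) ∪ ((T ∩ Y) \ ι '' ball 0 ρ) := by
    ext x
    constructor
    · intro hx
      by_cases h : x ∈ ι '' closedBall 0 ρ
      · exact Or.inl ⟨hx, h⟩
      · refine Or.inr ⟨⟨hx, (hT hx).resolve_left h⟩, fun h' => h (image_mono ball_subset_closedBall h')⟩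
    · rintro (h | h)
      · exact h.1
      · exact h.1.1
  intro x hx
  rw [hun]
  apply ContinuousWithinAt.union
  · by_cases h : x ∈ ι '' closedBall 0 ρ
    · exact h1 x ⟨hx, h⟩
    · apply continuousWithinAt_of_notMem_closure
      intro h'
      exact h (closure_minimal inter_subset_right hB h')
  · by_cases h : x ∈ Y \ ι '' ball 0 ρ
    · exact h2 x ⟨⟨hx, h.1⟩, h.2⟩
    · apply continuousWithinAt_of_notMem_closure
      intro h'
      refine h (closure_minimal ?_ (hY.sdiff hO) h')
      exact fun y hy => ⟨hy.1.2, hy.2⟩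

end K3n

namespace K3n
open Complex

def Ext {S : Type*} [TopologicalSpace S] (X : Set S) (f : S → ℂ) (Q : Set S) : Prop :=
  ∃ g : S → ℂ, ContinuousOn g Qᶜ ∧ (∀ x ∉ Q, g x ≠ 0) ∧ ∀ x ∈ X, g x = f x

theorem exists_rho {S : Type*} {ι : ℂ → S} (hι : Function.Injective ι) {Q : Set S} (hQ : Q.Finite) :
    ∃ ρ : ℝ, 1 < ρ ∧ ∀ z ∈ sphere (0:ℂ) ρ, ι z ∉ Q := by
  obtain ⟨ρ, h1, h2⟩ := (Ioo_infinite (show (1:ℝ) < 2 by norm_num)).exists_notMem_finite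
    (hQ.image (fun x => ‖Function.invFun ι x‖))
  refine ⟨ρ, h1.1, fun z hz hq => h2 ⟨ι z, hq, ?_⟩⟩
  simp only [Function.leftInverse_invFun hι z]
  simpa using hz

theorem ext_step {S : Type*} [TopologicalSpace S] [T2Space S] {X : Set S} (hX : IsClosed X)
    {f : S → ℂ} {ι : ℂ → S} (hι : IsOpenEmbedding ι) {Q Y : Set S} (hQ : Q.Finite)
    (hQX : Disjoint Q X) (hY : IsClosed Y) (hXY : X ⊆ Y) {g : S → ℂ}
    (hg : ContinuousOn g (Y \ Q)) (hg0 : ∀ x ∈ Y \ Q, g x ≠ 0) (hgf : ∀ x ∈ X, g x = f x) :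
    ∃ Q' Y' : Set S, ∃ g' : S → ℂ, Q'.Finite ∧ Disjoint Q' X ∧ IsClosed Y' ∧
      Y ∪ ι '' closedBall 0 1 ⊆ Y' ∧ ContinuousOn g' (Y' \ Q') ∧ (∀ x ∈ Y' \ Q', g' x ≠ 0) ∧
      ∀ x ∈ X, g' x = f x := by
  obtain ⟨ρ, hρ1, hρ⟩ := exists_rho hι.injective hQ
  have hXQ : ∀ x ∈ X, x ∉ Q := fun x hx hq => (Set.disjoint_left.1 hQX) hq hx
  set K : Set ℂ := (closedBall 0 ρ ∩ ι ⁻¹' X) ∪ (sphere 0 ρ ∩ ι ⁻¹' Y) with hK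
  have hKc : IsCompact K :=
    ((isCompact_closedBall _ _).inter_right (hX.preimage hι.continuous)).union
      ((isCompact_sphere _ _).inter_right (hY.preimage hι.continuous))
  have hKY : ∀ z ∈ K, ι z ∈ Y \ Q := by
    rintro z (hz | hz)
    · exact ⟨hXY hz.2, hXQ _ hz.2⟩
    · exact ⟨hz.2, hρ z hz.1⟩
  obtain ⟨h, hh, hfin, hhK⟩ := planar_ext hKc (isCompact_closedBall (0:ℂ) ρ)
    (f := fun z => g (ι z)) (hg.comp hι.continuous.continuousOn hKY)
    (fun z hz => hg0 _ (hKY z hz))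
  refine ⟨Q ∪ ι '' {z ∈ closedBall 0 ρ | h z = 0}, Y ∪ ι '' closedBall 0 ρ, glue ι ρ h g,
    hQ.union (hfin.image _), ?_, ?_, ?_, ?_, ?_, ?_⟩
  · rw [Set.disjoint_left]
    rintro _ (hq | ⟨z, hz, rfl⟩) hx
    · exact hXQ _ hx hq
    · have hzK : z ∈ K := Or.inl ⟨hz.1, hx⟩
      exact hg0 _ (hKY z hzK) (by rw [← hhK z hzK]; exact hz.2)
  · exact hY.union ((isCompact_closedBall _ _).image hι.continuous).isClosed
  · exact union_subset_union_right _ (image_mono (closedBall_subset_closedBall hρ1.le))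
  · refine glue_cont hι hY ?_ hh.continuousOn ?_ ?_
    · intro x hx
      exact hx.1.symm
    · exact hg.mono fun x hx => ⟨hx.1.2, fun h' => hx.1.1.2 (Or.inl h')⟩
    · intro z hz _ hzY
      exact hhK z (Or.inr ⟨hz, hzY⟩)
  · rintro x ⟨hx, hxQ⟩
    by_cases hxB : x ∈ ι '' closedBall 0 ρ
    · obtain ⟨z, hz, rfl⟩ := hxB
      rw [glue_in hι.injective hz]
      exact fun h0 => hxQ (Or.inr ⟨z, ⟨hz, h0⟩, rfl⟩)
    · rw [glue_out hxB]
      exact hg0 _ ⟨hx.resolve_right hxB, fun h => hxQ (Or.inl h)⟩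
  · intro x hx
    by_cases hxB : x ∈ ι '' closedBall 0 ρ
    · obtain ⟨z, hz, rfl⟩ := hxB
      rw [glue_in hι.injective hz, hhK z (Or.inl ⟨hz, hx⟩)]
      exact hgf _ hx
    · rw [glue_out hxB, hgf _ hx]

theorem ext_finite {S : Type*} [TopologicalSpace S] [T2Space S] [CompactSpace S]
    (hS : LocallyEuclidean2 S) {X : Set S} (hX : IsClosed X)
    {f : S → ℂ} (hf : ContinuousOn f X) (hf0 : ∀ x ∈ X, f x ≠ 0) :
    ∃ Q : Set S, Q.Finite ∧ Disjoint Q X ∧ Ext X f Q := by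
  choose ι hι hι0 _ using fun x : S => chart_at hS x (univ_mem)
  obtain ⟨t, ht⟩ := CompactSpace.elim_nhds_subcover (fun x => ι x '' closedBall 0 1) (fun x => by
    refine mem_of_superset ((hι x).isOpenMap _ isOpen_ball |>.mem_nhds
      ⟨0, mem_ball_self one_pos, hι0 x⟩) (image_mono ball_subset_closedBall))
  have key : ∀ t : Finset S, ∃ Q Y : Set S, ∃ g : S → ℂ, Q.Finite ∧ Disjoint Q X ∧ IsClosed Y ∧
      X ⊆ Y ∧ (⋃ x ∈ t, ι x '' closedBall 0 1) ⊆ Y ∧ ContinuousOn g (Y \ Q) ∧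
      (∀ x ∈ Y \ Q, g x ≠ 0) ∧ ∀ x ∈ X, g x = f x := by
    classical
    intro t
    induction t using Finset.induction_on with
    | empty => 
      exact ⟨∅, X, f, finite_empty, disjoint_bot_left, hX, subset_rfl, by simp, by simpa using hf,
        by simpa using hf0, fun _ _ => rfl⟩
    | insert a s ha ih =>
      obtain ⟨Q, Y, g, hQ, hQX, hY, hXY, hs, hg, hg0, hgf⟩ := ih
      obtain ⟨Q', Y', g', h1, h2, h3, h4, h5, h6, h7⟩ :=
        ext_step hX (hι a) hQ hQX hY hXY hg hg0 hgf
      refine ⟨Q', Y', g', h1, h2, h3, hXY.trans (subset_union_left.trans h4), ?_, h5, h6, h7⟩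
      rw [Finset.set_biUnion_insert]
      exact union_subset (subset_union_right.trans h4) (hs.trans (subset_union_left.trans h4))
  obtain ⟨Q, Y, g, hQ, hQX, hY, hXY, hs, hg, hg0, hgf⟩ := key t
  have hYu : Y = univ := by
    apply univ_subset_iff.1
    exact (show univ = _ from ht.symm).subset.trans hs
  subst hYu
  refine ⟨Q, hQ, hQX, g, by simpa [compl_eq_univ_sdiff] using hg, fun x hx => hg0 x ⟨trivial, hx⟩, hgf⟩

theorem push_disc {S : Type*} [TopologicalSpace S] [T2Space S] {X : Set S}
    {f : S → ℂ} {ι : ℂ → S} (hι : IsOpenEmbedding ι) (hιX : Disjoint (range ι) X)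
    {Q : Set S} (hQ : Q.Finite) {p q : S} (hp : p ∈ ι '' ball 0 1) (hq : q ∈ ι '' ball 0 1)
    (h : Ext X f (insert q Q)) : Ext X f (insert p Q) := by
  obtain ⟨g, hg, hg0, hgf⟩ := h
  obtain ⟨ρ, hρ1, hρ⟩ := exists_rho hι.injective (hQ.insert q)
  obtain ⟨p', hp', rfl⟩ := hp
  have hp'' : ‖p'‖ < ρ := by
    simp at hp'; linarith
  obtain ⟨h, hh, hh0, hhK⟩ := planar_push (f := fun z => g (ι z)) (by linarith) hp''
    (hg.comp hι.continuous.continuousOn hρ) (fun z hz => hg0 _ (hρ z hz))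
  have hqb : q ∈ ι '' ball 0 ρ := image_mono (ball_subset_ball hρ1.le) hq
  refine ⟨glue ι ρ h g, glue_cont hι isClosed_univ (by simp) ?_ ?_ ?_, ?_, ?_⟩
  · refine hh.mono ?_
    rintro z hz rfl
    exact hz.2 (mem_insert _ _)
  · refine hg.mono ?_
    rintro x hx (rfl | hxQ)
    · exact hx.2 hqb
    · exact hx.1.1 (Or.inr hxQ)
  · intro z hz _ _
    exact hhK z hz
  · intro x hx
    by_cases hxB : x ∈ ι '' closedBall 0 ρ
    · obtain ⟨z, hz, rfl⟩ := hxB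
      rw [glue_in hι.injective hz]
      apply hh0
      rintro rfl
      exact hx (mem_insert _ _)
    · rw [glue_out hxB]
      apply hg0
      rintro (rfl | h)
      · exact hxB (image_mono ball_subset_closedBall hqb)
      · exact hx (Or.inr h)
  · intro x hx
    rw [glue_out, hgf x hx]
    rintro ⟨z, _, rfl⟩
    exact (Set.disjoint_left.1 hιX) ⟨z, rfl⟩ hx

theorem push_comp {S : Type*} [TopologicalSpace S] [T2Space S] (hS : LocallyEuclidean2 S)
    {X : Set S} (hX : IsClosed X)
    {f : S → ℂ} {p q : S} (hq : q ∈ Xᶜ) (hp : p ∈ connectedComponentIn Xᶜ q) :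
    ∀ Q : Set S, Q.Finite → Ext X f (insert q Q) → Ext X f (insert p Q) := by
  refine IsPreconnected.induction₂' (s := connectedComponentIn Xᶜ q)
    isPreconnected_connectedComponentIn
    (fun q p => ∀ Q : Set S, Q.Finite → Ext X f (insert q Q) → Ext X f (insert p Q)) ?_ ?_
    (mem_connectedComponentIn hq) hp
  · intro x hx
    have hxX : Xᶜ ∈ 𝓝 x := hX.isOpen_compl.mem_nhds (connectedComponentIn_subset _ _ hx)
    obtain ⟨ι, hι, h0, hr⟩ := chart_at hS x hxX
    have hd : Disjoint (range ι) X := Set.disjoint_left.2 fun y hy => hr hy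
    have hn : ι '' ball 0 1 ∈ 𝓝 x := (hι.isOpenMap _ isOpen_ball).mem_nhds
      ⟨0, mem_ball_self one_pos, h0⟩
    have hxm := mem_of_mem_nhds hn
    filter_upwards [mem_nhdsWithin_of_mem_nhds hn] with y hy
    exact ⟨fun Q hQ h => push_disc hι hd hQ hy hxm h, fun Q hQ h => push_disc hι hd hQ hxm hy h⟩
  · intro x y z _ _ _ h1 h2 Q hQ h
    exact h2 Q hQ (h1 Q hQ h)

theorem ext_P {S : Type*} [TopologicalSpace S] [T2Space S] [CompactSpace S]
    (hS : LocallyEuclidean2 S) {X : Set S} (hX : IsClosed X)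
    {f : S → ℂ} (hf : ContinuousOn f X) (hf0 : ∀ x ∈ X, f x ≠ 0) {P : Set S} (hP : P.Finite)
    (hPX : ∀ x ∈ Xᶜ, ∃ p ∈ P, p ∈ connectedComponentIn Xᶜ x) : Ext X f P := by
  obtain ⟨Q, hQ, hQX, h⟩ := ext_finite hS hX hf hf0
  have key : ∀ Q : Set S, Q.Finite → Disjoint Q X → Ext X f (Q ∪ P) → Ext X f P := by
    intro Q hQ
    induction Q, hQ using Set.Finite.induction_on with
    | empty => intro _ h; simpa using h
    | @insert a s ha hs ih =>
      intro hd h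
      have haX : a ∈ Xᶜ := fun h => (Set.disjoint_left.1 hd) (mem_insert _ _) h
      obtain ⟨p, hpP, hp⟩ := hPX a haX
      refine ih (hd.mono_left (subset_insert _ _)) ?_
      rw [insert_union] at h
      have := push_comp hS hX haX hp (s ∪ P) (hs.union hP) h
      rwa [insert_eq_of_mem (show p ∈ s ∪ P from Or.inr hpP)] at this
  refine key Q hQ hQX ?_
  obtain ⟨g, h1, h2, h3⟩ := h
  exact ⟨g, h1.mono (compl_subset_compl.2 subset_union_left), fun x hx => h2 x fun h => hx (Or.inl h), h3⟩

end K3n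

namespace K3n
open Complex

theorem rank_step {r : ℕ} {ι : Type*} [Fintype ι] (M M' : Submodule ℤ (Fin r → ℤ))
    (h : ∀ (s : ℕ) (v : Fin s → Fin r → ℤ), (∀ l, v l ∈ M) → ∃ d : Fin s → ι → ℤ,
      ∀ c : Fin s → ℤ, (∀ i, ∑ l, c l * d l i = 0) → ∑ l, c l • v l ∈ M') :
    Module.finrank ℤ M ≤ Module.finrank ℤ M' + Fintype.card ι := by
  let b := Module.finBasis ℤ M
  obtain ⟨d, hd⟩ := h _ (fun l => (b l : Fin r → ℤ)) (fun l => (b l).2)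
  let δ : M →ₗ[ℤ] (ι → ℤ) := b.constr ℤ d
  have h1 := Submodule.finrank_quotient_add_finrank (LinearMap.ker δ)
  have h2 := δ.quotKerEquivRange.finrank_eq
  have h3 := Submodule.finrank_le (LinearMap.range δ)
  have hk : ∀ m ∈ LinearMap.ker δ, (m : Fin r → ℤ) ∈ M' := by
    intro m hm
    have hm' : δ m = 0 := hm
    have := hd (b.equivFun m) (by
      intro i
      have := congrFun hm' i
      rw [Module.Basis.constr_apply_fintype] at this
      simpa using this)
    convert this
    conv_lhs => rw [← b.sum_equivFun m]
    rw [AddSubmonoidClass.coe_finsetSum]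
    rfl
  have h4 : Module.finrank ℤ (LinearMap.ker δ) ≤ Module.finrank ℤ M' := by
    let u : LinearMap.ker δ →ₗ[ℤ] M' :=
      (M.subtype.comp (LinearMap.ker δ).subtype).codRestrict M' (fun m => hk m.1 m.2)
    apply LinearMap.finrank_le_finrank_of_injective (f := u)
    intro a b hab
    have : (u a : Fin r → ℤ) = u b := by rw [hab]
    apply Subtype.ext
    apply Subtype.ext
    exact this
  simp only [Module.finrank_fintype_fun_eq_card] at h3
  omega

theorem zpow_fsum {ι : Type*} (s : Finset ι) {a : ℂ} (ha : a ≠ 0) (n : ι → ℤ) :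
    a ^ (∑ l ∈ s, n l) = ∏ l ∈ s, a ^ n l := by
  classical
  induction s using Finset.induction_on with
  | empty => simp
  | insert i s hi ih => rw [Finset.sum_insert hi, Finset.prod_insert hi, zpow_add₀ ha, ih]

/-- exponent vectors `k` such that the monomial `f ^ k` agrees on `X` with a function in `R` -/
def expSub {S : Type*} {r : ℕ} (X : Set S) (f : Fin r → S → ℂ)
    (hf : ∀ t, ∀ x ∈ X, f t x ≠ 0) (R : (S → ℂ) → Prop) (h1 : R (fun _ => 1))
    (hmul : ∀ g h, R g → R h → R (fun x => g x * h x)) (hinv : ∀ g, R g → R (fun x => (g x)⁻¹)) :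
    Submodule ℤ (Fin r → ℤ) := AddSubgroup.toIntSubmodule
  { carrier := {k | ∃ g, R g ∧ ∀ x ∈ X, g x = ∏ t, f t x ^ k t}
    zero_mem' := ⟨_, h1, by simp⟩
    add_mem' := by
      rintro k k' ⟨g, hg, hgk⟩ ⟨g', hg', hgk'⟩
      refine ⟨_, hmul _ _ hg hg', fun x hx => ?_⟩
      rw [hgk x hx, hgk' x hx, ← Finset.prod_mul_distrib]
      refine Finset.prod_congr rfl fun t _ => ?_
      rw [Pi.add_apply, zpow_add₀ (hf t x hx)]
    neg_mem' := by
      rintro k ⟨g, hg, hgk⟩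
      refine ⟨_, hinv _ hg, fun x hx => ?_⟩
      rw [hgk x hx, ← Finset.prod_inv_distrib]
      refine Finset.prod_congr rfl fun t _ => ?_
      rw [Pi.neg_apply, zpow_neg] }

theorem mem_expSub {S : Type*} {r : ℕ} {X : Set S} {f : Fin r → S → ℂ}
    {hf : ∀ t, ∀ x ∈ X, f t x ≠ 0} {R : (S → ℂ) → Prop} {h1 : R (fun _ => 1)}
    {hmul : ∀ g h, R g → R h → R (fun x => g x * h x)} {hinv : ∀ g, R g → R (fun x => (g x)⁻¹)}
    {k : Fin r → ℤ} : k ∈ expSub X f hf R h1 hmul hinv ↔ ∃ g, R g ∧ ∀ x ∈ X, g x = ∏ t, f t x ^ k t :=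
  Iff.rfl

theorem expSub_step {S : Type*} {r : ℕ} {X : Set S} {f : Fin r → S → ℂ}
    {hf : ∀ t, ∀ x ∈ X, f t x ≠ 0} {R : (S → ℂ) → Prop} {h1 : R (fun _ => 1)}
    {hmul : ∀ g h, R g → R h → R (fun x => g x * h x)} {hinv : ∀ g, R g → R (fun x => (g x)⁻¹)}
    {R' : (S → ℂ) → Prop} {h1' : R' (fun _ => 1)}
    {hmul' : ∀ g h, R' g → R' h → R' (fun x => g x * h x)}
    {hinv' : ∀ g, R' g → R' (fun x => (g x)⁻¹)}
    {ι : Type*} [Fintype ι]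
    (h : ∀ (s : ℕ) (g : Fin s → S → ℂ), (∀ l, R (g l)) → ∃ d : Fin s → ι → ℤ,
      ∀ c : Fin s → ℤ, (∀ i, ∑ l, c l * d l i = 0) →
        ∃ g', R' g' ∧ ∀ x ∈ X, g' x = ∏ l, g l x ^ c l) :
    Module.finrank ℤ (expSub X f hf R h1 hmul hinv) ≤
      Module.finrank ℤ (expSub X f hf R' h1' hmul' hinv') + Fintype.card ι := by
  apply rank_step
  intro s v hv
  choose g hg hgv using hv
  obtain ⟨d, hd⟩ := h s g hg
  refine ⟨d, fun c hc => ?_⟩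
  obtain ⟨g', hg', hgg⟩ := hd c hc
  refine ⟨g', hg', fun x hx => ?_⟩
  rw [hgg x hx]
  have : ∀ t, f t x ^ (∑ l, c l • v l) t = ∏ l, f t x ^ (v l t * c l) := by
    intro t
    rw [← zpow_fsum _ (hf t x hx)]
    congr 1
    simp [mul_comm]
  simp_rw [this]
  rw [Finset.prod_comm]
  refine Finset.prod_congr rfl fun l _ => ?_
  rw [hgv l x hx, ← Finset.prod_zpow]
  refine Finset.prod_congr rfl fun t _ => ?_
  rw [zpow_mul]

def RQ {S : Type*} [TopologicalSpace S] (Q : Set S) (g : S → ℂ) : Prop :=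
  ContinuousOn g Qᶜ ∧ ∀ x ∉ Q, g x ≠ 0

def RL {S : Type*} [TopologicalSpace S] (g : S → ℂ) : Prop :=
  ∃ φ : S → ℂ, Continuous φ ∧ ∀ x, g x = exp (φ x)

/-- removing a pole -/
theorem pole_step {S : Type*} [TopologicalSpace S] [T2Space S] (hS : LocallyEuclidean2 S)
    {X Q : Set S} (hX : IsClosed X) (hQ : Q.Finite) {p : S} (hpX : p ∉ X) (hpQ : p ∉ Q)
    (s : ℕ) (g : Fin s → S → ℂ) (hg : ∀ l, RQ (insert p Q) (g l)) : ∃ d : Fin s → Unit → ℤ,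
      ∀ c : Fin s → ℤ, (∀ i, ∑ l, c l * d l i = 0) →
        ∃ g', RQ Q g' ∧ ∀ x ∈ X, g' x = ∏ l, g l x ^ c l := by
  obtain ⟨ι, hι, hι0, hr⟩ := chart_at hS p ((hX.union hQ.isClosed).isOpen_compl.mem_nhds
    (show p ∈ (X ∪ Q)ᶜ by simp [hpX, hpQ]))
  have hz : ∀ z : ℂ, z ≠ 0 → ι z ∉ insert p Q := by
    rintro z hz (h | h)
    · exact hz (hι.injective (h.trans hι0.symm))
    · exact hr ⟨z, rfl⟩ (Or.inr h)
  have hsph : ∀ z ∈ sphere (0:ℂ) 1, z ≠ 0 := by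
    rintro z hz rfl
    simp at hz
  choose d ψ hψ hd using fun l => circle_degree (f := fun z => g l (ι z)) one_pos
    ((hg l).1.comp hι.continuous.continuousOn fun z hz' => hz z (hsph z hz'))
    (fun z hz' => (hg l).2 _ (hz z (hsph z hz')))
  refine ⟨fun l _ => d l, fun c hc => ?_⟩
  have hc' := hc ()
  obtain ⟨Ψ, hΨ, hΨ'⟩ := tietze (s := sphere (0:ℂ) 1) (isClosed_sphere)
    (f := fun z => ∑ l, c l * ψ l z) (continuousOn_finsetSum _ fun l _ => (hψ l).const_mul _)
  have hGc : ContinuousOn (fun x => ∏ l, g l x ^ c l) (insert p Q)ᶜ :=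
    continuousOn_finsetProd _ fun l _ => (hg l).1.zpow₀ _ fun x hx => Or.inl ((hg l).2 x hx)
  refine ⟨glue ι 1 (fun z => exp (Ψ z)) (fun x => ∏ l, g l x ^ c l), ⟨glue_cont hι isClosed_univ
    (by simp) (by fun_prop) (hGc.mono ?_) ?_, ?_⟩, ?_⟩
  · rintro x hx (rfl | h)
    · exact hx.2 ⟨0, by simp, hι0⟩
    · exact hx.1.1 h
  · intro z hz' _ _
    have h0 := hsph z hz'
    rw [hΨ' z hz', Complex.exp_sum]
    have : ∏ l, g l (ι z) ^ c l = ∏ l, (z ^ (c l * d l) * exp (c l * ψ l z)) := by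
      refine Finset.prod_congr rfl fun l _ => ?_
      have := hd l z hz'
      rw [this, mul_zpow, ← zpow_mul, mul_comm (d l), Complex.exp_int_mul]
    rw [this, Finset.prod_mul_distrib, ← zpow_fsum _ h0, hc', zpow_zero, one_mul]
  · intro x hx
    by_cases hxB : x ∈ ι '' closedBall 0 1
    · obtain ⟨z, hz, rfl⟩ := hxB
      rw [glue_in hι.injective hz]
      exact exp_ne_zero _
    · rw [glue_out hxB]
      refine Finset.prod_ne_zero_iff.2 fun l _ => zpow_ne_zero _ ((hg l).2 x ?_)
      rintro (rfl | h)
      · exact hxB ⟨0, by simp, hι0⟩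
      · exact hx h
  · intro x hx
    rw [glue_out]
    rintro ⟨z, _, rfl⟩
    exact hr ⟨z, rfl⟩ (Or.inl hx)

/-- logarithms on a chart -/
theorem chart_log {S : Type*} [TopologicalSpace S] {ι : ℂ → S} (hι : IsOpenEmbedding ι)
    {g : S → ℂ} (hg : Continuous g) (hg0 : ∀ x, g x ≠ 0) :
    ∃ L : S → ℂ, ContinuousOn L (range ι) ∧ ∀ x ∈ range ι, exp (L x) = g x := by
  obtain ⟨φ, hφ, h⟩ := exists_log_complex (fun z => g (ι z)) (hg.comp hι.continuous)
    (fun z => hg0 _)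
  refine ⟨fun x => φ (Function.invFun ι x), ?_, ?_⟩
  · rw [← image_univ, hι.isInducing.continuousOn_image_iff]
    refine hφ.continuousOn.congr fun z _ => ?_
    simp [Function.leftInverse_invFun hι.injective z]
  · rintro _ ⟨z, rfl⟩
    simp [Function.leftInverse_invFun hι.injective z, h]

theorem log_step {S : Type*} [MetricSpace S] [CompactSpace S] (hS : LocallyEuclidean2 S) :
    ∃ t : Finset S, ∀ (s : ℕ) (g : Fin s → S → ℂ), (∀ l, RQ ∅ (g l)) →
      ∃ d : Fin s → (t × t) → ℤ,
      ∀ c : Fin s → ℤ, (∀ i, ∑ l, c l * d l i = 0) → RL (fun x => ∏ l, g l x ^ c l) := by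
  choose κ hκ hκ0 _ using fun x : S => chart_at hS x univ_mem
  obtain ⟨δ, hδ, hL⟩ := lebesgue_number_lemma_of_metric (s := (univ : Set S)) isCompact_univ
    (fun x => (hκ x).isOpen_range) (fun x _ => mem_iUnion.2 ⟨x, 0, hκ0 x⟩)
  choose ι hι hι0 hr using fun x : S => chart_at hS x (ball_mem_nhds x (half_pos (half_pos hδ)))
  obtain ⟨t, ht⟩ := CompactSpace.elim_nhds_subcover (fun x => range (ι x)) (fun x =>
    (hι x).isOpen_range.mem_nhds ⟨0, hι0 x⟩)
  have hcov : ∀ x : S, ∃ i : t, x ∈ range (ι i) := by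
    intro x
    have : x ∈ ⋃ y ∈ t, range (ι y) := by rw [ht]; trivial
    simp only [mem_iUnion] at this
    obtain ⟨y, hy, h⟩ := this
    exact ⟨⟨y, hy⟩, h⟩
  refine ⟨t, fun s g hg => ?_⟩
  have hgc : ∀ l, Continuous (g l) := fun l => by
    have := (hg l).1
    rwa [compl_empty, continuousOn_univ] at this
  have hg0 : ∀ l x, g l x ≠ 0 := fun l x => (hg l).2 x (notMem_empty _)
  choose L hLc hLe using fun (l : Fin s) (i : t) => chart_log (hι i) (hgc l) (hg0 l)
  have hdiff : ∀ (l : Fin s) (ij : t × t), ∃ n : ℤ, ∀ x ∈ range (ι ij.1) ∩ range (ι ij.2),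
      L l ij.1 x = L l ij.2 x + n * (2 * Real.pi * I) := by
    rintro l ⟨i, j⟩
    by_cases hne : (range (ι i) ∩ range (ι j)).Nonempty
    · obtain ⟨y, hyi, hyj⟩ := hne
      obtain ⟨x, hx⟩ := hL (i : S) trivial
      obtain ⟨Λ, hΛ, hΛe⟩ := chart_log (hκ x) (hgc l) (hg0 l)
      have hi : range (ι i) ⊆ range (κ x) := fun z hz => hx (by
        have := hr _ hz
        rw [mem_ball] at this ⊢; linarith)
      have hj : range (ι j) ⊆ range (κ x) := fun z hz => hx (by
        have h1 := hr _ hz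
        have h2 := hr _ hyi
        have h3 := hr _ hyj
        rw [mem_ball] at h1 h2 h3 ⊢
        rw [dist_comm] at h3
        have := dist_triangle4 z (j:S) y i
        linarith)
      obtain ⟨m, hm⟩ := log_unique (isPreconnected_range (hι i).continuous) (hLc l i)
        (hΛ.mono hi) (fun z hz => by rw [hLe l i z hz, hΛe z (hi hz)])
      obtain ⟨m', hm'⟩ := log_unique (isPreconnected_range (hι j).continuous) (hLc l j)
        (hΛ.mono hj) (fun z hz => by rw [hLe l j z hz, hΛe z (hj hz)])
      refine ⟨m - m', fun z hz => ?_⟩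
      rw [hm z hz.1, hm' z hz.2]
      push_cast
      ring
    · refine ⟨0, fun z hz => (hne ⟨z, hz⟩).elim⟩
  choose d hd using hdiff
  refine ⟨d, fun c hc => ?_⟩
  choose i hi using hcov
  have hloc : ∀ j : t, ∀ x ∈ range (ι j), ∑ l, c l * L l (i x) x = ∑ l, c l * L l j x := by
    intro j x hx
    have h1 : ∀ l, L l (i x) x = L l j x + d l (i x, j) * (2 * Real.pi * I) :=
      fun l => hd l (i x, j) x ⟨hi x, hx⟩
    have h2 : (∑ l, (c l : ℂ) * d l (i x, j)) = 0 := by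
      have := hc (i x, j)
      exact_mod_cast this
    calc ∑ l, c l * L l (i x) x
        = ∑ l, (c l * L l j x + c l * d l (i x, j) * (2 * Real.pi * I)) := by
          refine Finset.sum_congr rfl fun l _ => ?_
          rw [h1]; ring
      _ = _ := by
        rw [Finset.sum_add_distrib, ← Finset.sum_mul, h2]; ring
  refine ⟨fun x => ∑ l, c l * L l (i x) x, ?_, ?_⟩
  · rw [continuous_iff_continuousAt]
    intro x
    have hn : range (ι (i x)) ∈ 𝓝 x := (hι _).isOpen_range.mem_nhds (hi x)
    have : ContinuousOn (fun y => ∑ l, c l * L l (i x) y) (range (ι (i x))) :=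
      continuousOn_finsetSum _ fun l _ => (hLc l _).const_mul _
    exact (this.congr (hloc (i x))).continuousAt hn
  · intro x
    rw [Complex.exp_sum]
    refine Finset.prod_congr rfl fun l _ => ?_
    rw [Complex.exp_int_mul, hLe l _ x (hi x)]

theorem RQ_one {S : Type*} [TopologicalSpace S] (Q : Set S) : RQ Q (fun _ => 1) :=
  ⟨continuousOn_const, fun _ _ => one_ne_zero⟩
theorem RQ_mul {S : Type*} [TopologicalSpace S] (Q : Set S) (g h : S → ℂ) (hg : RQ Q g)
    (hh : RQ Q h) : RQ Q (fun x => g x * h x) :=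
  ⟨hg.1.mul hh.1, fun x hx => mul_ne_zero (hg.2 x hx) (hh.2 x hx)⟩
theorem RQ_inv {S : Type*} [TopologicalSpace S] (Q : Set S) (g : S → ℂ) (hg : RQ Q g) :
    RQ Q (fun x => (g x)⁻¹) :=
  ⟨hg.1.inv₀ hg.2, fun x hx => inv_ne_zero (hg.2 x hx)⟩
theorem RL_one {S : Type*} [TopologicalSpace S] : RL (fun _ : S => 1) :=
  ⟨fun _ => 0, continuous_const, by simp⟩
theorem RL_mul {S : Type*} [TopologicalSpace S] (g h : S → ℂ) (hg : RL g)
    (hh : RL h) : RL (fun x => g x * h x) := by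
  obtain ⟨φ, h1, h2⟩ := hg
  obtain ⟨ψ, h3, h4⟩ := hh
  exact ⟨fun x => φ x + ψ x, h1.add h3, fun x => by simp only [h2, h4, exp_add]⟩
theorem RL_inv {S : Type*} [TopologicalSpace S] (g : S → ℂ) (hg : RL g) :
    RL (fun x => (g x)⁻¹) := by
  obtain ⟨φ, h1, h2⟩ := hg
  exact ⟨fun x => -φ x, h1.neg, fun x => by simp only [h2, exp_neg]⟩

/-- The Alexander-type inequality: independent classes are bounded by the number of
complementary domains. -/
theorem rank_bound {S : Type*} [MetricSpace S] [CompactSpace S] (hS : LocallyEuclidean2 S) :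
    ∃ β : ℕ, ∀ (X : Set S) (P : Set S) (r : ℕ) (f : Fin r → S → ℂ), IsClosed X → P.Finite →
      Disjoint P X → (∀ x ∈ Xᶜ, ∃ p ∈ P, p ∈ connectedComponentIn Xᶜ x) →
      (∀ t, ContinuousOn (f t) X) → (∀ t, ∀ x ∈ X, f t x ≠ 0) →
      (∀ k : Fin r → ℤ, ∀ φ : S → ℂ, Continuous φ → (∀ x ∈ X, exp (φ x) = ∏ t, f t x ^ k t) →
        k = 0) → r ≤ P.ncard + β := by
  obtain ⟨t, ht⟩ := log_step hS
  refine ⟨Fintype.card (t × t), ?_⟩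
  intro X P r f hX hP hPX hcomp hfc hf0 hind
  have hL : Module.finrank ℤ (expSub X f hf0 RL RL_one RL_mul RL_inv) = 0 := by
    have : expSub X f hf0 RL RL_one RL_mul RL_inv = ⊥ := by
      rw [eq_bot_iff]
      rintro k ⟨g, ⟨φ, hφ, hg⟩, hk⟩
      exact hind k φ hφ fun x hx => by rw [← hg, hk x hx]
    rw [this]; simp
  have h0 : Module.finrank ℤ (expSub X f hf0 (RQ ∅) (RQ_one ∅) (RQ_mul ∅) (RQ_inv ∅)) ≤
      Fintype.card (t × t) := by
    have := expSub_step (X := X) (f := f) (hf := hf0) (h1 := RQ_one ∅) (hmul := RQ_mul ∅)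
      (hinv := RQ_inv ∅) (h1' := RL_one) (hmul' := RL_mul) (hinv' := RL_inv) (ι := t × t)
      (fun s g hg => by
        obtain ⟨d, hd⟩ := ht s g hg
        exact ⟨d, fun c hc => ⟨_, hd c hc, fun x _ => rfl⟩⟩)
    omega
  have hQ : ∀ Q : Set S, Q.Finite → Disjoint Q X →
      Module.finrank ℤ (expSub X f hf0 (RQ Q) (RQ_one Q) (RQ_mul Q) (RQ_inv Q)) ≤
        Q.ncard + Fintype.card (t × t) := by
    intro Q hQ
    induction Q, hQ using Set.Finite.induction_on with
    | empty => intro _; simpa using h0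
    | @insert a s ha hs ih =>
      intro hd
      have := ih (hd.mono_left (subset_insert _ _))
      have haX : a ∉ X := fun h => (Set.disjoint_left.1 hd) (mem_insert _ _) h
      have := expSub_step (X := X) (f := f) (hf := hf0) (h1 := RQ_one (insert a s))
        (hmul := RQ_mul _) (hinv := RQ_inv _) (h1' := RQ_one s) (hmul' := RQ_mul _)
        (hinv' := RQ_inv _) (pole_step hS hX hs haX ha)
      rw [Set.ncard_insert_of_notMem ha hs]
      simp only [Fintype.card_unit] at this
      omega
  have htop : expSub X f hf0 (RQ P) (RQ_one P) (RQ_mul P) (RQ_inv P) = ⊤ := by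
    rw [eq_top_iff]
    intro k _
    obtain ⟨g, h1, h2, h3⟩ := ext_P hS hX (f := fun x => ∏ t, f t x ^ k t)
      (continuousOn_finsetProd _ fun l _ => (hfc l).zpow₀ _ fun x hx => Or.inl (hf0 l x hx))
      (fun x hx => Finset.prod_ne_zero_iff.2 fun l _ => zpow_ne_zero _ (hf0 l x hx)) hP hcomp
    exact ⟨g, ⟨h1, h2⟩, h3⟩
  have := hQ P hP hPX
  rw [htop] at this
  simpa using this

end K3n

namespace K3n
open Complex

section arcs
set_option linter.unusedSectionVars false
variable {S : Type*} [TopologicalSpace S] [T2Space S] {γ : ℝ → S} {α β : ℝ}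

/-- the restriction of an injective path is a closed embedding -/
theorem arc_emb (hc : ContinuousOn γ (Icc α β)) (hi : InjOn γ (Icc α β)) :
    IsClosedEmbedding (fun t : Icc α β => γ t) :=
  Continuous.isClosedEmbedding (continuousOn_iff_continuous_domRestrict.1 hc)
    (injOn_iff_injective.1 hi)

theorem arc_closed (hc : ContinuousOn γ (Icc α β)) : IsClosed (γ '' Icc α β) :=
  (isCompact_Icc.image_of_continuousOn hc).isClosed

/-- functions on an arc are continuous iff they are continuous in the parameter -/
theorem arc_cont (hc : ContinuousOn γ (Icc α β)) (hi : InjOn γ (Icc α β)) {E : Type*}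
    [TopologicalSpace E] {f : S → E} (hf : ContinuousOn (fun t => f (γ t)) (Icc α β)) :
    ContinuousOn f (γ '' Icc α β) := by
  have he := arc_emb hc hi
  have : γ '' Icc α β = (fun t : Icc α β => γ t) '' univ := by
    rw [image_univ]; ext x; simp
  rw [this, he.isInducing.continuousOn_image_iff, continuousOn_univ]
  exact continuousOn_iff_continuous_domRestrict.1 hf

theorem arc_inverse (hc : ContinuousOn γ (Icc α β)) (hi : InjOn γ (Icc α β)) :
    ∃ σ : S → ℝ, ContinuousOn σ (γ '' Icc α β) ∧ ∀ t ∈ Icc α β, σ (γ t) = t := by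
  classical
  refine ⟨Function.invFunOn γ (Icc α β), ?_, fun t ht => hi.leftInvOn_invFunOn ht⟩
  apply arc_cont hc hi
  exact continuousOn_id.congr fun t ht => hi.leftInvOn_invFunOn ht

theorem arc_near (hc : ContinuousOn γ (Icc α β)) {t₀ : ℝ} (ht₀ : t₀ ∈ Icc α β) {W : Set S}
    (hW : W ∈ 𝓝 (γ t₀)) : ∃ ε > 0, ∀ t ∈ Icc α β, |t - t₀| ≤ ε → γ t ∈ W := by
  have := hc t₀ ht₀ hW
  rw [mem_map, Metric.mem_nhdsWithin_iff] at this
  obtain ⟨ε, hε, h⟩ := this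
  refine ⟨ε / 2, by positivity, fun t ht htε => h ⟨?_, ht⟩⟩
  rw [mem_ball, Real.dist_eq]; linarith

theorem arc_far (hc : ContinuousOn γ (Icc α β)) (hi : InjOn γ (Icc α β)) {t₀ : ℝ}
    (ht₀ : t₀ ∈ Icc α β) {ε : ℝ} (hε : 0 < ε) :
    ∃ W ∈ 𝓝 (γ t₀), ∀ t ∈ Icc α β, γ t ∈ W → |t - t₀| < ε := by
  have hK : IsCompact (γ '' (Icc α β ∩ {t | ε ≤ |t - t₀|})) :=
    (isCompact_Icc.inter_right (isClosed_le (by fun_prop) (by fun_prop))).image_of_continuousOn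
      (hc.mono inter_subset_left)
  refine ⟨_, hK.isClosed.isOpen_compl.mem_nhds ?_, fun t ht h => ?_⟩
  · rintro ⟨t, ⟨ht, hte⟩, h⟩
    have := hi ht ht₀ h
    subst this
    simp at hte
    linarith
  · by_contra hcon
    exact h ⟨t, ⟨ht, not_lt.1 hcon⟩, rfl⟩

theorem arc_hasLogs {η : ℝ → ℂ} (hab : α ≤ β) (hc : ContinuousOn η (Icc α β))
    (hi : InjOn η (Icc α β)) : HasLogs (η '' Icc α β) := by
  intro f hf hf0
  obtain ⟨σ, hσ, hσ'⟩ := arc_inverse hc hi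
  obtain ⟨φ, hφ, h⟩ := exists_log_real (fun t => f (η (projIcc α β hab t)))
    (hf.comp_continuous (hc.comp_continuous (by fun_prop) fun t => (projIcc α β hab t).2)
      fun t => mem_image_of_mem _ (projIcc α β hab t).2)
    (fun t => hf0 _ (mem_image_of_mem _ (projIcc α β hab t).2))
  refine ⟨fun z => φ (σ z), hφ.comp_continuousOn hσ, ?_⟩
  rintro _ ⟨t, ht, rfl⟩
  simp only [hσ' t ht]
  rw [← h t, projIcc_of_mem hab ht]

theorem arc_local (hS : LocallyEuclidean2 S) (hc : ContinuousOn γ (Icc α β))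
    (hi : InjOn γ (Icc α β)) {t₀ : ℝ}
    (ht₀ : t₀ ∈ Icc α β) {D : Set S} (hD : D ∈ 𝓝 (γ t₀)) :
    ∃ (ι : ℂ → S) (r R : ℝ) (A' A₁ B₁ B₂ : Set ℂ), IsOpenEmbedding ι ∧ ι 0 = γ t₀ ∧ range ι ⊆ D ∧
      0 < r ∧ r ≤ R ∧ IsClosed A' ∧ HasLogs A' ∧ A' ⊆ A₁ ∪ (B₁ ∪ B₂) ∧ A₁ ⊆ ball 0 R ∧
      B₁ ⊆ A' ∧ B₂ ⊆ A' ∧ IsPreconnected B₁ ∧ IsPreconnected B₂ ∧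
      (∀ z ∈ B₁, r ≤ ‖z - 0‖) ∧ (∀ z ∈ B₂, r ≤ ‖z - 0‖) ∧
      (∀ z ∈ ball (0:ℂ) R, ι z ∈ γ '' Icc α β ↔ z ∈ A') ∧ (t₀ = β → B₂ = ∅) := by
  obtain ⟨ι, hι, hι0, hr⟩ := chart_at hS (γ t₀) hD
  have hnb : ∀ r > 0, ι '' ball 0 r ∈ 𝓝 (γ t₀) := fun r hr =>
    (hι.isOpenMap _ isOpen_ball).mem_nhds ⟨0, mem_ball_self hr, hι0⟩
  have hnb' : ∀ W ∈ 𝓝 (γ t₀), ∃ R > 0, ∀ z ∈ ball (0:ℂ) R, ι z ∈ W := by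
    intro W hW
    rw [← hι0] at hW
    exact Metric.mem_nhds_iff.1 (hι.continuous.continuousAt hW)
  obtain ⟨ε₁, hε₁, h1⟩ := arc_near hc ht₀ (hι.isOpen_range.mem_nhds ⟨0, hι0⟩)
  obtain ⟨W₁, hW₁, hW₁'⟩ := arc_far hc hi ht₀ hε₁
  obtain ⟨R, hR, hRW⟩ := hnb' _ hW₁
  obtain ⟨ε₂, hε₂, h2⟩ := arc_near hc ht₀ (hnb R hR)
  obtain ⟨W₂, hW₂, hW₂'⟩ := arc_far hc hi ht₀ hε₂
  obtain ⟨r₀, hr₀, hrW⟩ := hnb' _ hW₂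
  set a := max α (t₀ - ε₁) with ha
  set b := min β (t₀ + ε₁) with hb
  have hat : a ≤ t₀ := max_le ht₀.1 (by linarith)
  have htb : t₀ ≤ b := le_min ht₀.2 (by linarith)
  have hab : a ≤ b := hat.trans htb
  have hJ : ∀ t, t ∈ Icc a b ↔ t ∈ Icc α β ∧ |t - t₀| ≤ ε₁ := by
    intro t
    simp only [ha, hb, mem_Icc, max_le_iff, le_min_iff, abs_le]
    constructor
    · rintro ⟨⟨h1, h2⟩, h3, h4⟩
      exact ⟨⟨h1, h3⟩, by linarith, by linarith⟩
    · rintro ⟨⟨h1, h2⟩, h3, h4⟩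
      exact ⟨⟨h1, by linarith⟩, h2, by linarith⟩
  set η : ℝ → ℂ := fun t => Function.invFun ι (γ t) with hη
  have hιη : ∀ t ∈ Icc a b, ι (η t) = γ t := by
    intro t ht
    obtain ⟨z, hz⟩ := h1 t ((hJ t).1 ht).1 ((hJ t).1 ht).2
    exact Function.invFun_eq ⟨z, hz⟩
  have hJs : Icc a b ⊆ Icc α β := fun t ht => ((hJ t).1 ht).1
  have hηc : ContinuousOn η (Icc a b) := by
    rw [hι.isInducing.continuousOn_iff]
    exact (hc.mono hJs).congr fun t ht => hιη t ht
  have hηi : InjOn η (Icc a b) := by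
    intro t ht s hs h
    apply hi (hJs ht) (hJs hs)
    rw [← hιη t ht, ← hιη s hs, h]
  have hfar : ∀ t ∈ Icc a b, ε₂ ≤ |t - t₀| → min r₀ R ≤ ‖η t - 0‖ := by
    intro t ht hte
    by_contra hcon
    have : |t - t₀| < ε₂ := hW₂' t (hJs ht) (by
      rw [← hιη t ht]
      apply hrW
      rw [mem_ball, dist_eq_norm]
      exact (not_le.1 hcon).trans_le (min_le_left _ _))
    linarith
  refine ⟨ι, min r₀ R, R, η '' Icc a b, η '' (Icc a b ∩ {t | |t - t₀| ≤ ε₂}),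
    η '' Icc a (t₀ - ε₂), η '' Icc (t₀ + ε₂) b, hι, hι0, hr, lt_min hr₀ hR, min_le_right _ _,
    arc_closed hηc, arc_hasLogs hab hηc hηi, ?_, ?_, ?_, ?_, ?_, ?_, ?_, ?_, ?_, ?_⟩
  · rintro _ ⟨t, ht, rfl⟩
    by_cases hte : |t - t₀| ≤ ε₂
    · exact Or.inl ⟨t, ⟨ht, hte⟩, rfl⟩
    · right
      rcases lt_abs.1 (not_le.1 hte) with h | h
      · exact Or.inr ⟨t, ⟨by linarith, ht.2⟩, rfl⟩
      · exact Or.inl ⟨t, ⟨ht.1, by linarith⟩, rfl⟩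
  · rintro _ ⟨t, ⟨ht, hte⟩, rfl⟩
    obtain ⟨z, hz, hzt⟩ := h2 t (hJs ht) hte
    rw [← hιη t ht] at hzt
    rwa [← hι.injective hzt]
  · exact image_mono (Icc_subset_Icc le_rfl (by linarith))
  · exact image_mono (Icc_subset_Icc (by linarith) le_rfl)
  · exact isPreconnected_Icc.image _ (hηc.mono (Icc_subset_Icc le_rfl (by linarith)))
  · exact isPreconnected_Icc.image _ (hηc.mono (Icc_subset_Icc (by linarith) le_rfl))
  · rintro _ ⟨t, ht, rfl⟩
    refine hfar t ⟨ht.1, by linarith [ht.2]⟩ ?_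
    rw [abs_sub_comm]
    exact le_trans (by linarith [ht.2]) (le_abs_self _)
  · rintro _ ⟨t, ht, rfl⟩
    refine hfar t ⟨by linarith [ht.1], ht.2⟩ ?_
    exact le_trans (by linarith [ht.1]) (le_abs_self _)
  · intro z hz
    constructor
    · rintro ⟨t, ht, htz⟩
      have htJ : t ∈ Icc a b := (hJ t).2 ⟨ht, (hW₁' t ht (by rw [htz]; exact hRW z hz)).le⟩
      refine ⟨t, htJ, hι.injective ?_⟩
      rw [hιη t htJ, htz]
    · rintro ⟨t, ht, rfl⟩
      exact ⟨t, hJs ht, (hιη t ht).symm⟩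
  · intro h
    rw [Icc_eq_empty, image_empty]
    have : b ≤ β := min_le_left _ _
    linarith

/-- The complement of an arc is locally connected at its endpoint. -/
theorem arc_end (hS : LocallyEuclidean2 S) (hab : α ≤ β) (hc : ContinuousOn γ (Icc α β))
    (hi : InjOn γ (Icc α β)) {D : Set S} (hD : D ∈ 𝓝 (γ β)) :
    ∃ V ∈ 𝓝 (γ β), ∀ p ∈ V \ γ '' Icc α β, ∀ q ∈ V \ γ '' Icc α β,
      ∃ Z, IsPreconnected Z ∧ p ∈ Z ∧ q ∈ Z ∧ Z ⊆ D \ γ '' Icc α β := by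
  obtain ⟨ι, r, R, A', A₁, B₁, B₂, hι, hι0, hιD, hr, hrR, hA', hlog, hcov, hA₁, hB₁A, hB₂A, hB₁,
    hB₂, hB₁r, hB₂r, hiff, hend⟩ := arc_local hS hc hi (right_mem_Icc.2 hab) hD
  have hB₂e := hend rfl
  subst hB₂e
  rw [union_empty] at hcov
  refine ⟨ι '' ball 0 r, (hι.isOpenMap _ isOpen_ball).mem_nhds ⟨0, mem_ball_self hr, hι0⟩, ?_⟩
  rintro _ ⟨⟨p, hp, rfl⟩, hpA⟩ _ ⟨⟨q, hq, rfl⟩, hqA⟩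
  have hp' : p ∈ ball 0 r \ A' := ⟨hp, fun h => hpA ((hiff p (ball_subset_ball hrR hp)).2 h)⟩
  have hq' : q ∈ ball 0 r \ A' := ⟨hq, fun h => hqA ((hiff q (ball_subset_ball hrR hq)).2 h)⟩
  have := planar_two hA' hlog hrR hcov hA₁ hB₁A hB₁ hB₁r hp' hq'
  refine ⟨ι '' connectedComponentIn (ball 0 R \ A') p,
    isPreconnected_connectedComponentIn.image _ hι.continuous.continuousOn,
    mem_image_of_mem _ (mem_connectedComponentIn ⟨ball_subset_ball hrR hp, hp'.2⟩),
    mem_image_of_mem _ this, ?_⟩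
  rintro _ ⟨z, hz, rfl⟩
  have hz' := connectedComponentIn_subset _ _ hz
  exact ⟨hιD ⟨z, rfl⟩, fun h => hz'.2 ((hiff z hz'.1).1 h)⟩

/-- Near any point of an arc there are at most two local complementary domains. -/
theorem arc_inner (hS : LocallyEuclidean2 S) (hc : ContinuousOn γ (Icc α β))
    (hi : InjOn γ (Icc α β)) {t₀ : ℝ} (ht₀ : t₀ ∈ Icc α β) {D : Set S} (hD : D ∈ 𝓝 (γ t₀)) :
    ∃ V ∈ 𝓝 (γ t₀), ∀ p : Fin 3 → S, (∀ i, p i ∈ V \ γ '' Icc α β) →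
      ∃ i j, i ≠ j ∧ ∃ Z, IsPreconnected Z ∧ p i ∈ Z ∧ p j ∈ Z ∧ Z ⊆ D \ γ '' Icc α β := by
  obtain ⟨ι, r, R, A', A₁, B₁, B₂, hι, hι0, hιD, hr, hrR, hA', hlog, hcov, hA₁, hB₁A, hB₂A, hB₁,
    hB₂, hB₁r, hB₂r, hiff, -⟩ := arc_local hS hc hi ht₀ hD
  refine ⟨ι '' ball 0 r, (hι.isOpenMap _ isOpen_ball).mem_nhds ⟨0, mem_ball_self hr, hι0⟩, ?_⟩
  intro p hp
  choose z hz hzp using fun i => (hp i).1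
  have hp' : ∀ i, z i ∈ ball 0 r \ A' := fun i => ⟨hz i, fun h => (hp i).2 (by
    rw [← hzp i]
    exact (hiff _ (ball_subset_ball hrR (hz i))).2 h)⟩
  obtain ⟨i, j, hij, h⟩ :=
    planar_three hA' hlog hrR hcov hA₁ hB₁A hB₂A hB₁ hB₂ hB₁r hB₂r hp'
  refine ⟨i, j, hij, ι '' connectedComponentIn (ball 0 R \ A') (z i),
    isPreconnected_connectedComponentIn.image _ hι.continuous.continuousOn,
    ⟨_, mem_connectedComponentIn ⟨ball_subset_ball hrR (hz i), (hp' i).2⟩, hzp i⟩,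
    ⟨_, h, hzp j⟩, ?_⟩
  rintro _ ⟨w, hw, rfl⟩
  have hw' := connectedComponentIn_subset _ _ hw
  exact ⟨hιD ⟨w, rfl⟩, fun h => hw'.2 ((hiff w hw'.1).1 h)⟩

theorem no_inj_plane (σ : ℂ → ℝ) (hσ : Continuous σ) (hi : Function.Injective σ) : False := by
  have hrank : 1 < Module.rank ℝ ℂ := by rw [Complex.rank_real_complex]; norm_num
  obtain ⟨u, v, w, huv, hvw⟩ : ∃ u v w : ℂ, σ u < σ v ∧ σ v < σ w := by
    have h01 : σ 0 ≠ σ 1 := fun h => by simpa using hi h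
    have h02 : σ 0 ≠ σ 2 := fun h => by simpa using hi h
    have h12 : σ 1 ≠ σ 2 := fun h => by simpa using hi h
    rcases lt_or_gt_of_ne h01 with h | h <;> rcases lt_or_gt_of_ne h02 with h' | h' <;>
      rcases lt_or_gt_of_ne h12 with h'' | h''
    · exact ⟨0, 1, 2, h, h''⟩
    · exact ⟨0, 2, 1, h', h''⟩
    · exact ⟨2, 0, 1, h', h⟩
    · exact ⟨2, 0, 1, h', h⟩
    · exact ⟨1, 0, 2, h, h'⟩
    · exact ⟨1, 0, 2, h, h'⟩
    · exact ⟨1, 2, 0, h'', h'⟩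
    · exact ⟨2, 1, 0, h'', h⟩
  have hp : IsPreconnected ({v}ᶜ : Set ℂ) :=
    (isConnected_compl_singleton_of_one_lt_rank hrank v).isPreconnected
  have := (hp.image σ hσ.continuousOn).ordConnected.out
    ⟨u, by rintro rfl; exact lt_irrefl _ huv, rfl⟩ ⟨w, by rintro rfl; exact lt_irrefl _ hvw, rfl⟩
    ⟨huv.le, hvw.le⟩
  obtain ⟨z, hz, hzv⟩ := this
  exact hz (hi hzv)

/-- Arcs have empty interior. -/
theorem arc_interior (hS : LocallyEuclidean2 S) (hc : ContinuousOn γ (Icc α β))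
    (hi : InjOn γ (Icc α β)) {U : Set S} (hU : IsOpen U) (hne : U.Nonempty) :
    (U \ γ '' Icc α β).Nonempty := by
  by_contra hcon
  have hUA : U ⊆ γ '' Icc α β := by
    intro x hx
    by_contra h
    exact hcon ⟨x, hx, h⟩
  obtain ⟨x, hx⟩ := hne
  obtain ⟨ι, hι, -, hr⟩ := chart_at hS x (hU.mem_nhds hx)
  obtain ⟨σ, hσ, hσ'⟩ := arc_inverse hc hi
  have hm : ∀ z, ι z ∈ γ '' Icc α β := fun z => hUA (hr ⟨z, rfl⟩)
  refine no_inj_plane (fun z => σ (ι z)) (hσ.comp_continuous hι.continuous hm) ?_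
  intro z w h
  apply hι.injective
  obtain ⟨s, hs, hsz⟩ := hm z
  obtain ⟨t, ht, htw⟩ := hm w
  simp only [← hsz, ← htw, hσ' s hs, hσ' t ht] at h ⊢
  rw [h]

end arcs

end K3n

namespace K3n
open Complex

theorem hits_frontier {S : Type*} [TopologicalSpace S] {Z F : Set S} (hZ : IsPreconnected Z)
    {p q : S} (hp : p ∈ Z) (hq : q ∈ Z) (hpF : p ∈ interior F) (hqF : q ∉ closure F) :
    ∃ w ∈ Z, w ∈ frontier F := by
  by_contra! h
  obtain ⟨w, hw, hw1, hw2⟩ := hZ (interior F) (closure F)ᶜ isOpen_interior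
    isClosed_closure.isOpen_compl (by
      intro w hw
      by_cases hwi : w ∈ interior F
      · exact Or.inl hwi
      · exact Or.inr fun hc => h w hw ⟨hc, hwi⟩) ⟨p, hp, hpF⟩ ⟨q, hq, hqF⟩
  exact hw2 (interior_subset_closure hw1)

/-- A family of arcs with common endpoints and disjoint interiors. -/
structure Theta (S : Type*) [TopologicalSpace S] (n : ℕ) where
  γ : Fin n → ℝ → S
  u : S
  v : S
  hc : ∀ j, ContinuousOn (γ j) (Icc 0 1)
  hi : ∀ j, InjOn (γ j) (Icc 0 1)
  h0 : ∀ j, γ j 0 = u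
  h1 : ∀ j, γ j 1 = v
  hd : ∀ j l, j ≠ l → ∀ s ∈ Ioo (0:ℝ) 1, ∀ t ∈ Icc (0:ℝ) 1, γ j s ≠ γ l t

namespace Theta

section basic
variable {S : Type*} [TopologicalSpace S] {n : ℕ} (θ : Theta S n)

def P (j : Fin n) : Set S := θ.γ j '' Icc 0 1
def X : Set S := ⋃ j, θ.P j

def rev : Theta S n where
  γ := fun j t => θ.γ j (1 - t)
  u := θ.v
  v := θ.u
  hc := fun j => (θ.hc j).comp (by fun_prop) (fun t ht => ⟨by linarith [ht.2], by linarith [ht.1]⟩)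
  hi := fun j s hs t ht h => by
    have := θ.hi j (x₁ := 1 - s) (x₂ := 1 - t) ⟨by linarith [hs.2], by linarith [hs.1]⟩ ⟨by linarith [ht.2], by linarith [ht.1]⟩ h
    linarith
  h0 := fun j => by simpa using θ.h1 j
  h1 := fun j => by simpa using θ.h0 j
  hd := fun j l hjl s hs t ht => θ.hd j l hjl _ ⟨by linarith [hs.2], by linarith [hs.1]⟩ _
    ⟨by linarith [ht.2], by linarith [ht.1]⟩

theorem rev_P (j : Fin n) : θ.rev.P j = θ.P j := by
  ext x
  constructor
  · rintro ⟨t, ht, rfl⟩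
    exact ⟨1 - t, ⟨by linarith [ht.2], by linarith [ht.1]⟩, rfl⟩
  · rintro ⟨t, ht, rfl⟩
    refine ⟨1 - t, ⟨by linarith [ht.2], by linarith [ht.1]⟩, ?_⟩
    simp [rev]

theorem rev_X : θ.rev.X = θ.X := by simp [X, rev_P]

theorem P_subset (j : Fin n) : θ.P j ⊆ θ.X := subset_iUnion _ j

theorem hits_P {j : Fin n} {x : S} (hx : x ∈ θ.X)
    (hx' : ∀ l, l ≠ j → x ∉ θ.P l) : x ∈ θ.P j := by
  obtain ⟨l, hl⟩ := mem_iUnion.1 hx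
  by_cases h : l = j
  · rwa [← h]
  · exact (hx' l h hl).elim
end basic

variable {S : Type*} [TopologicalSpace S] [T2Space S] {n : ℕ} (θ : Theta S n)

theorem P_closed (j : Fin n) : IsClosed (θ.P j) := arc_closed (θ.hc j)
theorem X_closed : IsClosed θ.X := isClosed_iUnion_of_finite θ.P_closed

theorem away (j : Fin n) {t : ℝ} (ht : t ∈ Ioo (0:ℝ) 1) :
    (⋃ l, ⋃ (_ : l ≠ j), θ.P l)ᶜ ∈ 𝓝 (θ.γ j t) := by
  apply IsOpen.mem_nhds
  · rw [isOpen_compl_iff]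
    exact isClosed_iUnion_of_finite fun l => isClosed_iUnion_of_finite fun _ => θ.P_closed l
  · simp only [mem_compl_iff, mem_iUnion, not_exists]
    rintro l hl ⟨s, hs, h⟩
    exact θ.hd j l (Ne.symm hl) t ht s hs h.symm

theorem face_frontier (hS : LocallyEuclidean2 S) (x : S) :
    frontier (connectedComponentIn θ.Xᶜ x) ⊆ θ.X := by
  have := locConn hS
  have := frontier_component θ.X_closed.isOpen_compl x
  rwa [compl_compl] at this

theorem face_open (hS : LocallyEuclidean2 S) (x : S) :
    IsOpen (connectedComponentIn θ.Xᶜ x) := by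
  have := locConn hS
  exact θ.X_closed.isOpen_compl.connectedComponentIn

theorem touch_left (hS : LocallyEuclidean2 S) (j : Fin n) (x : S) {t : ℝ} (ht0 : 0 < t)
    (ht : t ≤ 1/2) (htF : θ.γ j t ∈ closure (connectedComponentIn θ.Xᶜ x)) :
    θ.γ j (1/2) ∈ closure (connectedComponentIn θ.Xᶜ x) := by
  by_contra hb
  set F := connectedComponentIn θ.Xᶜ x with hF
  have hFX : F ⊆ θ.Xᶜ := connectedComponentIn_subset _ _
  have hcont : ContinuousOn (θ.γ j) (Icc t (1/2)) :=
    (θ.hc j).mono (Icc_subset_Icc ht0.le (by norm_num))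
  have hK : IsCompact (Icc t (1/2) ∩ θ.γ j ⁻¹' closure F) :=
    isCompact_Icc.of_isClosed_subset
      (hcont.preimage_isClosed_of_isClosed isClosed_Icc isClosed_closure) inter_subset_left
  obtain ⟨m, ⟨hm, hmF⟩, hmax⟩ := hK.exists_isGreatest ⟨t, ⟨le_rfl, ht⟩, htF⟩
  have hm2 : m < 1/2 := lt_of_le_of_ne hm.2 (by rintro rfl; exact hb hmF)
  have hm0 : 0 < m := ht0.trans_le hm.1
  have hafter : ∀ s, m < s → s ≤ 1/2 → θ.γ j s ∉ closure F := by
    intro s hs hs2 h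
    have := hmax ⟨⟨hm.1.trans hs.le, hs2⟩, h⟩
    linarith
  have hsub : Icc 0 m ⊆ Icc (0:ℝ) 1 := Icc_subset_Icc le_rfl (by linarith)
  -- the neighbourhood `D`
  have hD1 := θ.away j (t := m) ⟨hm0, by linarith⟩
  have hD2 : (θ.γ j '' Icc (1/2) 1)ᶜ ∈ 𝓝 (θ.γ j m) := by
    apply IsOpen.mem_nhds
    · exact (arc_closed ((θ.hc j).mono (Icc_subset_Icc (by norm_num) le_rfl))).isOpen_compl
    · rintro ⟨s, hs, h⟩
      have := θ.hi j ⟨by linarith [hs.1], hs.2⟩ ⟨hm0.le, by linarith⟩ h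
      linarith [hs.1]
  obtain ⟨V, hV, hVZ⟩ := arc_end hS hm0.le ((θ.hc j).mono hsub) ((θ.hi j).mono hsub)
    (inter_mem hD1 hD2)
  obtain ⟨p, hpV, hpF⟩ := mem_closure_iff_nhds.1 hmF V hV
  obtain ⟨ε, hε, hεV⟩ := arc_near (θ.hc j) (t₀ := m) ⟨hm0.le, by linarith⟩ hV
  set s := min (m + ε) (1/2) with hs
  have hms : m < s := lt_min (by linarith) hm2
  have hs2 : s ≤ 1/2 := min_le_right _ _
  have hsI : s ∈ Icc (0:ℝ) 1 := ⟨by linarith, by linarith⟩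
  have hqV : θ.γ j s ∈ V := hεV s hsI (by
    have : s ≤ m + ε := min_le_left _ _
    rw [abs_le]; constructor <;> linarith)
  obtain ⟨Z, hZ, hpZ, hqZ, hZs⟩ := hVZ p ⟨hpV, fun ⟨a, ha, hap⟩ =>
      hFX hpF (θ.P_subset j ⟨a, hsub ha, hap⟩)⟩ (θ.γ j s) ⟨hqV, by
    rintro ⟨a, ha, h⟩
    have := θ.hi j (hsub ha) hsI h
    linarith [ha.2]⟩
  obtain ⟨w, hwZ, hwF⟩ := hits_frontier hZ hpZ hqZ
    (by rw [(θ.face_open hS x).interior_eq]; exact hpF) (hafter s hms hs2)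
  have hwX := θ.face_frontier hS x hwF
  obtain ⟨⟨hw1, hw2⟩, hw3⟩ := hZs hwZ
  obtain ⟨a, ha, rfl⟩ := θ.hits_P (j := j) hwX fun l hl h =>
    hw1 (mem_iUnion₂.2 ⟨l, hl, h⟩)
  have ha1 : m < a := by
    by_contra hcon
    exact hw3 ⟨a, ⟨ha.1, not_lt.1 hcon⟩, rfl⟩
  have ha2 : a < 1/2 := by
    by_contra hcon
    exact hw2 ⟨a, ⟨not_lt.1 hcon, ha.2⟩, rfl⟩
  exact hafter a ha1 ha2.le (frontier_subset_closure hwF)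

theorem touch (hS : LocallyEuclidean2 S) (j : Fin n) (x : S) {t : ℝ} (ht : t ∈ Ioo (0:ℝ) 1)
    (htF : θ.γ j t ∈ closure (connectedComponentIn θ.Xᶜ x)) :
    θ.γ j (1/2) ∈ closure (connectedComponentIn θ.Xᶜ x) := by
  rcases le_total t (1/2) with h | h
  · exact θ.touch_left hS j x ht.1 h htF
  · have := θ.rev.touch_left hS j x (t := 1 - t) (by linarith [ht.2]) (by linarith)
    rw [rev_X] at this
    simp only [rev] at this
    rw [show (1:ℝ) - (1 - t) = t by ring, show (1:ℝ) - 1/2 = 1/2 by norm_num] at this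
    exact this htF

/-- at most two faces touch the middle of an arc -/
theorem two_faces (hS : LocallyEuclidean2 S) (j : Fin n) (x : Fin 3 → S)
    (hx : ∀ i, θ.γ j (1/2) ∈ closure (connectedComponentIn θ.Xᶜ (x i))) :
    ∃ i k, i ≠ k ∧ connectedComponentIn θ.Xᶜ (x i) = connectedComponentIn θ.Xᶜ (x k) := by
  obtain ⟨V, hV, h⟩ := arc_inner hS (θ.hc j) (θ.hi j) (t₀ := 1/2) ⟨by norm_num, by norm_num⟩
    (θ.away j (t := 1/2) ⟨by norm_num, by norm_num⟩)
  choose p hpV hpF using fun i => mem_closure_iff_nhds.1 (hx i) V hV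
  have hpX : ∀ i, p i ∈ θ.Xᶜ := fun i => connectedComponentIn_subset _ _ (hpF i)
  obtain ⟨i, k, hik, Z, hZ, hi, hk, hZs⟩ := h p fun i =>
    ⟨hpV i, fun h => hpX i (θ.P_subset j h)⟩
  refine ⟨i, k, hik, ?_⟩
  have hZX : Z ⊆ θ.Xᶜ := by
    intro w hw hwX
    exact (hZs hw).2 (θ.hits_P (j := j) hwX fun l hl h => (hZs hw).1 (mem_iUnion₂.2 ⟨l, hl, h⟩))
  have := hZ.subset_connectedComponentIn hi hZX hk
  rw [connectedComponentIn_eq (hpF i), connectedComponentIn_eq this,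
    ← connectedComponentIn_eq (hpF k)]

/-- a face different from another one is not bounded by a single arc -/
theorem not_single [ConnectedSpace S] (hS : LocallyEuclidean2 S) (j : Fin n) {x c : S}
    (hx : x ∈ θ.Xᶜ) (hc : c ∈ θ.Xᶜ)
    (hne : connectedComponentIn θ.Xᶜ x ≠ connectedComponentIn θ.Xᶜ c)
    (hfr : frontier (connectedComponentIn θ.Xᶜ x) ⊆ θ.P j) : False := by
  set F := connectedComponentIn θ.Xᶜ x with hF
  have hFo : IsOpen F := θ.face_open hS x
  have hdisj : Disjoint F (connectedComponentIn θ.Xᶜ c) := by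
    rw [Set.disjoint_left]
    intro y h1 h2
    exact hne ((connectedComponentIn_eq h1).trans (connectedComponentIn_eq h2).symm)
  have hcF : c ∉ closure F := fun h =>
    (Set.disjoint_left.1 (hdisj.closure_left (θ.face_open hS c))) h (mem_connectedComponentIn hc)
  have hne' : (frontier (closure F)).Nonempty := by
    rw [nonempty_frontier_iff]
    exact ⟨⟨x, subset_closure (mem_connectedComponentIn hx)⟩, fun h => hcF (by rw [h]; trivial)⟩
  have hsub : frontier (closure F) ⊆ θ.P j := frontier_closure_subset.trans hfr
  have hK : IsCompact (Icc 0 1 ∩ θ.γ j ⁻¹' frontier (closure F)) :=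
    isCompact_Icc.of_isClosed_subset
      ((θ.hc j).preimage_isClosed_of_isClosed isClosed_Icc isClosed_frontier) inter_subset_left
  obtain ⟨m, ⟨hm, hmF⟩, hmax⟩ := hK.exists_isGreatest (by
    obtain ⟨y, hy⟩ := hne'
    obtain ⟨t, ht, rfl⟩ := hsub hy
    exact ⟨t, ht, hy⟩)
  have hIm : Icc 0 m ⊆ Icc (0:ℝ) 1 := Icc_subset_Icc le_rfl hm.2
  have hcm := (θ.hc j).mono hIm
  have him := (θ.hi j).mono hIm
  obtain ⟨V, hV, hVZ⟩ := arc_end hS hm.1 hcm him univ_mem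
  obtain ⟨p, hpV, hpF⟩ := mem_closure_iff_nhds.1
    (frontier_subset_closure (frontier_closure_subset hmF)) V hV
  have hpA : p ∉ θ.γ j '' Icc 0 m := fun ⟨a, ha, hap⟩ =>
    connectedComponentIn_subset _ _ hpF (θ.P_subset j ⟨a, hIm ha, hap⟩)
  obtain ⟨y, hyV, hyF⟩ : (interior V ∩ (closure F)ᶜ).Nonempty := by
    have : θ.γ j m ∈ closure (closure F)ᶜ := by
      rw [frontier_eq_closure_inter_closure] at hmF
      exact hmF.2
    exact mem_closure_iff_nhds.1 this _ (interior_mem_nhds.2 hV)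
  obtain ⟨q, ⟨hqV, hqF⟩, hqA⟩ := arc_interior hS hcm him
    (isOpen_interior.inter isClosed_closure.isOpen_compl) ⟨y, hyV, hyF⟩
  obtain ⟨Z, hZ, hpZ, hqZ, hZs⟩ := hVZ p ⟨hpV, hpA⟩ q ⟨interior_subset hqV, hqA⟩
  obtain ⟨w, hwZ, hwF⟩ := hits_frontier hZ hpZ hqZ (F := closure F)
    (interior_maximal subset_closure hFo hpF) (by rw [closure_closure]; exact hqF)
  obtain ⟨a, ha, rfl⟩ := hsub hwF
  exact (hZs hwZ).2 ⟨a, ⟨ha.1, hmax ⟨ha, hwF⟩⟩, rfl⟩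

theorem two_touch [ConnectedSpace S] (hS : LocallyEuclidean2 S) (hn : 0 < n) {x c : S}
    (hx : x ∈ θ.Xᶜ) (hc : c ∈ θ.Xᶜ)
    (hne : connectedComponentIn θ.Xᶜ x ≠ connectedComponentIn θ.Xᶜ c) :
    ∃ j l, j ≠ l ∧ θ.γ j (1/2) ∈ closure (connectedComponentIn θ.Xᶜ x) ∧
      θ.γ l (1/2) ∈ closure (connectedComponentIn θ.Xᶜ x) := by
  by_contra! hcon
  obtain ⟨j, hj⟩ : ∃ j, ∀ l, θ.γ l (1/2) ∈ closure (connectedComponentIn θ.Xᶜ x) → l = j := by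
    by_cases h : ∃ j, θ.γ j (1/2) ∈ closure (connectedComponentIn θ.Xᶜ x)
    · obtain ⟨j, hj⟩ := h
      refine ⟨j, fun l hl => ?_⟩
      by_contra hlj
      exact hcon j l (Ne.symm hlj) hj hl
    · push Not at h
      exact ⟨⟨0, hn⟩, fun l hl => (h l hl).elim⟩
  refine θ.not_single hS j hx hc hne ?_
  intro w hw
  obtain ⟨l, t, ht, rfl⟩ := mem_iUnion.1 (θ.face_frontier hS x hw)
  rcases ht.1.eq_or_lt with h | h
  · subst h
    exact ⟨0, by simp, by rw [θ.h0, θ.h0]⟩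
  rcases ht.2.eq_or_lt with h' | h'
  · subst h'
    exact ⟨1, by simp, by rw [θ.h1, θ.h1]⟩
  · have := hj l (θ.touch hS l x ⟨h, h'⟩ (frontier_subset_closure hw))
    subst this
    exact ⟨t, ht, rfl⟩

theorem faces_bound [ConnectedSpace S] (hS : LocallyEuclidean2 S) (hn : 0 < n) {c : S}
    (hc : c ∈ θ.Xᶜ)
    (hb : ∀ j, θ.γ j (1/2) ∈ closure (connectedComponentIn θ.Xᶜ c)) :
    ∃ P : Set S, P.Finite ∧ Disjoint P θ.X ∧
      (∀ x ∈ θ.Xᶜ, ∃ p ∈ P, p ∈ connectedComponentIn θ.Xᶜ x) ∧ 2 * P.ncard ≤ n + 2 := by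
  classical
  let 𝓕 : Set (Set S) := {F | ∃ x ∈ θ.Xᶜ, F = connectedComponentIn θ.Xᶜ x ∧
    F ≠ connectedComponentIn θ.Xᶜ c}
  have hF : ∀ F : 𝓕, ∃ x ∈ θ.Xᶜ, (F : Set S) = connectedComponentIn θ.Xᶜ x ∧
    (F : Set S) ≠ connectedComponentIn θ.Xᶜ c := fun F => F.2
  choose x hxX hFx hFc using hF
  choose j l hjl hj hl using fun F : 𝓕 =>
    θ.two_touch hS hn (hxX F) hc (by rw [← hFx F]; exact hFc F)
  let m : 𝓕 × Bool → Fin n := fun a => if a.2 then j a.1 else l a.1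
  have hm : ∀ a, θ.γ (m a) (1/2) ∈ closure (connectedComponentIn θ.Xᶜ (x a.1)) := by
    rintro ⟨F, b⟩
    cases b
    · exact hl F
    · exact hj F
  have hminj : Function.Injective m := by
    rintro ⟨F, b⟩ ⟨G, b'⟩ h
    have hFG : F = G := by
      by_contra hFG
      obtain ⟨i, k, hik, he⟩ := θ.two_faces hS (m (F, b)) ![c, x F, x G] (by
        intro i
        fin_cases i
        · exact hb _
        · exact hm (F, b)
        · simp only [h]
          exact hm (G, b'))
      have e1 : connectedComponentIn θ.Xᶜ c ≠ connectedComponentIn θ.Xᶜ (x F) := by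
        rw [← hFx F]; exact (hFc F).symm
      have e2 : connectedComponentIn θ.Xᶜ c ≠ connectedComponentIn θ.Xᶜ (x G) := by
        rw [← hFx G]; exact (hFc G).symm
      have e3 : connectedComponentIn θ.Xᶜ (x F) ≠ connectedComponentIn θ.Xᶜ (x G) := by
        rw [← hFx F, ← hFx G]; exact fun h => hFG (Subtype.ext h)
      fin_cases i <;> fin_cases k <;> simp at hik he
      · exact e1 he
      · exact e2 he
      · exact e1 he.symm
      · exact e3 he
      · exact e2 he.symm
      · exact e3 he.symm
    subst hFG
    have : b = b' := by
      cases b <;> cases b'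
      · rfl
      · exact (hjl F h.symm).elim
      · exact (hjl F h).elim
      · rfl
    rw [this]
  have hfin : Finite (𝓕 × Bool) := Finite.of_injective m hminj
  have hfin' : Finite 𝓕 := Finite.of_injective (fun F : 𝓕 => (F, true)) (fun F G h => by simpa using h)
  have hcard : Nat.card 𝓕 * 2 ≤ n := by
    have := Nat.card_le_card_of_injective m hminj
    rw [Nat.card_prod] at this
    simpa using this
  refine ⟨insert c (range x), (finite_range x).insert c, ?_, ?_, ?_⟩
  · rw [Set.disjoint_left]
    rintro _ (rfl | ⟨F, rfl⟩)
    · exact hc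
    · exact hxX F
  · intro y hy
    by_cases h : connectedComponentIn θ.Xᶜ y = connectedComponentIn θ.Xᶜ c
    · exact ⟨c, mem_insert _ _, by rw [h]; exact mem_connectedComponentIn hc⟩
    · let F : 𝓕 := ⟨connectedComponentIn θ.Xᶜ y, y, hy, rfl, h⟩
      refine ⟨x F, Or.inr ⟨F, rfl⟩, ?_⟩
      have : connectedComponentIn θ.Xᶜ y = connectedComponentIn θ.Xᶜ (x F) := hFx F
      rw [this]
      exact mem_connectedComponentIn (hxX F)
  · have h1 := Set.ncard_insert_le c (range x)
    have h2 : (range x).ncard ≤ Nat.card 𝓕 := by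
      rw [← image_univ, ← Set.ncard_univ]
      exact Set.ncard_image_le
    omega

end Theta

end K3n

namespace K3n
open Complex

namespace Theta

/-- the bound on the number of arcs -/
theorem count {S : Type*} [MetricSpace S] [CompactSpace S] [ConnectedSpace S]
    (hS : LocallyEuclidean2 S) :
    ∃ β : ℕ, ∀ (r : ℕ) (θ : Theta S (r + 1)) (c : S), c ∈ θ.Xᶜ →
      (∀ j, θ.γ j (1/2) ∈ closure (connectedComponentIn θ.Xᶜ c)) → r ≤ 2 * β + 3 := by
  classical
  obtain ⟨β, hβ⟩ := rank_bound hS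
  refine ⟨β, fun r θ c hc hb => ?_⟩
  obtain ⟨P, hP, hPX, hPc, hcard⟩ := θ.faces_bound hS (Nat.succ_pos r) hc hb
  choose σ hσ hσ' using fun j => arc_inverse (θ.hc j) (θ.hi j)
  let f : Fin r → S → ℂ := fun t x =>
    if x ∈ θ.P t.succ then exp (2 * Real.pi * I * σ t.succ x) else 1
  have hf1 : ∀ (t : Fin r) (s : ℝ), s ∈ Icc (0:ℝ) 1 →
      f t (θ.γ t.succ s) = exp (2 * Real.pi * I * s) := by
    intro t s hs
    simp only [f]
    rw [if_pos ⟨s, hs, rfl⟩, hσ' _ s hs]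
  have hf2 : ∀ (t : Fin r) (l : Fin (r + 1)), l ≠ t.succ → ∀ s ∈ Icc (0:ℝ) 1,
      f t (θ.γ l s) = 1 := by
    intro t l hl s hs
    by_cases hx : θ.γ l s ∈ θ.P t.succ
    · obtain ⟨a, ha, hal⟩ := hx
      rw [← hal, hf1 t a ha]
      rcases ha.1.eq_or_lt with h | h
      · rw [← h]; simp
      rcases ha.2.eq_or_lt with h' | h'
      · rw [h']
        simp [Complex.exp_two_pi_mul_I]
      · exact (θ.hd _ l hl.symm a ⟨h, h'⟩ s hs hal).elim
    · simp only [f]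
      rw [if_neg hx]
  have hfc : ∀ t, ContinuousOn (f t) θ.X := by
    intro t
    refine (locallyFinite_of_finite _).continuousOn_iUnion θ.P_closed fun l => ?_
    refine arc_cont (θ.hc l) (θ.hi l) ?_
    by_cases hl : l = t.succ
    · subst hl
      have : ContinuousOn (fun s : ℝ => exp (2 * Real.pi * I * s)) (Icc 0 1) := by fun_prop
      exact this.congr fun s hs => hf1 t s hs
    · exact (continuousOn_const (c := (1:ℂ))).congr fun s hs => hf2 t l hl s hs
  have hf0 : ∀ t, ∀ x ∈ θ.X, f t x ≠ 0 := by
    intro t x _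
    simp only [f]
    split_ifs
    · exact exp_ne_zero _
    · exact one_ne_zero
  have hmem : ∀ l, ∀ s ∈ Icc (0:ℝ) 1, θ.γ l s ∈ θ.X := fun l s hs => θ.P_subset l ⟨s, hs, rfl⟩
  have h0I : (0:ℝ) ∈ Icc (0:ℝ) 1 := by simp
  have h1I : (1:ℝ) ∈ Icc (0:ℝ) 1 := by simp
  have := hβ θ.X P r f θ.X_closed hP hPX hPc hfc hf0 (by
    intro k φ hφ hk
    have hφc : ∀ l, ContinuousOn (fun s => φ (θ.γ l s)) (Icc 0 1) := fun l =>
      hφ.comp_continuousOn (θ.hc l)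
    have huv : φ θ.u = φ θ.v := by
      obtain ⟨m, hm⟩ := log_unique (isPreconnected_Icc (a := (0:ℝ)) (b := 1)) (hφc 0)
        (continuousOn_const (c := (0:ℂ))) (fun s hs => by
          rw [hk _ (hmem 0 s hs), exp_zero]
          refine Finset.prod_eq_one fun t _ => ?_
          rw [hf2 t 0 (Fin.succ_ne_zero t).symm s hs, one_zpow])
      have e0 := hm 0 h0I
      have e1 := hm 1 h1I
      rw [θ.h0] at e0
      rw [θ.h1] at e1
      rw [e0, e1]
    ext t
    obtain ⟨m, hm⟩ := log_unique (isPreconnected_Icc (a := (0:ℝ)) (b := 1)) (hφc t.succ)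
      (ψ := fun s => k t * (2 * Real.pi * I * s)) (by fun_prop) (fun s hs => by
        rw [hk _ (hmem _ s hs), Complex.exp_int_mul, Finset.prod_eq_single t]
        · rw [hf1 t s hs]
        · intro t' _ ht'
          rw [hf2 t' t.succ (fun h => ht' (Fin.succ_injective _ h).symm) s hs, one_zpow]
        · intro h; exact (h (Finset.mem_univ _)).elim)
    have e0 := hm 0 h0I
    have e1 := hm 1 h1I
    rw [θ.h0] at e0
    rw [θ.h1] at e1
    rw [huv, e1] at e0
    have hpi : (2 * Real.pi * I : ℂ) ≠ 0 := two_pi_I_ne_zero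
    have : (k t : ℂ) * (2 * Real.pi * I) = 0 := by
      have := e0
      push_cast at this
      linear_combination this
    have := (mul_eq_zero.1 this).resolve_right hpi
    exact_mod_cast this)
  omega

end Theta

/-- joining two arcs -/
theorem join_arcs {S : Type*} [TopologicalSpace S] {A B : Set S} {a b c : S}
    (hA : IsArcFrom A a b) (hB : IsArcFrom B c b) (hAB : A ∩ B ⊆ {b}) :
    ∃ γ : ℝ → S, ContinuousOn γ (Icc 0 1) ∧ InjOn γ (Icc 0 1) ∧ γ 0 = a ∧ γ 1 = c ∧
      γ (1/2) = b ∧ γ '' Icc 0 1 ⊆ A ∪ B := by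
  obtain ⟨f, hf, hfi, hfA, hf0, hf1⟩ := hA
  obtain ⟨g, hg, hgi, hgB, hg0, hg1⟩ := hB
  have h01 : (0:ℝ) ≤ 1 := zero_le_one
  let γ : ℝ → S := fun s =>
    if s ≤ 1/2 then f (projIcc 0 1 h01 (2 * s)) else g (projIcc 0 1 h01 (2 - 2 * s))
  have hp0 : projIcc (0:ℝ) 1 h01 0 = ⟨0, by norm_num⟩ := projIcc_left h01
  have hp1 : projIcc (0:ℝ) 1 h01 1 = ⟨1, by norm_num⟩ := projIcc_right h01
  have hγ1 : ∀ s, s ≤ 1/2 → γ s = f (projIcc 0 1 h01 (2 * s)) := fun s hs => if_pos hs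
  have hγ2 : ∀ s, 1/2 < s → γ s = g (projIcc 0 1 h01 (2 - 2 * s)) :=
    fun s hs => if_neg (not_le.2 hs)
  have hmem1 : ∀ s, s ≤ 1/2 → γ s ∈ A := fun s hs => by
    rw [hγ1 s hs, ← hfA]; exact mem_range_self _
  have hmem2 : ∀ s, 1/2 < s → γ s ∈ B := fun s hs => by
    rw [hγ2 s hs, ← hgB]; exact mem_range_self _
  have hpr : ∀ x ∈ Icc (0:ℝ) 1, ∀ y ∈ Icc (0:ℝ) 1,
      projIcc (0:ℝ) 1 h01 x = projIcc 0 1 h01 y → x = y := by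
    intro x hx y hy h
    rw [projIcc_of_mem h01 hx, projIcc_of_mem h01 hy] at h
    exact congrArg Subtype.val h
  have hcross : ∀ s t, s ∈ Icc (0:ℝ) 1 → t ∈ Icc (0:ℝ) 1 → s ≤ 1/2 → 1/2 < t → γ s ≠ γ t := by
    intro s t hs ht h1 h2 h
    have hb : γ t = b := hAB ⟨by rw [← h]; exact hmem1 s h1, hmem2 t h2⟩
    rw [hγ2 t h2, ← hg1, ← hp1] at hb
    have := hpr _ ⟨by linarith [ht.2], by linarith⟩ _ ⟨h01, le_rfl⟩ (hgi hb)
    linarith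
  refine ⟨γ, ?_, ?_, ?_, ?_, ?_, ?_⟩
  · apply Continuous.continuousOn
    refine Continuous.if_le ?_ ?_ continuous_id continuous_const ?_
    · exact hf.comp (continuous_projIcc.comp (by fun_prop))
    · exact hg.comp (continuous_projIcc.comp (by fun_prop))
    · intro s hs
      subst hs
      rw [show (2:ℝ) * (1/2) = 1 by norm_num, show (2:ℝ) - 1 = 1 by norm_num, hp1, hf1, hg1]
  · intro s hs t ht h
    rcases le_or_gt s (1/2) with h1 | h1 <;> rcases le_or_gt t (1/2) with h2 | h2
    · rw [hγ1 s h1, hγ1 t h2] at h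
      have := hpr _ ⟨by linarith [hs.1], by linarith⟩ _ ⟨by linarith [ht.1], by linarith⟩ (hfi h)
      linarith
    · exact (hcross s t hs ht h1 h2 h).elim
    · exact (hcross t s ht hs h2 h1 h.symm).elim
    · rw [hγ2 s h1, hγ2 t h2] at h
      have := hpr _ ⟨by linarith [hs.2], by linarith⟩ _ ⟨by linarith [ht.2], by linarith⟩ (hgi h)
      linarith
  · rw [hγ1 0 (by norm_num), mul_zero, hp0, hf0]
  · rw [hγ2 1 (by norm_num), mul_one, sub_self, hp0, hg0]
  · rw [hγ1 _ le_rfl, show (2:ℝ) * (1/2) = 1 by norm_num, hp1, hf1]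
  · rintro _ ⟨s, _, rfl⟩
    rcases le_or_gt s (1/2) with h1 | h1
    · exact Or.inl (hmem1 s h1)
    · exact Or.inr (hmem2 s h1)

end K3n

/-- For every closed surface `S` there is an `n` such that the complete bipartite
graph `K_{3,n}` cannot be topologically embedded in `S`. -/
theorem no_embedding_K3n
    {S : Type*} [MetricSpace S] [CompactSpace S] [ConnectedSpace S] [Nonempty S]
    (hS : LocallyEuclidean2 S) :
    ∃ n : ℕ, ¬ ∃ (a : Fin 3 → S) (b : Fin n → S) (A : Fin 3 → Fin n → Set S),
      Function.Injective a ∧ Function.Injective b ∧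
      (∀ i j, a i ≠ b j) ∧
      (∀ i j, IsArcFrom (A i j) (a i) (b j)) ∧
      (∀ i j i' j', (i, j) ≠ (i', j') →
        (A i j \ {a i, b j}) ∩ (A i' j' \ {a i', b j'}) = ∅) ∧
      (∀ i j, (A i j \ {a i, b j}) ∩ (Set.range a ∪ Set.range b) = ∅) := by
  obtain ⟨β, hβ⟩ := K3n.Theta.count hS
  refine ⟨2 * β + 4 + 1, ?_⟩
  rintro ⟨a, b, A, ha, hb, hab, hA, hdis, hvert⟩
  -- the vertices lying on an arc
  have hva : ∀ i j i', a i' ∈ A i j → i' = i := by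
    intro i j i' h
    by_contra hne
    have : a i' ∈ (A i j \ {a i, b j}) ∩ (Set.range a ∪ Set.range b) := by
      refine ⟨⟨h, ?_⟩, Or.inl ⟨i', rfl⟩⟩
      rintro (h | h)
      · exact hne (ha h)
      · exact hab _ _ h
    rw [hvert] at this
    exact this
  have hvb : ∀ i j j', b j' ∈ A i j → j' = j := by
    intro i j j' h
    by_contra hne
    have : b j' ∈ (A i j \ {a i, b j}) ∩ (Set.range a ∪ Set.range b) := by
      refine ⟨⟨h, ?_⟩, Or.inr ⟨j', rfl⟩⟩
      rintro (h | h)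
      · exact hab _ _ h.symm
      · exact hne (hb h)
    rw [hvert] at this
    exact this
  -- common points of two arcs
  have hcom : ∀ i j i' j', (i, j) ≠ (i', j') → ∀ x ∈ A i j, x ∈ A i' j' →
      (x = a i ∧ i = i') ∨ (x = b j ∧ j = j') := by
    intro i j i' j' hne x hx hx'
    by_cases h1 : x = a i
    · subst h1
      exact Or.inl ⟨rfl, hva _ _ _ hx'⟩
    by_cases h2 : x = b j
    · subst h2
      exact Or.inr ⟨rfl, hvb _ _ _ hx'⟩
    by_cases h3 : x = a i'
    · subst h3
      have := hva _ _ _ hx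
      subst this
      exact (h1 rfl).elim
    by_cases h4 : x = b j'
    · subst h4
      have := hvb _ _ _ hx
      subst this
      exact (h2 rfl).elim
    have : x ∈ (A i j \ {a i, b j}) ∩ (A i' j' \ {a i', b j'}) :=
      ⟨⟨hx, by simp [h1, h2]⟩, ⟨hx', by simp [h3, h4]⟩⟩
    rw [hdis i j i' j' hne] at this
    exact this.elim
  choose γ hγc hγi hγ0 hγ1 hγb hγA using fun j => K3n.join_arcs (hA 0 j) (hA 1 j) (by
    rintro x ⟨h1, h2⟩
    rcases hcom 0 j 1 j (by simp) x h1 h2 with h | h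
    · exact absurd h.2 (by decide)
    · exact h.1)
  let θ : K3n.Theta S (2 * β + 4 + 1) :=
    { γ := γ, u := a 0, v := a 1, hc := hγc, hi := hγi, h0 := hγ0, h1 := hγ1
      hd := by
        intro j l hjl s hs t ht h
        have hsI : s ∈ Icc (0:ℝ) 1 := ⟨hs.1.le, hs.2.le⟩
        have e0 : γ j s ≠ a 0 := by
          rw [← hγ0 j]; intro h
          have := hγi j hsI ⟨le_rfl, zero_le_one⟩ h
          linarith [hs.1]
        have e1 : γ j s ≠ a 1 := by
          rw [← hγ1 j]; intro h
          have := hγi j hsI ⟨zero_le_one, le_rfl⟩ h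
          linarith [hs.2]
        have hj : γ j s ∈ A 0 j ∪ A 1 j := hγA j ⟨s, hsI, rfl⟩
        have hl : γ j s ∈ A 0 l ∪ A 1 l := by rw [h]; exact hγA l ⟨t, ht, rfl⟩
        have hne : ∀ i i' : Fin 3, (i, j) ≠ (i', l) := fun i i' h => hjl (congrArg Prod.snd h)
        rcases hj with hj | hj <;> rcases hl with hl | hl <;>
          rcases hcom _ _ _ _ (hne _ _) _ hj hl with h | h
        · exact e0 h.1
        · exact hjl h.2
        · exact e0 h.1
        · exact hjl h.2
        · exact e1 h.1
        · exact hjl h.2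
        · exact e1 h.1
        · exact hjl h.2 }
  have hθX : ∀ x ∈ θ.X, ∃ j, x ∈ A 0 j ∪ A 1 j := by
    intro x hx
    obtain ⟨j, hj⟩ := mem_iUnion.1 hx
    exact ⟨j, hγA j hj⟩
  have hc : a 2 ∈ θ.Xᶜ := by
    intro hx
    obtain ⟨j, hj | hj⟩ := hθX _ hx
    · exact absurd (hva _ _ _ hj) (by decide)
    · exact absurd (hva _ _ _ hj) (by decide)
  have := hβ _ θ (a 2) hc (by
    intro j
    change γ j (1/2) ∈ _
    rw [hγb j]
    obtain ⟨f, hf, hfi, hfA, hf0, hf1⟩ := hA 2 j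
    have h01 : (0:ℝ) ≤ 1 := zero_le_one
    have hFc : Continuous (fun s : ℝ => f (projIcc 0 1 h01 s)) := hf.comp continuous_projIcc
    have hZ : (fun s : ℝ => f (projIcc 0 1 h01 s)) '' Ico 0 1 ⊆ connectedComponentIn θ.Xᶜ (a 2) := by
      refine (isPreconnected_Ico.image _ hFc.continuousOn).subset_connectedComponentIn ?_ ?_
      · refine ⟨0, ⟨le_rfl, one_pos⟩, ?_⟩
        rw [← hf0]
        exact congrArg f (projIcc_left h01)
      · rintro _ ⟨s, hs, rfl⟩ hx
        simp only [projIcc_of_mem h01 ⟨hs.1, hs.2.le⟩] at hx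
        have hx2 : f ⟨s, hs.1, hs.2.le⟩ ∈ A 2 j := by rw [← hfA]; exact mem_range_self _
        have hxb : f ⟨s, hs.1, hs.2.le⟩ ≠ b j := by
          rw [← hf1]; intro h
          have := congrArg Subtype.val (hfi h)
          simp only at this
          linarith [hs.2]
        obtain ⟨l, hl | hl⟩ := hθX _ hx
        · rcases hcom 2 j 0 l (by simp) _ hx2 hl with h | h
          · exact absurd h.2 (by decide)
          · exact hxb h.1
        · rcases hcom 2 j 1 l (by simp) _ hx2 hl with h | h
          · exact absurd h.2 (by decide)
          · exact hxb h.1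
    refine closure_mono hZ ?_
    have h1 : (1:ℝ) ∈ closure (Ico (0:ℝ) 1) := by
      rw [closure_Ico zero_ne_one]; exact ⟨zero_le_one, le_rfl⟩
    have := image_closure_subset_closure_image hFc ⟨1, h1, rfl⟩
    simp only [projIcc_right] at this
    rwa [← hf1])
  omega
end

section
/- Kuratowski's theorem: Let X ⊆ ℂ be a continuum. If there exist three pairwise distinct complementary domains U₁, U₂, U₃ of X such that the frontier of each Uᵢ equals X, then X is either indecomposable or 2-indecomposable. -/
open Set Metric Filter Topology

/-- Two continuous logarithms of one function on a preconnected set differ by a constant. -/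
lemma kur_log_const {α : Type*} [TopologicalSpace α] {S : Set α} (hS : IsPreconnected S)
    {g : α → ℂ} (hg : ContinuousOn g S) {c : ℂ} (h : ∀ z ∈ S, Complex.exp (g z) = c)
    {x y : α} (hx : x ∈ S) (hy : y ∈ S) : g x = g y := by
  refine hS.induction₂' (fun x y => g x = g y) ?_ (fun _ _ _ _ _ _ h1 h2 => h1.trans h2) hx hy
  intro x hx
  have h1 : ∀ᶠ y in 𝓝[S] x, dist (g y) (g x) < 1 := by
    have := hg x hx
    exact this (Metric.ball_mem_nhds _ one_pos)
  filter_upwards [h1, self_mem_nhdsWithin] with y h2 hyS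
  suffices g y = g x from ⟨this.symm, this⟩
  obtain ⟨n, hn⟩ := Complex.exp_eq_exp_iff_exists_int.1 ((h y hyS).trans (h x hx).symm)
  rw [hn, dist_eq_norm] at h2
  have h3 : |(n : ℝ)| * (2 * Real.pi) < 1 := by
    simpa [abs_of_pos Real.pi_pos] using h2
  have h4 : n = 0 := by
    by_contra h0
    have h5 : (1 : ℝ) ≤ |(n : ℝ)| := by exact_mod_cast Int.one_le_abs h0
    nlinarith [Real.pi_gt_three]
  simpa [h4] using hn

lemma kur_log_diff {S : Set ℂ} (hS : IsPreconnected S) {h g g' : ℂ → ℂ}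
    (hg : ContinuousOn g S) (hg' : ContinuousOn g' S)
    (e : ∀ z ∈ S, Complex.exp (g z) = h z) (e' : ∀ z ∈ S, Complex.exp (g' z) = h z) :
    ∃ n : ℤ, ∀ z ∈ S, g z = g' z + n * (2 * Real.pi * Complex.I) := by
  rcases S.eq_empty_or_nonempty with rfl | ⟨x, hx⟩
  · exact ⟨0, by simp⟩
  obtain ⟨n, hn⟩ := Complex.exp_eq_exp_iff_exists_int.1 ((e x hx).trans (e' x hx).symm)
  refine ⟨n, fun z hz => ?_⟩
  have := kur_log_const hS (g := fun z => g z - g' z) (hg.sub hg') (c := 1)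
    (fun z hz => Complex.exp_eq_exp_iff_exp_sub_eq_one.1 ((e z hz).trans (e' z hz).symm)) hz hx
  linear_combination this + hn

lemma kur_glue {A B : Set ℂ} (hA : IsClosed A) (hB : IsClosed B) {f g : ℂ → ℂ}
    (hf : ContinuousOn f A) (hg : ContinuousOn g B) (h : ∀ z ∈ A, z ∈ B → f z = g z) :
    ∃ k : ℂ → ℂ, ContinuousOn k (A ∪ B) ∧ (∀ z ∈ A, k z = f z) ∧ (∀ z ∈ B, k z = g z) := by
  classical
  have h1 : ∀ z ∈ A, A.piecewise f g z = f z := fun z hz => Set.piecewise_eq_of_mem _ _ _ hz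
  have h2 : ∀ z ∈ B, A.piecewise f g z = g z := by
    intro z hz
    by_cases hzA : z ∈ A
    · rw [h1 z hzA, h z hzA hz]
    · exact Set.piecewise_eq_of_notMem _ _ _ hzA
  exact ⟨A.piecewise f g, (hf.congr h1).union_of_isClosed (hg.congr h2) hA hB, h1, h2⟩

/-- Points in one connected subset of the complement of `F` give a logarithm on `F`. -/
lemma kur_log_of_connected {F S : Set ℂ} (hF : IsClosed F) (hS : IsPreconnected S)
    (hSF : ∀ z ∈ S, z ∉ F) {u v : ℂ} (hu : u ∈ S) (hv : v ∈ S) :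
    ∃ g : ℂ → ℂ, ContinuousOn g F ∧ ∀ z ∈ F, Complex.exp (g z) = (z - u) / (z - v) := by
  have ne : ∀ x ∈ S, ∀ z ∈ F, z - x ≠ 0 := fun x hx z hz h0 =>
    hSF x hx (by rwa [← sub_eq_zero.1 h0])
  refine hS.induction₂ (fun u v => ∃ g : ℂ → ℂ, ContinuousOn g F ∧
    ∀ z ∈ F, Complex.exp (g z) = (z - u) / (z - v)) ?_ ?_ ?_ hu hv
  · intro x hx
    obtain ⟨r, hr, hrF⟩ := Metric.isOpen_iff.1 hF.isOpen_compl x (hSF x hx)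
    have h1 : ∀ᶠ y in 𝓝[S] x, y ∈ Metric.ball x r :=
      mem_nhdsWithin_of_mem_nhds (Metric.ball_mem_nhds _ hr)
    filter_upwards [h1, self_mem_nhdsWithin] with y hy hyS
    have key : ∀ z ∈ F, (z - y) / (z - x) ∈ Complex.slitPlane := by
      intro z hz
      have hzr : r ≤ ‖z - x‖ := by
        by_contra hlt
        exact hrF (by rw [Metric.mem_ball, dist_eq_norm]; exact not_le.1 hlt) hz
      have h0 := ne x hx z hz
      have e : (z - y) / (z - x) = 1 + (x - y) / (z - x) := by field_simp; ring
      rw [e]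
      apply Complex.mem_slitPlane_of_norm_lt_one
      rw [norm_div, div_lt_one (norm_pos_iff.2 h0)]
      rw [Metric.mem_ball, dist_comm, dist_eq_norm] at hy
      linarith
    refine ⟨fun z => - Complex.log ((z - y) / (z - x)), ?_, ?_⟩
    · refine (ContinuousOn.clog ?_ key).neg
      exact ContinuousOn.div (by fun_prop) (by fun_prop) (ne x hx)
    · intro z hz
      simp only
      rw [Complex.exp_neg, Complex.exp_log (div_ne_zero (ne y hyS z hz) (ne x hx z hz)), inv_div]
  · rintro x y z hx hy hz ⟨g, hg, e⟩ ⟨g', hg', e'⟩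
    refine ⟨fun w => g w + g' w, hg.add hg', fun w hw => ?_⟩
    have := ne y hy w hw
    have := ne z hz w hw
    simp only
    rw [Complex.exp_add, e w hw, e' w hw]
    field_simp
  · rintro x y hx hy ⟨g, hg, e⟩
    refine ⟨fun w => - g w, hg.neg, fun w hw => ?_⟩
    simp only
    rw [Complex.exp_neg, e w hw, inv_div]

/-- A nonzero power of `z - u` has no continuous logarithm relative to a bounded domain. -/
lemma kur_borsuk {U : Set ℂ} (hU : IsOpen U) (hb : Bornology.IsBounded U) {u : ℂ} (hu : u ∈ U)
    {q g : ℂ → ℂ} (hq : ContinuousOn q (closure U)) (hq0 : ∀ z ∈ closure U, q z ≠ 0)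
    (hg : ContinuousOn g (frontier U)) {a : ℤ}
    (e : ∀ z ∈ frontier U, (z - u) ^ a = Complex.exp (g z) * q z) : a = 0 := by
  obtain ⟨G, hG⟩ := ContinuousMap.exists_restrict_eq (Y := ℂ) (isClosed_frontier (s := U))
    ⟨(frontier U).domRestrict g, continuousOn_iff_continuous_domRestrict.1 hg⟩
  have hG' : ∀ z ∈ frontier U, G z = g z := fun z hz => congrArg (fun k => k ⟨z, hz⟩) hG
  have hne : ∀ z ∈ Uᶜ, z - u ≠ 0 := fun z hz h0 => hz (by rwa [sub_eq_zero.1 h0])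
  obtain ⟨k, hk, hk1, hk2⟩ := kur_glue (isClosed_closure (s := U)) hU.isClosed_compl
    (f := fun z => Complex.exp (G z) * q z) (g := fun z => (z - u) ^ a)
    (ContinuousOn.mul (by fun_prop) hq)
    (ContinuousOn.zpow₀ (by fun_prop) _ (fun z hz => Or.inl (hne z hz)))
    (fun z hz hz' => by
      have hzf : z ∈ frontier U := by rw [hU.frontier_eq]; exact ⟨hz, hz'⟩
      rw [e z hzf, hG' z hzf])
  have huniv : closure U ∪ Uᶜ = univ := by
    apply eq_univ_of_forall
    intro z
    by_cases hz : z ∈ U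
    · exact Or.inl (subset_closure hz)
    · exact Or.inr hz
  rw [huniv, continuousOn_univ] at hk
  have hk0 : ∀ z, k z ≠ 0 := by
    intro z
    by_cases hz : z ∈ U
    · rw [hk1 z (subset_closure hz)]
      exact mul_ne_zero (Complex.exp_ne_zero _) (hq0 z (subset_closure hz))
    · rw [hk2 z hz]
      exact zpow_ne_zero _ (hne z hz)
  obtain ⟨L, ⟨-, hL⟩, -⟩ := Complex.isCoveringMapOn_exp.existsUnique_continuousMap_lifts
    (A := ℂ) ⟨k, hk⟩ (a₀ := 0) (e₀ := Complex.log (k 0)) (Complex.exp_log (hk0 0)) hk0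
  have hL' : ∀ z, Complex.exp (L z) = k z := fun z => congrFun hL z
  obtain ⟨R, hR⟩ := hb.subset_ball u
  let R' := max R 1
  have hR'pos : 0 < R' := lt_of_lt_of_le one_pos (le_max_right _ _)
  let γ : ℝ → ℂ := fun θ => u + R' * Complex.exp (θ * Complex.I)
  have hγ : ∀ θ, γ θ ∈ Uᶜ := by
    intro θ hθ
    have := hR hθ
    rw [Metric.mem_ball, dist_eq_norm] at this
    simp only [γ, add_sub_cancel_left, norm_mul, Complex.norm_exp_ofReal_mul_I, mul_one,
      Complex.norm_real, Real.norm_eq_abs, abs_of_pos hR'pos] at this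
    exact absurd this (not_lt.2 (le_max_left _ _))
  have hc := kur_log_const (S := (univ : Set ℝ)) isPreconnected_univ
    (g := fun θ : ℝ => L (γ θ) - a * (θ * Complex.I)) (by fun_prop) (c := (R' : ℂ) ^ a)
    (fun θ _ => by
      have h1 : Complex.exp ((a : ℂ) * (θ * Complex.I)) = Complex.exp (θ * Complex.I) ^ a :=
        Complex.exp_int_mul _ _
      rw [Complex.exp_sub, hL', hk2 _ (hγ θ), h1]
      simp only [γ, add_sub_cancel_left, mul_zpow]
      exact mul_div_cancel_right₀ _ (zpow_ne_zero _ (Complex.exp_ne_zero _)))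
    (mem_univ 0) (mem_univ (2 * Real.pi))
  have h0 : γ 0 = γ (2 * Real.pi) := by
    simp [γ, Complex.exp_two_pi_mul_I]
  rw [h0] at hc
  have h5 : (a : ℂ) * (2 * Real.pi * Complex.I) = 0 := by
    push_cast at hc
    linear_combination hc
  rcases mul_eq_zero.1 h5 with h6 | h6
  · exact_mod_cast h6
  · exact absurd h6 Complex.two_pi_I_ne_zero

/-- The three pairwise logarithms can be normalized up to one integer. -/
lemma kur_three {X₁ X₂ X₃ : Set ℂ}
    (c₁ : IsPreconnected X₁) (c₂ : IsPreconnected X₂) (c₃ : IsPreconnected X₃) {h : ℂ → ℂ}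
    (H12 : ∃ g : ℂ → ℂ, ContinuousOn g (X₁ ∪ X₂) ∧ ∀ z ∈ X₁ ∪ X₂, Complex.exp (g z) = h z)
    (H13 : ∃ g : ℂ → ℂ, ContinuousOn g (X₁ ∪ X₃) ∧ ∀ z ∈ X₁ ∪ X₃, Complex.exp (g z) = h z)
    (H23 : ∃ g : ℂ → ℂ, ContinuousOn g (X₂ ∪ X₃) ∧ ∀ z ∈ X₂ ∪ X₃, Complex.exp (g z) = h z) :
    ∃ (n : ℤ) (g g' : ℂ → ℂ), ContinuousOn g (X₁ ∪ X₂) ∧ ContinuousOn g' X₃ ∧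
      (∀ z ∈ X₁ ∪ X₂, Complex.exp (g z) = h z) ∧ (∀ z ∈ X₃, Complex.exp (g' z) = h z) ∧
      (∀ z ∈ X₂, z ∈ X₃ → g z = g' z) ∧
      (∀ z ∈ X₁, z ∈ X₃ → g z = g' z + n * (2 * Real.pi * Complex.I)) := by
  obtain ⟨g12, k12, e12⟩ := H12
  obtain ⟨g13, k13, e13⟩ := H13
  obtain ⟨g23, k23, e23⟩ := H23
  obtain ⟨n1, hn1⟩ := kur_log_diff c₁ (k12.mono subset_union_left) (k13.mono subset_union_left)
    (fun z hz => e12 z (Or.inl hz)) (fun z hz => e13 z (Or.inl hz))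
  obtain ⟨n2, hn2⟩ := kur_log_diff c₂ (k12.mono subset_union_right) (k23.mono subset_union_left)
    (fun z hz => e12 z (Or.inr hz)) (fun z hz => e23 z (Or.inl hz))
  obtain ⟨n3, hn3⟩ := kur_log_diff c₃ (k13.mono subset_union_right) (k23.mono subset_union_right)
    (fun z hz => e13 z (Or.inr hz)) (fun z hz => e23 z (Or.inr hz))
  refine ⟨n1 + n3 - n2, g12, fun z => g23 z + n2 * (2 * Real.pi * Complex.I), k12,
    (k23.mono subset_union_right).add continuousOn_const, e12, ?_, fun z hz _ => hn2 z hz, ?_⟩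
  · intro z hz
    rw [← e23 z (Or.inr hz)]
    exact Complex.exp_eq_exp_iff_exists_int.2 ⟨n2, rfl⟩
  · intro z hz hz'
    rw [hn1 z hz, hn3 z hz']
    push_cast
    ring

lemma kur_combine {X₁ X₂ X₃ : Set ℂ}
    (k₁ : IsClosed X₁) (k₂ : IsClosed X₂) (k₃ : IsClosed X₃)
    (c₁ : IsPreconnected X₁) (c₂ : IsPreconnected X₂) (c₃ : IsPreconnected X₃)
    (u : Fin 2 → ℂ → ℂ)
    (H12 : ∀ i, ∃ g : ℂ → ℂ, ContinuousOn g (X₁ ∪ X₂) ∧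
      ∀ z ∈ X₁ ∪ X₂, Complex.exp (g z) = u i z)
    (H13 : ∀ i, ∃ g : ℂ → ℂ, ContinuousOn g (X₁ ∪ X₃) ∧
      ∀ z ∈ X₁ ∪ X₃, Complex.exp (g z) = u i z)
    (H23 : ∀ i, ∃ g : ℂ → ℂ, ContinuousOn g (X₂ ∪ X₃) ∧
      ∀ z ∈ X₂ ∪ X₃, Complex.exp (g z) = u i z) :
    ∃ a b : ℤ, ¬ (a = 0 ∧ b = 0) ∧ ∃ g : ℂ → ℂ, ContinuousOn g (X₁ ∪ X₂ ∪ X₃) ∧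
      ∀ z ∈ X₁ ∪ X₂ ∪ X₃, Complex.exp (g z) = u 0 z ^ a * u 1 z ^ b := by
  obtain ⟨n, g, g', hg, hg', e, e', h2, h1⟩ := kur_three c₁ c₂ c₃ (H12 0) (H13 0) (H23 0)
  obtain ⟨m, f, f', hf, hf', d, d', j2, j1⟩ := kur_three c₁ c₂ c₃ (H12 1) (H13 1) (H23 1)
  obtain ⟨a, b, hab, h0⟩ : ∃ a b : ℤ, ¬ (a = 0 ∧ b = 0) ∧ a * n + b * m = 0 := by
    by_cases hn : n = 0
    · exact ⟨1, 0, by simp, by simp [hn]⟩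
    · exact ⟨m, -n, by simp [hn], by ring⟩
  have h0' : (a : ℂ) * n + b * m = 0 := by exact_mod_cast h0
  refine ⟨a, b, hab, ?_⟩
  obtain ⟨k, hk, hk1, hk2⟩ := kur_glue (k₁.union k₂) k₃
    (f := fun z => a * g z + b * f z) (g := fun z => a * g' z + b * f' z)
    ((continuousOn_const.mul hg).add (continuousOn_const.mul hf))
    ((continuousOn_const.mul hg').add (continuousOn_const.mul hf'))
    (by
      rintro z (hz | hz) hz3
      · rw [h1 z hz hz3, j1 z hz hz3]
        linear_combination (2 * Real.pi * Complex.I) * h0'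
      · rw [h2 z hz hz3, j2 z hz hz3])
  refine ⟨k, hk, ?_⟩
  rintro z (hz | hz)
  · rw [hk1 z hz, Complex.exp_add, Complex.exp_int_mul, Complex.exp_int_mul, e z hz, d z hz]
  · rw [hk2 z hz, Complex.exp_add, Complex.exp_int_mul, Complex.exp_int_mul, e' z hz, d' z hz]

lemma kur_unbounded {X U V : Set ℂ} (hX : Bornology.IsBounded X)
    (hU : IsComplementaryDomain X U) (hV : IsComplementaryDomain X V)
    (bU : ¬ Bornology.IsBounded U) (bV : ¬ Bornology.IsBounded V) : U = V := by
  obtain ⟨R, hR⟩ := hX.subset_ball 0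
  let R' := max R 1
  have hR'pos : 0 < R' := lt_of_lt_of_le one_pos (le_max_right _ _)
  let E : Set ℂ := Complex.exp '' {w | Real.log R' < w.re}
  have hE : IsPreconnected E :=
    (convex_halfSpace_re_gt (Real.log R')).isPreconnected.image _ Complex.continuous_exp.continuousOn
  have hmem : ∀ z : ℂ, R' < ‖z‖ → z ∈ E := by
    intro z hz
    have hz0 : z ≠ 0 := norm_pos_iff.1 (hR'pos.trans hz)
    refine ⟨Complex.log z, ?_, Complex.exp_log hz0⟩
    rw [mem_ofPred_eq, Complex.log_re]
    exact Real.log_lt_log hR'pos hz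
  have hEX : E ⊆ Xᶜ := by
    rintro _ ⟨w, hw, rfl⟩ hx
    have h1 := hR hx
    rw [Metric.mem_ball, dist_zero_right, Complex.norm_exp] at h1
    have h2 : R' < Real.exp w.re := (Real.log_lt_iff_lt_exp hR'pos).1 hw
    exact absurd (h1.trans_le (le_max_left R 1)) (not_lt.2 h2.le)
  have hex : ∀ W : Set ℂ, ¬ Bornology.IsBounded W → ∃ z ∈ W, z ∈ E := by
    intro W hW
    by_contra! hcon
    apply hW
    refine (Metric.isBounded_closedBall (x := (0 : ℂ)) (r := R')).subset fun z hz => ?_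
    rw [Metric.mem_closedBall, dist_zero_right]
    exact not_lt.1 fun hlt => hcon z hz (hmem z hlt)
  obtain ⟨x, hx, rfl⟩ := hU
  obtain ⟨y, hy, rfl⟩ := hV
  obtain ⟨p, hp, hpE⟩ := hex _ bU
  obtain ⟨q, hq, hqE⟩ := hex _ bV
  rw [connectedComponentIn_eq hp, connectedComponentIn_eq hq]
  exact connectedComponentIn_eq (hE.subset_connectedComponentIn hpE hEX hqE)

lemma kur_domain {X U : Set ℂ} (hX : IsClosed X) (hU : IsComplementaryDomain X U) :
    IsOpen U ∧ IsPreconnected U ∧ U.Nonempty ∧ U ⊆ Xᶜ := by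
  obtain ⟨x, hx, rfl⟩ := hU
  exact ⟨hX.isOpen_compl.connectedComponentIn, isPreconnected_connectedComponentIn,
    ⟨x, mem_connectedComponentIn hx⟩, connectedComponentIn_subset _ _⟩

lemma kur_disjoint {X U V : Set ℂ} (hU : IsComplementaryDomain X U)
    (hV : IsComplementaryDomain X V) (h : U ≠ V) {z : ℂ} (hz : z ∈ U) : z ∉ V := by
  obtain ⟨x, hx, rfl⟩ := hU
  obtain ⟨y, hy, rfl⟩ := hV
  intro hz'
  exact h ((connectedComponentIn_eq hz).trans (connectedComponentIn_eq hz').symm)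

/-- A proper closed subset of the common frontier does not separate the two domains. -/
lemma kur_proper {X U V F : Set ℂ} (hX : IsClosed X) (hU : IsComplementaryDomain X U)
    (hV : IsComplementaryDomain X V) (bU : frontier U = X) (bV : frontier V = X)
    (hF : IsClosed F) (hFX : F ⊆ X) (hne : ¬ X ⊆ F) {u v : ℂ} (hu : u ∈ U) (hv : v ∈ V) :
    ∃ g : ℂ → ℂ, ContinuousOn g F ∧ ∀ z ∈ F, Complex.exp (g z) = (z - u) / (z - v) := by
  obtain ⟨p, hpX, hpF⟩ := not_subset.1 hne
  obtain ⟨-, cU, -, sU⟩ := kur_domain hX hU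
  obtain ⟨-, cV, -, sV⟩ := kur_domain hX hV
  have pU : p ∈ closure U := frontier_subset_closure (by rwa [bU])
  have pV : p ∈ closure V := frontier_subset_closure (by rwa [bV])
  have iU : IsPreconnected (insert p U) := cU.subset_closure (subset_insert _ _)
    (insert_subset pU subset_closure)
  have iV : IsPreconnected (insert p V) := cV.subset_closure (subset_insert _ _)
    (insert_subset pV subset_closure)
  refine kur_log_of_connected hF
    (iU.union p (mem_insert _ _) (mem_insert _ _) iV) ?_
    (Or.inl (mem_insert_of_mem _ hu)) (Or.inr (mem_insert_of_mem _ hv))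
  rintro z ((rfl | hz) | (rfl | hz))
  · exact hpF
  · exact fun h => sU hz (hFX h)
  · exact hpF
  · exact fun h => sV hz (hFX h)

lemma kur_main {X : Set ℂ} (hX : IsClosed X) {U₁ U₂ U₃ : Set ℂ}
    (hU₁ : IsComplementaryDomain X U₁) (hU₂ : IsComplementaryDomain X U₂)
    (hU₃ : IsComplementaryDomain X U₃)
    (h12 : U₁ ≠ U₂) (h13 : U₁ ≠ U₃) (h23 : U₂ ≠ U₃)
    (hb₁ : frontier U₁ = X) (hb₂ : frontier U₂ = X) (hb₃ : frontier U₃ = X)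
    (B₁ : Bornology.IsBounded U₁) (B₂ : Bornology.IsBounded U₂) :
    ¬ IsEssentialUnionOfThree X := by
  rintro ⟨X₁, X₂, X₃, ⟨-, k₁, c₁, s₁, -⟩, ⟨-, k₂, c₂, s₂, -⟩, ⟨-, k₃, c₃, s₃, -⟩, hun, n1, n2, n3⟩
  obtain ⟨o1, -, ⟨u₁, hu₁⟩, sU₁⟩ := kur_domain hX hU₁
  obtain ⟨o2, -, ⟨u₂, hu₂⟩, sU₂⟩ := kur_domain hX hU₂
  obtain ⟨-, -, ⟨u₃, hu₃⟩, sU₃⟩ := kur_domain hX hU₃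
  have P : ∀ F : Set ℂ, IsClosed F → F ⊆ X → ¬ X ⊆ F → ∀ i : Fin 2, ∃ g : ℂ → ℂ,
      ContinuousOn g F ∧ ∀ z ∈ F, Complex.exp (g z) =
        (![fun z => (z - u₁) / (z - u₃), fun z => (z - u₂) / (z - u₃)] : Fin 2 → ℂ → ℂ) i z := by
    intro F hF hFX hn i
    fin_cases i
    · exact kur_proper hX hU₁ hU₃ hb₁ hb₃ hF hFX hn hu₁ hu₃
    · exact kur_proper hX hU₂ hU₃ hb₂ hb₃ hF hFX hn hu₂ hu₃
  obtain ⟨a, b, hab, g, hg, e⟩ := kur_combine k₁ k₂ k₃ c₁.isPreconnected c₂.isPreconnected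
    c₃.isPreconnected _
    (P _ (k₁.union k₂) (union_subset s₁ s₂) (fun h => n3 (s₃.trans h)))
    (P _ (k₁.union k₃) (union_subset s₁ s₃) (fun h => n2 (s₂.trans h)))
    (P _ (k₂.union k₃) (union_subset s₂ s₃) (fun h => n1 (s₁.trans h)))
  rw [hun] at hg e
  simp only [Matrix.cons_val_zero, Matrix.cons_val_one] at e
  have ne : ∀ U : Set ℂ, frontier U = X → IsOpen U → ∀ u, u ∉ U → u ∉ X →
      ∀ z ∈ closure U, z - u ≠ 0 := by
    intro U hf ho u hu huX z hz h0
    rw [sub_eq_zero] at h0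
    subst h0
    exact huX (hf ▸ (by rw [ho.frontier_eq]; exact ⟨hz, hu⟩))
  have nX : ∀ u, u ∉ X → ∀ z ∈ X, z - u ≠ 0 := by
    intro u hu z hz h0
    rw [sub_eq_zero] at h0
    exact hu (h0 ▸ hz)
  apply hab
  have d21 := ne U₁ hb₁ o1 u₂ (kur_disjoint hU₂ hU₁ h12.symm hu₂) (sU₂ hu₂)
  have d31 := ne U₁ hb₁ o1 u₃ (kur_disjoint hU₃ hU₁ h13.symm hu₃) (sU₃ hu₃)
  have d12 := ne U₂ hb₂ o2 u₁ (kur_disjoint hU₁ hU₂ h12 hu₁) (sU₁ hu₁)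
  have d32 := ne U₂ hb₂ o2 u₃ (kur_disjoint hU₃ hU₂ h23.symm hu₃) (sU₃ hu₃)
  constructor
  · refine kur_borsuk o1 B₁ hu₁ (q := fun z => (z - u₃) ^ a * ((z - u₂) / (z - u₃)) ^ (-b)) (g := g)
      ?_ ?_ (by rwa [hb₁]) ?_
    · refine ContinuousOn.mul (ContinuousOn.zpow₀ (by fun_prop) _ fun z hz => Or.inl (d31 z hz)) ?_
      exact ContinuousOn.zpow₀ (ContinuousOn.div (by fun_prop) (by fun_prop) d31) _
        fun z hz => Or.inl (div_ne_zero (d21 z hz) (d31 z hz))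
    · exact fun z hz => mul_ne_zero (zpow_ne_zero _ (d31 z hz))
        (zpow_ne_zero _ (div_ne_zero (d21 z hz) (d31 z hz)))
    · intro z hz
      rw [hb₁] at hz
      have q3 := nX u₃ (sU₃ hu₃) z hz
      have q2 := nX u₂ (sU₂ hu₂) z hz
      have w3 : (z - u₃) ^ a ≠ 0 := zpow_ne_zero _ q3
      have w : ((z - u₂) / (z - u₃)) ^ b ≠ 0 := zpow_ne_zero _ (div_ne_zero q2 q3)
      rw [e z hz, zpow_neg, div_zpow (z - u₁)]
      field_simp
  · refine kur_borsuk o2 B₂ hu₂ (q := fun z => (z - u₃) ^ b * ((z - u₁) / (z - u₃)) ^ (-a)) (g := g)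
      ?_ ?_ (by rwa [hb₂]) ?_
    · refine ContinuousOn.mul (ContinuousOn.zpow₀ (by fun_prop) _ fun z hz => Or.inl (d32 z hz)) ?_
      exact ContinuousOn.zpow₀ (ContinuousOn.div (by fun_prop) (by fun_prop) d32) _
        fun z hz => Or.inl (div_ne_zero (d12 z hz) (d32 z hz))
    · exact fun z hz => mul_ne_zero (zpow_ne_zero _ (d32 z hz))
        (zpow_ne_zero _ (div_ne_zero (d12 z hz) (d32 z hz)))
    · intro z hz
      rw [hb₂] at hz
      have q3 := nX u₃ (sU₃ hu₃) z hz
      have q1 := nX u₁ (sU₁ hu₁) z hz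
      have w3 : (z - u₃) ^ b ≠ 0 := zpow_ne_zero _ q3
      have w : ((z - u₁) / (z - u₃)) ^ a ≠ 0 := zpow_ne_zero _ (div_ne_zero q1 q3)
      rw [e z hz, zpow_neg, div_zpow (z - u₂)]
      field_simp

/-- **Kuratowski's theorem.** A planar continuum which is the common boundary of
three of its complementary domains is indecomposable or 2-indecomposable. -/
theorem kuratowski_three_domains
    (X : Set ℂ) (hX : IsContinuum X)
    (U₁ U₂ U₃ : Set ℂ)
    (hU₁ : IsComplementaryDomain X U₁) (hU₂ : IsComplementaryDomain X U₂)
    (hU₃ : IsComplementaryDomain X U₃)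
    (h12 : U₁ ≠ U₂) (h13 : U₁ ≠ U₃) (h23 : U₂ ≠ U₃)
    (hb₁ : frontier U₁ = X) (hb₂ : frontier U₂ = X) (hb₃ : frontier U₃ = X) :
    ¬ IsDecomposable X ∨ Is2Indecomposable X := by
  refine or_iff_not_imp_left.2 fun h => ⟨not_not.1 h, ?_⟩
  have hc := hX.1.isClosed
  have hbd := hX.1.isBounded
  by_cases B₁ : Bornology.IsBounded U₁
  · by_cases B₂ : Bornology.IsBounded U₂
    · exact kur_main hc hU₁ hU₂ hU₃ h12 h13 h23 hb₁ hb₂ hb₃ B₁ B₂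
    · have B₃ : Bornology.IsBounded U₃ := by
        by_contra B₃
        exact h23 (kur_unbounded hbd hU₂ hU₃ B₂ B₃)
      exact kur_main hc hU₁ hU₃ hU₂ h13 h12 h23.symm hb₁ hb₃ hb₂ B₁ B₃
  · have B₂ : Bornology.IsBounded U₂ := by
      by_contra B₂
      exact h12 (kur_unbounded hbd hU₁ hU₂ B₁ B₂)
    have B₃ : Bornology.IsBounded U₃ := by
      by_contra B₃
      exact h13 (kur_unbounded hbd hU₁ hU₃ B₁ B₃)
    exact kur_main hc hU₂ hU₃ hU₁ h23 h12.symm h13.symm hb₂ hb₃ hb₁ B₂ B₃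
end

section
/- Burgess's planar theorem: Let X ⊆ ℂ be a continuum and let (Uₙ) be a sequence of pairwise distinct complementary domains of X. If the frontiers ∂Uₙ converge to X in the Hausdorff metric, then X is either indecomposable or 2-indecomposable. -/
open Set Metric Filter Topology

theorem bp_exists_sqrt (H : ℝ × ℝ → ℂ) (hc : Continuous H) (h0 : ∀ x, H x ≠ 0) :
    ∃ S : ℝ × ℝ → ℂ, Continuous S ∧ ∀ x, S x ^ 2 = H x := by
  obtain ⟨f, ⟨-, hf⟩, -⟩ := Complex.isCoveringMapOn_exp.existsUnique_continuousMap_lifts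
    (⟨H, hc⟩ : C(ℝ × ℝ, ℂ)) (a₀ := (0, 0)) (e₀ := Complex.log (H (0, 0)))
    (Complex.exp_log (h0 _)) (fun x => h0 x)
  refine ⟨fun x => Complex.exp (f x / 2), by fun_prop, fun x => ?_⟩
  have := congrFun hf x
  simp only [Function.comp_apply, ContinuousMap.coe_mk] at this
  rw [← this, ← Complex.exp_nat_mul]
  congr 1
  push_cast
  ring

theorem bp_exists_phi : ∃ φ : (ℝ → ℂ) → ℂ, ∀ S : ℝ → ℂ, Continuous S → (∀ x, S x ≠ 0) →
    S 1 = φ (fun x => S x ^ 2) * S 0 := by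
  classical
  refine ⟨fun g => if h : ∃ T : ℝ → ℂ, Continuous T ∧ ∀ x, T x ^ 2 = g x then
    h.choose 1 / h.choose 0 else 0, fun S hS h0 => ?_⟩
  have h : ∃ T : ℝ → ℂ, Continuous T ∧ ∀ x, T x ^ 2 = S x ^ 2 := ⟨S, hS, fun _ => rfl⟩
  simp only [dif_pos h]
  obtain ⟨hT, hTS⟩ := h.choose_spec
  set T := h.choose
  have key := isPreconnected_univ.eq_or_eq_neg_of_sq_eq hT.continuousOn hS.continuousOn
    (fun x _ => by simpa using hTS x) (fun {x} _ => h0 x)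
  have hs := h0 0
  rcases key with k | k
  · rw [k (mem_univ 1), k (mem_univ 0)]
    field_simp
  · rw [k (mem_univ 1), k (mem_univ 0)]
    simp only [Pi.neg_apply]
    field_simp

/-- Topological nonplanarity of `K₃,₃`, in a weak (Hanani-Tutte like) form. -/
theorem bp_K33 (P Q : Fin 3 → ℂ) (E : Fin 3 → Fin 3 → Set ℂ)
    (hE : ∀ i n, JoinedIn (E i n) (P i) (Q n))
    (hd : ∀ i j n m, i ≠ j → n ≠ m → Disjoint (E i n) (E j m)) : False := by
  obtain ⟨φ, hφ⟩ := bp_exists_phi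
  have hF : ∀ i n, ∃ f : ℝ → ℂ, Continuous f ∧ f 0 = P i ∧ f 1 = Q n ∧ ∀ t, f t ∈ E i n := by
    intro i n
    obtain ⟨γ, hγ⟩ := hE i n
    refine ⟨γ.extend, γ.continuous_extend, by simp, by simp, fun t => ?_⟩
    have : γ.extend t ∈ range γ.extend := ⟨t, rfl⟩
    rw [Path.extend_range] at this
    obtain ⟨u, hu⟩ := this
    rw [← hu]; exact hγ u
  choose F hFc hF0 hF1 hFE using hF
  have hne : ∀ i j n m, i ≠ j → n ≠ m → ∀ s t, F i n s - F j m t ≠ 0 := by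
    intro i j n m hij hnm s t h
    exact (Set.disjoint_left.mp (hd i j n m hij hnm)) (hFE i n s)
      (by rw [sub_eq_zero.mp h]; exact hFE j m t)
  -- `a v i n`
  let a : ℂ → Fin 3 → Fin 3 → ℂ := fun v i n => φ (fun x => F i n x - v)
  have main : ∀ i j n m, i ≠ j → n ≠ m →
      a (P j) i n * a (Q n) j m = a (P i) j m * a (Q m) i n ∧ a (Q n) j m ≠ 0 ∧
      a (P j) i n ^ 2 * (P i - P j) = Q n - P j ∧ Q n - P j ≠ 0 ∧ P i - P j ≠ 0 := by
    intro i j n m hij hnm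
    have hn := hne i j n m hij hnm
    obtain ⟨S, hS, hS2⟩ := bp_exists_sqrt (fun x => F i n x.1 - F j m x.2)
      (by have := hFc i n; have := hFc j m; fun_prop) (fun x => hn _ _)
    have hS0 : ∀ x, S x ≠ 0 := by
      intro x h
      have := hS2 x
      rw [h] at this
      exact hn x.1 x.2 (by rw [← this]; simp)
    have e1 : S (1, 0) = a (P j) i n * S (0, 0) := by
      have := hφ (fun s => S (s, 0)) (by fun_prop) (fun x => hS0 _)
      simpa only [hS2, hF0] using this
    have e2 : S (1, 1) = a (Q m) i n * S (0, 1) := by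
      have := hφ (fun s => S (s, 1)) (by fun_prop) (fun x => hS0 _)
      simpa only [hS2, hF1] using this
    have e3 : S (0, 1) = a (P i) j m * S (0, 0) := by
      have := hφ (fun s => Complex.I * S (0, s)) (by fun_prop)
        (fun x => mul_ne_zero Complex.I_ne_zero (hS0 _))
      simp only [mul_pow, hS2, hF0, Complex.I_sq, neg_one_mul, neg_sub] at this
      apply mul_left_cancel₀ Complex.I_ne_zero
      rw [this]; ring
    have e4 : S (1, 1) = a (Q n) j m * S (1, 0) := by
      have := hφ (fun s => Complex.I * S (1, s)) (by fun_prop)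
        (fun x => mul_ne_zero Complex.I_ne_zero (hS0 _))
      simp only [mul_pow, hS2, hF1, Complex.I_sq, neg_one_mul, neg_sub] at this
      apply mul_left_cancel₀ Complex.I_ne_zero
      rw [this]; ring
    have q1 := hS2 (1, 0)
    have q0 := hS2 (0, 0)
    simp only [hF0, hF1] at q0 q1
    refine ⟨?_, ?_, ?_, ?_, ?_⟩
    · apply mul_right_cancel₀ (hS0 (0, 0))
      have : a (Q n) j m * (a (P j) i n * S (0, 0)) = a (Q m) i n * (a (P i) j m * S (0, 0)) := by
        rw [← e1, ← e3, ← e4, ← e2]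
      linear_combination this
    · intro h
      rw [h, zero_mul] at e4
      exact hS0 _ e4
    · rw [← q0, ← q1, e1]; ring
    · rw [← q1]; exact pow_ne_zero _ (hS0 _)
    · rw [← q0]; exact pow_ne_zero _ (hS0 _)
  let B : Fin 3 → ℂ := fun j => a (Q 0) j 1 * a (Q 0) j 2 * a (Q 1) j 0 * a (Q 1) j 2 *
    a (Q 2) j 0 * a (Q 2) j 1
  let G : Fin 3 → ℂ := fun j => (Q 0 - P j) * (Q 1 - P j) * (Q 2 - P j)
  have nz : ∀ j, G j * B j ≠ 0 := by
    intro j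
    obtain ⟨i, hij⟩ : ∃ i : Fin 3, i ≠ j := exists_ne j
    have hb : ∀ n m, n ≠ m → a (Q n) j m ≠ 0 := fun n m h => (main i j n m hij h).2.1
    have hg : ∀ n, Q n - P j ≠ 0 := by
      intro n
      obtain ⟨m, hm⟩ : ∃ m : Fin 3, m ≠ n := exists_ne n
      exact (main i j n m hij hm.symm).2.2.2.1
    simp only [G, B]
    simp [hb, hg]
  have rel : ∀ i j, i ≠ j → G j * B j = - (G i * B i) := by
    intro i j hij
    have r := fun n m h => (main i j n m hij h).1
    have p0 := main i j 0 1 hij (by decide)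
    have p1 := main i j 1 0 hij (by decide)
    have p2 := main i j 2 0 hij (by decide)
    have s0 := main j i 0 1 hij.symm (by decide)
    have s1 := main j i 1 0 hij.symm (by decide)
    have s2 := main j i 2 0 hij.symm (by decide)
    have hp : P i - P j ≠ 0 := p0.2.2.2.2
    have prod : (a (P j) i 0 ^ 2 * a (P j) i 1 ^ 2 * a (P j) i 2 ^ 2) * B j =
        (a (P i) j 0 ^ 2 * a (P i) j 1 ^ 2 * a (P i) j 2 ^ 2) * B i := by
      have h01 := r 0 1 (by decide)
      have h02 := r 0 2 (by decide)
      have h10 := r 1 0 (by decide)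
      have h12 := r 1 2 (by decide)
      have h20 := r 2 0 (by decide)
      have h21 := r 2 1 (by decide)
      calc _ = (a (P j) i 0 * a (Q 0) j 1) * (a (P j) i 0 * a (Q 0) j 2) *
          (a (P j) i 1 * a (Q 1) j 0) * (a (P j) i 1 * a (Q 1) j 2) *
          (a (P j) i 2 * a (Q 2) j 0) * (a (P j) i 2 * a (Q 2) j 1) := by
            simp only [B]; ring
        _ = _ := by
            rw [h01, h02, h10, h12, h20, h21]; simp only [B]; ring
    have g1 : G j = (a (P j) i 0 ^ 2 * a (P j) i 1 ^ 2 * a (P j) i 2 ^ 2) * (P i - P j) ^ 3 := by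
      simp only [G]
      rw [← p0.2.2.1, ← p1.2.2.1, ← p2.2.2.1]; ring
    have g2 : G i = (a (P i) j 0 ^ 2 * a (P i) j 1 ^ 2 * a (P i) j 2 ^ 2) * (P j - P i) ^ 3 := by
      simp only [G]
      rw [← s0.2.2.1, ← s1.2.2.1, ← s2.2.2.1]; ring
    rw [g1, g2]
    linear_combination (P i - P j) ^ 3 * prod
  have r1 := rel 0 1 (by decide)
  have r2 := rel 1 2 (by decide)
  have r3 := rel 2 0 (by decide)
  have : G 0 * B 0 = 0 := by linear_combination (1 / 2 : ℂ) * r3 - (1 / 2 : ℂ) * r2 + (1 / 2 : ℂ) * r1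
  exact nz 0 this

theorem bp_path_order (U : Set ℂ) (hUo : IsOpen U) (hUc : IsConnected U) (D : Fin 3 → Set ℂ)
    (hDc : ∀ i, IsClosed (D i)) (hDd : ∀ i j, i ≠ j → Disjoint (D i) (D j))
    (hDU : ∀ i, (D i ∩ U).Nonempty) :
    ∃ σ : Fin 3 × Fin 3 × Fin 3, (σ.1 ≠ σ.2.1 ∧ σ.1 ≠ σ.2.2 ∧ σ.2.1 ≠ σ.2.2) ∧
      ∃ (A B : Set ℂ) (c p d : ℂ), IsCompact A ∧ IsCompact B ∧ A ⊆ U ∧ B ⊆ U ∧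
        c ∈ D σ.1 ∧ p ∈ D σ.2.1 ∧ p ∈ U ∧ d ∈ D σ.2.2 ∧ JoinedIn A c p ∧ JoinedIn B p d ∧
        Disjoint A (D σ.2.2) ∧ Disjoint B (D σ.1) := by
  choose w hwD hwU using hDU
  have hpc : IsPathConnected U := (hUo.isConnected_iff_isPathConnected).mp hUc
  obtain ⟨γ, τ, hγU, hγτ⟩ := hpc.exists_path_through_family' w hwU
  obtain ⟨f, hf⟩ : ∃ f : ℝ → ℂ, f = γ.extend := ⟨_, rfl⟩
  have hfc : Continuous f := hf ▸ γ.continuous_extend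
  have hfU : ∀ t, f t ∈ U := fun t => by
    have : γ.extend t ∈ range γ.extend := ⟨t, rfl⟩
    rw [Path.extend_range] at this
    obtain ⟨u, hu⟩ := this
    rw [hf, ← hu]; exact hγU u
  have hfd : ∀ i j t, f t ∈ D i → f t ∈ D j → i = j := by
    intro i j t hi hj
    by_contra h
    exact Set.disjoint_left.mp (hDd i j h) hi hj
  -- first visiting times
  have hmin : ∀ i, ∃ m : ℝ, m ∈ Icc (0 : ℝ) 1 ∧ f m ∈ D i ∧
      ∀ t ∈ Icc (0 : ℝ) 1, f t ∈ D i → m ≤ t := by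
    intro i
    have hK : IsCompact (Icc (0 : ℝ) 1 ∩ f ⁻¹' D i) :=
      isCompact_Icc.inter_right ((hDc i).preimage hfc)
    have hN : (Icc (0 : ℝ) 1 ∩ f ⁻¹' D i).Nonempty := by
      refine ⟨τ i, (τ i).2, ?_⟩
      show f (τ i) ∈ D i
      rw [hf, Path.extend_apply γ (τ i).2]
      show γ (τ i) ∈ D i
      rw [hγτ i]; exact hwD i
    obtain ⟨m, hm, hm'⟩ := hK.exists_isLeast hN
    exact ⟨m, hm.1, hm.2, fun t ht ht' => hm' ⟨ht, ht'⟩⟩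
  choose m hm01 hmD hmle using hmin
  obtain ⟨k, hk⟩ := Finite.exists_max m
  set t := m k with ht
  have hmax : ∀ i, ∃ l : ℝ, l ∈ Icc (0 : ℝ) t ∧ f l ∈ D i ∧
      ∀ x ∈ Icc (0 : ℝ) t, f x ∈ D i → x ≤ l := by
    intro i
    have hK : IsCompact (Icc (0 : ℝ) t ∩ f ⁻¹' D i) :=
      isCompact_Icc.inter_right ((hDc i).preimage hfc)
    have hN : (Icc (0 : ℝ) t ∩ f ⁻¹' D i).Nonempty := ⟨m i, ⟨(hm01 i).1, hk i⟩, hmD i⟩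
    obtain ⟨l, hl, hl'⟩ := hK.exists_isGreatest hN
    exact ⟨l, hl.1, hl.2, fun x hx hx' => hl' ⟨hx, hx'⟩⟩
  choose l hl0t hlD hlge using hmax
  obtain ⟨i, hi, hil⟩ := Finset.exists_min_image (Finset.univ.erase k) l
    (by obtain ⟨i, hi⟩ := exists_ne k; exact ⟨i, by simp [hi]⟩)
  have hik : i ≠ k := by simpa using hi
  obtain ⟨j, hji, hjk⟩ : ∃ j : Fin 3, j ≠ i ∧ j ≠ k := by
    clear hil hi hk; clear_value t; clear ht hmle hlge; revert i k; decide
  have hil := hil j (by simp [hjk])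
  have h1t : t ≤ 1 := (hm01 k).2
  have hij' : l i ≤ l j := hil
  refine ⟨(i, j, k), ⟨hji.symm, hik, hjk⟩, f '' Icc (l i) (l j), f '' Icc (l j) t, f (l i),
    f (l j), f t, isCompact_Icc.image hfc, isCompact_Icc.image hfc, ?_, ?_, hlD i, hlD j, hfU _,
    hmD k, ?_, ?_, ?_, ?_⟩
  · rintro _ ⟨x, -, rfl⟩; exact hfU x
  · rintro _ ⟨x, -, rfl⟩; exact hfU x
  · have : IsPathConnected (f '' Icc (l i) (l j)) :=
      ((convex_Icc _ _).isPathConnected (nonempty_Icc.mpr hij')).image hfc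
    exact this.joinedIn _ ⟨_, left_mem_Icc.mpr hij', rfl⟩ _ ⟨_, right_mem_Icc.mpr hij', rfl⟩
  · have hjt := (hl0t j).2
    have : IsPathConnected (f '' Icc (l j) t) :=
      ((convex_Icc _ _).isPathConnected (nonempty_Icc.mpr hjt)).image hfc
    exact this.joinedIn _ ⟨_, left_mem_Icc.mpr hjt, rfl⟩ _ ⟨_, right_mem_Icc.mpr hjt, rfl⟩
  · rw [Set.disjoint_left]
    rintro _ ⟨x, hx, rfl⟩ hxk
    have h1 : t ≤ x := hmle k x ⟨(hl0t i).1.trans hx.1, (hx.2.trans (hl0t j).2).trans h1t⟩ hxk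
    have h2 : l j = t := le_antisymm (hl0t j).2 (h1.trans hx.2)
    exact hjk (hfd j k t (h2 ▸ hlD j) (hmD k))
  · rw [Set.disjoint_left]
    rintro _ ⟨x, hx, rfl⟩ hxi
    have h1 : x ≤ l i := hlge i x ⟨(hl0t j).1.trans hx.1, hx.2⟩ hxi
    have h2 : l j = l i := le_antisymm (hx.1.trans h1) hij'
    exact hji (hfd j i (l j) (hlD j) (h2 ▸ hlD i))

/-- Walking along a segment in a ball until one is about to leave `U`. -/
theorem bp_segment (U N : Set ℂ) (hUo : IsOpen U) (hN : IsOpen N) (x p : ℂ) (r : ℝ)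
    (hr : 0 ≤ r) (hp : p ∈ U) (hpD : p ∈ closedBall x r) (hx : x ∉ U)
    (hfr : ∀ z ∈ frontier U, z ∈ closedBall x r → z ∈ N) :
    ∃ q ∈ N, JoinedIn (U ∩ closedBall x r) p q := by
  set g : ℝ → ℂ := fun t => AffineMap.lineMap p x t with hg
  have hgc : Continuous g := AffineMap.lineMap_continuous
  have hgD : ∀ t ∈ Icc (0 : ℝ) 1, g t ∈ closedBall x r := fun t ht =>
    (convex_closedBall x r).lineMap_mem hpD (mem_closedBall_self hr) ht
  have hK : IsCompact (Icc (0 : ℝ) 1 ∩ g ⁻¹' Uᶜ) :=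
    isCompact_Icc.inter_right (hUo.isClosed_compl.preimage hgc)
  obtain ⟨t₀, ⟨ht01, ht0U⟩, htle⟩ := hK.exists_isLeast ⟨1, by simp, by simpa [hg] using hx⟩
  have hlt : ∀ t, 0 ≤ t → t < t₀ → g t ∈ U := by
    intro t h0 h1
    by_contra h
    exact absurd (htle ⟨⟨h0, h1.le.trans ht01.2⟩, h⟩) (not_le.mpr h1)
  have ht0 : 0 < t₀ := by
    rcases ht01.1.eq_or_lt with h | h
    · exfalso; apply ht0U; rw [← h]; simpa [hg] using hp
    · exact h
  have hfr0 : g t₀ ∈ frontier U := by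
    rw [hUo.frontier_eq]
    refine ⟨?_, ht0U⟩
    have h1 : Tendsto g (𝓝[<] t₀) (𝓝 (g t₀)) := (hgc.tendsto t₀).mono_left nhdsWithin_le_nhds
    refine mem_closure_of_tendsto h1 ?_
    filter_upwards [Ioo_mem_nhdsLT ht0] with t ht using hlt t ht.1.le ht.2
  have hN0 : g t₀ ∈ N := hfr _ hfr0 (hgD _ ht01)
  have hev : ∀ᶠ t in 𝓝[<] t₀, g t ∈ N ∧ t ∈ Ioo 0 t₀ :=
    ((hgc.continuousAt.eventually (hN.mem_nhds hN0)).filter_mono nhdsWithin_le_nhds).and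
      (Ioo_mem_nhdsLT ht0)
  obtain ⟨t, htN, ht⟩ := hev.exists
  refine ⟨g t, htN, ?_⟩
  have hpc : IsPathConnected (g '' Icc 0 t) :=
    ((convex_Icc _ _).isPathConnected (nonempty_Icc.mpr ht.1.le)).image hgc
  have hsub : g '' Icc 0 t ⊆ U ∩ closedBall x r := by
    rintro _ ⟨s, hs, rfl⟩
    exact ⟨hlt s hs.1 (hs.2.trans_lt ht.2), hgD s ⟨hs.1, (hs.2.trans ht.2.le).trans ht01.2⟩⟩
  exact (hpc.joinedIn p ⟨0, left_mem_Icc.mpr ht.1.le, by simp [hg]⟩ _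
    ⟨t, right_mem_Icc.mpr ht.1.le, rfl⟩).mono hsub

theorem bp_core (X : Set ℂ) (Y : Fin 3 → Set ℂ) (hYc : ∀ i, IsCompact (Y i))
    (hYp : ∀ i, IsPreconnected (Y i)) (hYX : ∀ i, Y i ⊆ X) (hXY : ∀ z ∈ X, ∃ i, z ∈ Y i)
    (x : Fin 3 → ℂ) (hxY : ∀ i, x i ∈ Y i) (r : ℝ) (hr : 0 ≤ r)
    (hxd : ∀ i j, i ≠ j → Disjoint (closedBall (x i) r) (Y j))
    (hxx : ∀ i j, i ≠ j → Disjoint (closedBall (x i) r) (closedBall (x j) r))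
    (U : ℕ → Set ℂ) (s : Set ℕ) (hs : s.Infinite) (hUo : ∀ n ∈ s, IsOpen (U n))
    (hUc : ∀ n ∈ s, IsConnected (U n)) (hUX : ∀ n ∈ s, Disjoint (U n) X)
    (hUf : ∀ n ∈ s, frontier (U n) ⊆ X)
    (hUU : ∀ n m, n ≠ m → Disjoint (U n) (U m))
    (hUD : ∀ n ∈ s, ∀ i, (closedBall (x i) r ∩ U n).Nonempty) : False := by
  have H := fun n : s => bp_path_order (U n) (hUo n n.2) (hUc n n.2) (fun i => closedBall (x i) r)
    (fun i => isClosed_closedBall) hxx (hUD n n.2)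
  choose σ hσ A B c p d hA hB hAU hBU hc hp hpU hd hAj hBj hAD hBD using H
  have := hs.to_subtype
  obtain ⟨⟨i, j, k⟩, hy⟩ := Finite.exists_infinite_fiber σ
  have e : ℕ ↪ σ ⁻¹' {(i, j, k)} := Infinite.natEmbedding _
  let n : Fin 3 → s := fun a => (e a.1).1
  have hnσ : ∀ a, σ (n a) = (i, j, k) := fun a => (e a.1).2
  have hninj : ∀ a b, a ≠ b → (n a : ℕ) ≠ n b := by
    intro a b hab h
    exact hab (Fin.ext (e.injective (Subtype.ext (Subtype.ext h))))
  have hUn : ∀ a b, a ≠ b → Disjoint (U (n a)) (U (n b)) := fun a b h => hUU _ _ (hninj a b h)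
  have hσ := hσ (n 0)
  simp only [hnσ] at hσ
  obtain ⟨hij, hik, hjk⟩ := hσ
  replace hc : ∀ a, c (n a) ∈ closedBall (x i) r := fun a => by simpa [hnσ a] using hc (n a)
  replace hp : ∀ a, p (n a) ∈ closedBall (x j) r := fun a => by simpa [hnσ a] using hp (n a)
  replace hd : ∀ a, d (n a) ∈ closedBall (x k) r := fun a => by simpa [hnσ a] using hd (n a)
  replace hAD : ∀ a, Disjoint (A (n a)) (closedBall (x k) r) := fun a => by
    simpa [hnσ a] using hAD (n a)
  replace hBD : ∀ a, Disjoint (B (n a)) (closedBall (x i) r) := fun a => by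
    simpa [hnσ a] using hBD (n a)
  let K : Set ℂ := (closedBall (x i) r ∪ closedBall (x k) r) ∪ ⋃ a, (A (n a) ∪ B (n a))
  have hK : IsClosed K := by
    refine (isClosed_closedBall.union isClosed_closedBall).union ?_
    exact isClosed_iUnion_of_finite fun a => (hA _).isClosed.union (hB _).isClosed
  have hYK : Y j ⊆ Kᶜ := by
    intro z hz hzK
    rcases hzK with (h | h) | h
    · exact Set.disjoint_left.mp (hxd i j hij) h hz
    · exact Set.disjoint_left.mp (hxd k j hjk.symm) h hz
    · obtain ⟨a, ha⟩ := mem_iUnion.mp h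
      exact Set.disjoint_left.mp (hUX (n a) (n a).2)
        (ha.elim (fun h => hAU _ h) (fun h => hBU _ h)) (hYX j hz)
  let N : Set ℂ := connectedComponentIn Kᶜ (x j)
  have hNo : IsOpen N := hK.isOpen_compl.connectedComponentIn
  have hYN : Y j ⊆ N := (hYp j).subset_connectedComponentIn (hxY j) hYK
  have hNc : IsConnected N := ⟨⟨x j, hYN (hxY j)⟩, isPreconnected_connectedComponentIn⟩
  have hNp : IsPathConnected N := hNo.isConnected_iff_isPathConnected.mp hNc
  have hNK : ∀ z ∈ N, z ∉ K := fun z hz => connectedComponentIn_subset _ _ hz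
  have hNi : Disjoint N (closedBall (x i) r) :=
    Set.disjoint_left.mpr fun z hz h => hNK z hz (Or.inl (Or.inl h))
  have hNk : Disjoint N (closedBall (x k) r) :=
    Set.disjoint_left.mpr fun z hz h => hNK z hz (Or.inl (Or.inr h))
  have hNA : ∀ a, Disjoint N (A (n a)) := fun a =>
    Set.disjoint_left.mpr fun z hz h => hNK z hz (Or.inr (mem_iUnion.mpr ⟨a, Or.inl h⟩))
  have hNB : ∀ a, Disjoint N (B (n a)) := fun a =>
    Set.disjoint_left.mpr fun z hz h => hNK z hz (Or.inr (mem_iUnion.mpr ⟨a, Or.inr h⟩))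
  have hseg : ∀ a, ∃ q ∈ N, JoinedIn (U (n a) ∩ closedBall (x j) r) (p (n a)) q := by
    intro a
    refine bp_segment (U (n a)) N (hUo _ (n a).2) hNo (x j) (p (n a)) r hr (hpU _) (hp a) ?_ ?_
    · intro h
      exact Set.disjoint_left.mp (hUX (n a) (n a).2) h (hYX j (hxY j))
    · intro z hz hzD
      obtain ⟨i', hi'⟩ := hXY z (hUf _ (n a).2 hz)
      by_cases h : j = i'
      · exact hYN (h ▸ hi')
      · exact absurd hi' (Set.disjoint_left.mp (hxd j i' h) hzD)
  choose q hqN hq using hseg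
  have hball : ∀ i, IsPathConnected (closedBall (x i) r) := fun i =>
    (convex_closedBall (x i) r).isPathConnected ⟨x i, mem_closedBall_self hr⟩
  let E0 : Fin 3 → Set ℂ := fun a => closedBall (x i) r ∪ A (n a)
  let E1 : Fin 3 → Set ℂ := fun a => N ∪ (U (n a) ∩ closedBall (x j) r)
  let E2 : Fin 3 → Set ℂ := fun a => closedBall (x k) r ∪ B (n a)
  have d01 : ∀ a b, a ≠ b → Disjoint (E0 a) (E1 b) := by
    intro a b hab
    refine Disjoint.union_left (Disjoint.union_right hNi.symm ?_)
      (Disjoint.union_right (hNA a).symm ?_)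
    · exact (hxx i j hij).mono_right inter_subset_right
    · exact (hUn a b hab).mono (hAU _) inter_subset_left
  have d21 : ∀ a b, a ≠ b → Disjoint (E2 a) (E1 b) := by
    intro a b hab
    refine Disjoint.union_left (Disjoint.union_right hNk.symm ?_)
      (Disjoint.union_right (hNB a).symm ?_)
    · exact (hxx k j hjk.symm).mono_right inter_subset_right
    · exact (hUn a b hab).mono (hBU _) inter_subset_left
  have d02 : ∀ a b, a ≠ b → Disjoint (E0 a) (E2 b) := by
    intro a b hab
    refine Disjoint.union_left (Disjoint.union_right (hxx i k hik) (hBD b).symm)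
      (Disjoint.union_right (hAD a) ?_)
    exact (hUn a b hab).mono (hAU _) (hBU _)
  refine bp_K33 ![x i, x j, x k] (fun a => p (n a)) ![E0, E1, E2] ?_ ?_
  · intro v a
    fin_cases v
    · exact (((hball i).joinedIn _ (mem_closedBall_self hr) _ (hc a)).mono
        subset_union_left).trans ((hAj (n a)).mono subset_union_right)
    · exact ((hNp.joinedIn _ (hYN (hxY j)) _ (hqN a)).mono
        subset_union_left).trans ((hq a).symm.mono subset_union_right)
    · exact (((hball k).joinedIn _ (mem_closedBall_self hr) _ (hd a)).mono
        subset_union_left).trans ((hBj (n a)).symm.mono subset_union_right)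
  · intro v w a b hvw hab
    fin_cases v <;> fin_cases w
    · exact absurd rfl hvw
    · exact d01 a b hab
    · exact d02 a b hab
    · exact (d01 b a hab.symm).symm
    · exact absurd rfl hvw
    · exact (d21 b a hab.symm).symm
    · exact (d02 b a hab.symm).symm
    · exact d21 a b hab
    · exact absurd rfl hvw

/-- **Burgess's planar theorem.** A planar continuum which is the Hausdorff limit
of the frontiers of a sequence of pairwise distinct complementary domains is
indecomposable or 2-indecomposable. -/
theorem burgess_planar
    (X : Set ℂ) (hX : IsContinuum X)
    (U : ℕ → Set ℂ) (hU : ∀ n, IsComplementaryDomain X (U n))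
    (hdistinct : ∀ m n, m ≠ n → U m ≠ U n)
    (hconv : HausdorffConvergesTo (fun n => frontier (U n)) X) :
    ¬ IsDecomposable X ∨ Is2Indecomposable X := by
  by_cases hdec : IsDecomposable X
  swap
  · exact Or.inl hdec
  refine Or.inr ⟨hdec, ?_⟩
  rintro ⟨X₁, X₂, X₃, h1, h2, h3, hun, n1, n2, n3⟩
  obtain ⟨x₁, hx₁, hx₁'⟩ := Set.not_subset.mp n1
  obtain ⟨x₂, hx₂, hx₂'⟩ := Set.not_subset.mp n2
  obtain ⟨x₃, hx₃, hx₃'⟩ := Set.not_subset.mp n3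
  have hXcl : IsClosed X := hX.1.isClosed
  let Y : Fin 3 → Set ℂ := ![X₁, X₂, X₃]
  let x : Fin 3 → ℂ := ![x₁, x₂, x₃]
  have hY : ∀ i, IsProperSubcontinuum X (Y i) := by
    intro i; fin_cases i
    exacts [h1, h2, h3]
  have hxY : ∀ i, x i ∈ Y i := by
    intro i; fin_cases i
    exacts [hx₁, hx₂, hx₃]
  have hxnY : ∀ i j, i ≠ j → x i ∉ Y j := by
    intro i j hij
    fin_cases i <;> fin_cases j
    · exact absurd rfl hij
    · exact fun h => hx₁' (Or.inl h)
    · exact fun h => hx₁' (Or.inr h)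
    · exact fun h => hx₂' (Or.inl h)
    · exact absurd rfl hij
    · exact fun h => hx₂' (Or.inr h)
    · exact fun h => hx₃' (Or.inl h)
    · exact fun h => hx₃' (Or.inr h)
    · exact absurd rfl hij
  have hXY : ∀ z ∈ X, ∃ i, z ∈ Y i := by
    intro z hz
    rw [← hun] at hz
    rcases hz with (h | h) | h
    exacts [⟨0, h⟩, ⟨1, h⟩, ⟨2, h⟩]
  -- the radius
  obtain ⟨δ, hδ, hδY⟩ : ∃ δ > 0, ∀ i j, i ≠ j → Disjoint (closedBall (x i) δ) (Y j) := by
    have hex : ∀ i j, ∃ δ > 0, i ≠ j → Disjoint (closedBall (x i) δ) (Y j) := by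
      intro i j
      by_cases hij : i = j
      · exact ⟨1, one_pos, fun h => absurd hij h⟩
      · obtain ⟨δ, hδ, h⟩ := Metric.nhds_basis_closedBall.mem_iff.mp
          ((hY j).2.1.isOpen_compl.mem_nhds (hxnY i j hij))
        exact ⟨δ, hδ, fun _ => Set.disjoint_left.mpr fun z hz => h hz⟩
    choose δ hδ hδY using hex
    obtain ⟨a, ha⟩ := Finite.exists_min (fun v : Fin 3 × Fin 3 => δ v.1 v.2)
    exact ⟨δ a.1 a.2, hδ _ _, fun i j hij =>
      (hδY i j hij).mono_left (closedBall_subset_closedBall (ha (i, j)))⟩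
  have hr : 0 < δ / 2 := half_pos hδ
  have hxd : ∀ i j, i ≠ j → Disjoint (closedBall (x i) (δ / 2)) (Y j) := fun i j hij =>
    (hδY i j hij).mono_left (closedBall_subset_closedBall (by linarith))
  have hxx : ∀ i j, i ≠ j →
      Disjoint (closedBall (x i) (δ / 2)) (closedBall (x j) (δ / 2)) := by
    intro i j hij
    apply closedBall_disjoint_closedBall
    have : x j ∉ closedBall (x i) δ := fun h =>
      Set.disjoint_left.mp (hδY i j hij) h (hxY j)
    rw [mem_closedBall, not_le, dist_comm] at this
    linarith
  -- facts about the domains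
  have hUo : ∀ n, IsOpen (U n) := by
    intro n
    obtain ⟨y, hy, h⟩ := hU n
    rw [h]; exact hXcl.isOpen_compl.connectedComponentIn
  have hUc : ∀ n, IsConnected (U n) := by
    intro n
    obtain ⟨y, hy, h⟩ := hU n
    rw [h]; exact isConnected_connectedComponentIn_iff.mpr hy
  have hUX : ∀ n, Disjoint (U n) X := by
    intro n
    obtain ⟨y, hy, h⟩ := hU n
    rw [h]; exact Set.disjoint_left.mpr fun z hz => connectedComponentIn_subset _ _ hz
  have hUeq : ∀ n z, z ∈ U n → U n = connectedComponentIn Xᶜ z := by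
    intro n z hz
    obtain ⟨y, hy, h⟩ := hU n
    rw [h] at hz ⊢
    exact connectedComponentIn_eq hz
  have hUU : ∀ n m, n ≠ m → Disjoint (U n) (U m) := by
    intro n m hnm
    refine Set.disjoint_left.mpr fun z hn hm => hdistinct n m hnm ?_
    rw [hUeq n z hn, hUeq m z hm]
  have hUf : ∀ n, frontier (U n) ⊆ X := by
    intro n z hz
    by_contra hzX
    have hV : IsOpen (connectedComponentIn Xᶜ z) := hXcl.isOpen_compl.connectedComponentIn
    have hzV : z ∈ connectedComponentIn Xᶜ z := mem_connectedComponentIn hzX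
    obtain ⟨w, hwV, hwU⟩ := mem_closure_iff.mp (frontier_subset_closure hz) _ hV hzV
    have : U n = connectedComponentIn Xᶜ z := by
      rw [hUeq n w hwU, connectedComponentIn_eq hwV]
    rw [(hUo n).frontier_eq] at hz
    exact hz.2 (this ▸ hzV)
  have hUne : ∀ n, (frontier (U n)).Nonempty := by
    intro n
    refine nonempty_frontier_iff.mpr ⟨(hUc n).nonempty, fun h => ?_⟩
    obtain ⟨z, hz⟩ := hX.2.nonempty
    exact Set.disjoint_left.mp (hUX n) (h ▸ mem_univ z) hz
  have hev : ∀ᶠ n in atTop, hausdorffDist (frontier (U n)) X < δ / 2 :=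
    hconv.eventually (gt_mem_nhds hr)
  have hs : {n | hausdorffDist (frontier (U n)) X < δ / 2}.Infinite :=
    Nat.frequently_atTop_iff_infinite.mp hev.frequently
  refine bp_core X Y (fun i => hX.1.of_isClosed_subset (hY i).2.1 (hY i).2.2.2.1)
    (fun i => (hY i).2.2.1.isPreconnected) (fun i => (hY i).2.2.2.1) hXY x hxY (δ / 2) hr.le
    hxd hxx U _ hs (fun n _ => hUo n) (fun n _ => hUc n) (fun n _ => hUX n) (fun n _ => hUf n)
    hUU ?_
  intro n hn i
  obtain ⟨z, hz, hzd⟩ := exists_dist_lt_of_hausdorffDist_lt' ((hY i).2.2.2.1 (hxY i)) hn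
    (hausdorffEDist_ne_top_of_nonempty_of_bounded (hUne n) hX.2.nonempty
      (hX.1.isBounded.subset (hUf n)) hX.1.isBounded)
  obtain ⟨w, hw, hwU⟩ := mem_closure_iff.mp (frontier_subset_closure hz) _ isOpen_ball
    (mem_ball.mpr hzd)
  exact ⟨w, ball_subset_closedBall hw, hwU⟩
end
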